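/- arXiv:1109.4497 — 3 statements merged into one kernel-verified Lean document; each statement's English description precedes it below -/
import Mathlib

section
/- Assume in addition that the Hamilton map F of q is diagonalizable. Let Ω ⊂ ℂ be a bounded set. There exist h₀ > 0 and A > 0 such that for all h ∈ (0, h₀], all z ∈ Ω with z ∉ Λ_h, and all Schwartz functions u on ℝⁿ, one has dist(z, Λ_h)·‖u‖_{L²(ℝⁿ)} ≤ A e^{A/h} ‖(q^w(x,hD_x) − z)u‖_{L²(ℝⁿ)}. (This is an a priori form of the resolvent bound ‖(q^w(x,hD_x) − z)^{-1}‖ ≤ A e^{A/h}/dist(z, Spec(q^w(x,hD_x))).) -/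
open MeasureTheory

/-- The quadratic form `q(x,ξ) = ⟨Ax,x⟩ + 2⟨Bx,ξ⟩ + ⟨Cξ,ξ⟩` on ℂⁿ×ℂⁿ. -/
noncomputable def qForm {n : ℕ} (A B C : Matrix (Fin n) (Fin n) ℂ)
    (x ξ : Fin n → ℂ) : ℂ :=
  (∑ j, ∑ k, A j k * x k * x j) + 2 * ∑ k, (∑ l, B k l * x l) * ξ k
    + ∑ j, ∑ k, C j k * ξ k * ξ j

/-- The symmetric bilinear polarization `q(X,Y)` of `q`, on `ℂ^{2n} = ℂⁿ ⊕ ℂⁿ`. -/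
noncomputable def qPolar {n : ℕ} (A B C : Matrix (Fin n) (Fin n) ℂ)
    (X Y : (Fin n ⊕ Fin n) → ℂ) : ℂ :=
  (∑ j, ∑ k, A j k * X (Sum.inl k) * Y (Sum.inl j))
    + (∑ k, (∑ l, B k l * X (Sum.inl l)) * Y (Sum.inr k))
    + (∑ k, (∑ l, B k l * Y (Sum.inl l)) * X (Sum.inr k))
    + ∑ j, ∑ k, C j k * X (Sum.inr k) * Y (Sum.inr j)

/-- The complex symplectic form `σ((x,ξ),(y,η)) = ⟨ξ,y⟩ − ⟨x,η⟩` on `ℂ^{2n}`. -/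
noncomputable def sympForm {n : ℕ} (X Y : (Fin n ⊕ Fin n) → ℂ) : ℂ :=
  (∑ j, X (Sum.inr j) * Y (Sum.inl j)) - ∑ j, X (Sum.inl j) * Y (Sum.inr j)

/-- The semiclassical Weyl quantization
`q^w(x,hD_x)u = ⟨Ax,x⟩u − h² Σ_{j,k} C_{jk} ∂²u/∂x_j∂x_k
 + (2h/i) Σ_k (Bx)_k ∂u/∂x_k + (h/i)(tr B)u`. -/
noncomputable def weylQuant {n : ℕ} (A B C : Matrix (Fin n) (Fin n) ℂ) (h : ℝ)
    (u : EuclideanSpace ℝ (Fin n) → ℂ) (x : EuclideanSpace ℝ (Fin n)) : ℂ :=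
  (∑ j, ∑ k, A j k * (x j : ℂ) * (x k : ℂ)) * u x
    - (h : ℂ) ^ 2 * ∑ j, ∑ k, C j k *
        fderiv ℝ (fun y => fderiv ℝ u y (EuclideanSpace.single k 1)) x
          (EuclideanSpace.single j 1)
    + (2 * (h : ℂ) / Complex.I) * ∑ k, (∑ l, B k l * (x l : ℂ)) *
        fderiv ℝ u x (EuclideanSpace.single k 1)
    + ((h : ℂ) / Complex.I) * (∑ j, B j j) * u x

/-- The `L²(ℝⁿ)`-norm of a function. -/
noncomputable def l2Norm {n : ℕ} (f : EuclideanSpace ℝ (Fin n) → ℂ) : ℝ :=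
  Real.sqrt (∫ x : EuclideanSpace ℝ (Fin n), ‖f x‖ ^ 2)

/-- The set `Λ_h = {(h/i) Σ_j λ_j(2ν_j+1) : ν ∈ ℕⁿ}`, which is the spectrum of
`q^w(x,hD_x)`. -/
noncomputable def specSet {n : ℕ} (lam : Fin n → ℂ) (h : ℝ) : Set ℂ :=
  {w | ∃ ν : Fin n → ℕ, w = (h : ℂ) / Complex.I * ∑ j, lam j * (2 * (ν j : ℂ) + 1)}



section AbstractHilbert
variable {H : Type*} [NormedAddCommGroup H] [InnerProductSpace ℂ H]

lemma hasDerivAt_expSum {ι : Type*} [Fintype ι] (v : ι → H) (κ c : ι → ℂ) (t : ℝ) :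
    HasDerivAt (fun t : ℝ => ∑ i, (Complex.exp (t * κ i) * c i) • v i)
      (∑ i, (κ i * (Complex.exp (t * κ i) * c i)) • v i) t := by
  refine HasDerivAt.fun_sum fun i _ => ?_
  have h1 : HasDerivAt (fun t : ℝ => Complex.exp (t * κ i) * c i)
      (κ i * (Complex.exp (t * κ i) * c i)) t := by
    have h2 : HasDerivAt (fun t : ℝ => (t : ℂ) * κ i) (1 * κ i) t :=
      (Complex.ofRealCLM.hasDerivAt (x := t)).mul_const _
    have := (h2.cexp).mul_const (c i)
    exact this.congr_deriv (by ring)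
  exact h1.smul_const (v i)

lemma contraction_expSum {ι : Type*} [Fintype ι] (v : ι → H) (κ : ι → ℂ)
    (hκ : ∀ c : ι → ℂ, (inner ℂ (∑ i, c i • v i) (∑ i, (κ i * c i) • v i)).re ≤ 0)
    (c : ι → ℂ) {t : ℝ} (ht : 0 ≤ t) :
    ‖∑ i, (Complex.exp (t * κ i) * c i) • v i‖ ≤ ‖∑ i, c i • v i‖ := by
  set g : ℝ → H := fun t => ∑ i, (Complex.exp (t * κ i) * c i) • v i with hg
  have hd : ∀ t : ℝ, HasDerivAt (fun t => (inner ℂ (g t) (g t)).re)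
      (2 * (inner ℂ (g t) (∑ i, (κ i * (Complex.exp (t * κ i) * c i)) • v i)).re) t := by
    intro t
    have h1 := (hasDerivAt_expSum v κ c t)
    have h2 := HasDerivAt.inner ℂ h1 h1
    have h3 := Complex.reCLM.hasFDerivAt.comp_hasDerivAt t h2
    refine HasDerivAt.congr_deriv (f := fun t => (inner ℂ (g t) (g t)).re) h3 ?_
    simp only [Complex.reCLM_apply, Complex.add_re]
    rw [← inner_conj_symm (∑ i, (κ i * (Complex.exp (t * κ i) * c i)) • v i), Complex.conj_re]
    ring
  have hanti : Antitone (fun t => (inner ℂ (g t) (g t)).re) := by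
    refine antitone_of_deriv_nonpos (fun t => (hd t).differentiableAt) fun t => ?_
    rw [(hd t).deriv]
    have := hκ (fun i => Complex.exp (t * κ i) * c i)
    linarith
  have h0 := hanti ht
  simp only [inner_self_eq_norm_sq_to_K] at h0
  have e : g 0 = ∑ i, c i • v i := by simp [hg]
  rw [e] at h0
  have h1 : ‖g t‖ ^ 2 ≤ ‖∑ i, c i • v i‖ ^ 2 := by
    norm_cast at h0
  exact (pow_le_pow_iff_left₀ (norm_nonneg _) (norm_nonneg _) two_ne_zero).1 h1

lemma root_orth (M : ℕ) (a b : Fin M) :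
    ∑ k : Fin M, Complex.exp (2 * Real.pi * Complex.I * (k : ℕ) * ((a : ℕ) - (b : ℕ)) / M)
      = if a = b then (M : ℂ) else 0 := by
  have hM : (M : ℂ) ≠ 0 := by
    have := a.pos
    exact_mod_cast this.ne'
  split_ifs with hab
  · subst hab; simp
  · set ζ := Complex.exp (2 * Real.pi * Complex.I * ((a : ℕ) - (b : ℕ)) / M) with hζ
    have h1 : ∀ k : Fin M, Complex.exp (2 * Real.pi * Complex.I * (k : ℕ) * ((a : ℕ) - (b : ℕ)) / M)
        = ζ ^ (k : ℕ) := by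
      intro k
      rw [hζ, ← Complex.exp_nat_mul]
      congr 1; ring
    simp_rw [h1]
    rw [Fin.sum_univ_eq_sum_range (fun k => ζ ^ k)]
    have hpow : ζ ^ M = 1 := by
      rw [hζ, ← Complex.exp_nat_mul, Complex.exp_eq_one_iff]
      refine ⟨(a : ℤ) - (b : ℤ), ?_⟩
      push_cast
      field_simp
    have hne : ζ ≠ 1 := by
      intro h
      rw [hζ, Complex.exp_eq_one_iff] at h
      obtain ⟨m, hm⟩ := h
      have h2 : (2 * Real.pi * Complex.I : ℂ) ≠ 0 := Complex.two_pi_I_ne_zero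
      have h3 : ((a : ℕ) - (b : ℕ) : ℂ) = m * M := by
        field_simp at hm
        have := mul_left_cancel₀ h2 (by linear_combination (2 * Real.pi * Complex.I) * hm : (2 * Real.pi * Complex.I : ℂ) * ((a : ℕ) - (b : ℕ) : ℂ) = (2 * Real.pi * Complex.I) * (m * M))
        exact this
      have h4 : ((a : ℕ) : ℤ) - ((b : ℕ) : ℤ) = m * M := by exact_mod_cast h3
      have ha := a.2
      have hb := b.2
      have h5 : m = 0 := by
        by_contra hm0
        have : (M : ℤ) ≤ |m * M| := by
          rw [abs_mul]
          have : 1 ≤ |m| := Int.one_le_abs hm0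
          have h7 : |(M : ℤ)| = M := abs_of_nonneg (by positivity)
          nlinarith [abs_nonneg (M : ℤ)]
        rw [← h4] at this
        have h6 := abs_lt.2 (⟨by omega, by omega⟩ : -(M : ℤ) < (a : ℤ) - b ∧ ((a : ℤ) - b < M))
        omega
      rw [h5] at h4
      apply hab
      ext
      omega
    exact (mul_eq_zero.1 (by rw [mul_geom_sum, hpow, sub_self] : (ζ - 1) * _ = 0)).resolve_left
      (sub_ne_zero.2 hne)

/-- the model rate -/
noncomputable def rate {n : ℕ} (s : Fin n → ℂ) (ν : Fin n → ℕ) : ℂ :=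
  Complex.I * ∑ j, s j * (2 * (ν j : ℂ) + 1)

lemma coeff_bound {n M : ℕ} (lam : Fin n → ℂ) (δ : ℝ) (hδ : 0 < δ)
    (v : (Fin n → Fin M) → H)
    (hacc : ∀ θ : Fin n → ℝ, (∀ j, 0 ≤ θ j ∧ θ j ≤ δ) → ∀ c : (Fin n → Fin M) → ℂ,
      (inner ℂ (∑ ν, c ν • v ν)
        (∑ ν, (rate (fun j => lam j + θ j) (fun j => ν j) * c ν) • v ν)).re ≤ 0)
    (c : (Fin n → Fin M) → ℂ) (ν₀ : Fin n → Fin M) :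
    ‖c ν₀ • v ν₀‖ ≤ Real.exp (-(Real.pi / δ * (rate lam (fun j => ν₀ j)).re)) *
      ‖∑ ν, c ν • v ν‖ := by
  have hT : 0 ≤ Real.pi / δ := by positivity
  set T := Real.pi / δ with hTdef
  set θ : (Fin n → Fin M) → Fin n → ℝ := fun k j => δ * (k j : ℕ) / M with hθ
  have hθb : ∀ k j, 0 ≤ θ k j ∧ θ k j ≤ δ := by
    intro k j
    have h1 : ((k j : ℕ) : ℝ) ≤ M := by exact_mod_cast (k j).2.le
    have h2 : (0 : ℝ) < M := by exact_mod_cast (k j).pos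
    refine ⟨by simp only [hθ]; positivity, ?_⟩
    simp only [hθ]
    rw [div_le_iff₀ h2]
    nlinarith
  set S := ‖∑ ν, c ν • v ν‖ with hS
  have hbd : ∀ k, ‖∑ ν, (Complex.exp (T * rate (fun j => lam j + θ k j) (fun j => ν j)) * c ν) • v ν‖
      ≤ S := fun k => contraction_expSum v _ (hacc (θ k) (hθb k)) c hT
  set ω : (Fin n → Fin M) → ℂ := fun k =>
    Complex.exp (-(T * (Complex.I * ∑ j, (θ k j : ℂ) * (2 * ((ν₀ j : ℕ) : ℂ) + 1)))) with hω
  have hωn : ∀ k, ‖ω k‖ = 1 := by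
    intro k
    have : -(T * (Complex.I * ∑ j, (θ k j : ℂ) * (2 * ((ν₀ j : ℕ) : ℂ) + 1)))
      = ((-(T * ∑ j, θ k j * (2 * (ν₀ j : ℕ) + 1)) : ℝ) : ℂ) * Complex.I := by
      push_cast; ring
    simp only [hω]
    rw [this, Complex.norm_exp_ofReal_mul_I]
  have key : ∑ k, ω k • ∑ ν, (Complex.exp (T * rate (fun j => lam j + θ k j) (fun j => ν j)) * c ν) • v ν
      = ((M : ℂ) ^ n * Complex.exp (T * rate lam (fun j => ν₀ j))) • (c ν₀ • v ν₀) := by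
    simp_rw [Finset.smul_sum, smul_smul]
    rw [Finset.sum_comm]
    have h1 : ∀ ν : Fin n → Fin M, ∑ k, (ω k *
        (Complex.exp (T * rate (fun j => lam j + θ k j) (fun j => ν j)) * c ν)) • v ν
        = (if ν = ν₀ then (M : ℂ) ^ n else 0) • (Complex.exp (T * rate lam (fun j => ν j)) • (c ν • v ν)) := by
      intro ν
      have h2 : ∀ k, ω k * (Complex.exp (T * rate (fun j => lam j + θ k j) (fun j => ν j)) * c ν)
          = (∏ j, Complex.exp (2 * Real.pi * Complex.I * (k j : ℕ) * ((ν j : ℕ) - (ν₀ j : ℕ)) / M))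
            * (Complex.exp (T * rate lam (fun j => ν j)) * c ν) := by
        intro k
        rw [← Complex.exp_sum, ← mul_assoc, ← mul_assoc]
        simp only [hω]
        rw [← Complex.exp_add, ← Complex.exp_add]
        congr 2
        unfold rate
        simp only [Finset.mul_sum, ← Finset.sum_neg_distrib, ← Finset.sum_add_distrib]
        refine Finset.sum_congr rfl fun j _ => ?_
        simp only [hθ, hTdef]
        have hM : (M : ℂ) ≠ 0 := by
          have := (k j).pos
          exact_mod_cast this.ne'
        have hδ' : (δ : ℂ) ≠ 0 := by exact_mod_cast hδ.ne'
        push_cast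
        field_simp
        ring
      simp_rw [h2]
      rw [← Finset.sum_smul, ← Finset.sum_mul]
      have h3 : ∑ k : Fin n → Fin M, ∏ j, Complex.exp (2 * Real.pi * Complex.I * (k j : ℕ) * ((ν j : ℕ) - (ν₀ j : ℕ)) / M)
          = if ν = ν₀ then (M : ℂ) ^ n else 0 := by
        have := Finset.prod_univ_sum (fun _ : Fin n => (Finset.univ : Finset (Fin M)))
          (fun j k => Complex.exp (2 * Real.pi * Complex.I * (k : ℕ) * ((ν j : ℕ) - (ν₀ j : ℕ)) / M))
        rw [Fintype.piFinset_univ] at this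
        rw [← this]
        simp_rw [root_orth]
        split_ifs with h
        · subst h; simp
        · obtain ⟨j, hj⟩ := Function.ne_iff.1 h
          exact Finset.prod_eq_zero (Finset.mem_univ j) (by simp [hj])
      rw [h3, smul_smul, smul_smul, mul_assoc]
    simp_rw [h1]
    simp [ite_smul, smul_smul, mul_assoc]
  have hn1 : ‖((M : ℂ) ^ n * Complex.exp (T * rate lam (fun j => ν₀ j))) • (c ν₀ • v ν₀)‖
      ≤ (M : ℝ) ^ n * S := by
    rw [← key]
    refine (norm_sum_le _ _).trans ?_
    calc _ ≤ ∑ k : Fin n → Fin M, S := by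
          refine Finset.sum_le_sum fun k _ => ?_
          rw [norm_smul, hωn, one_mul]
          exact hbd k
      _ = _ := by simp
  have hMpos : (0 : ℝ) < (M : ℝ) ^ n := by
    rcases Nat.eq_zero_or_pos n with h | h
    · subst h; simp
    · have := (ν₀ ⟨0, h⟩).pos
      have : (0 : ℝ) < M := by exact_mod_cast this
      positivity
  rw [norm_smul, norm_mul, Complex.norm_exp] at hn1
  simp only [norm_pow, Complex.norm_natCast] at hn1
  have h5 : Real.exp ((T * rate lam (fun j => ν₀ j)).re) * ‖c ν₀ • v ν₀‖ ≤ S := by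
    rw [mul_assoc] at hn1
    exact le_of_mul_le_mul_left hn1 hMpos
  rw [Complex.re_ofReal_mul] at h5
  rw [Real.exp_neg, inv_mul_eq_div, le_div_iff₀ (Real.exp_pos _)]
  linarith

lemma rate_re {n : ℕ} (lam : Fin n → ℂ) (ν : Fin n → ℕ) :
    (rate lam ν).re = -∑ j, (lam j).im * (2 * (ν j : ℝ) + 1) := by
  simp [rate, Complex.mul_im]

lemma box_sum_bound {n M : ℕ} (lam : Fin n → ℂ) (hlam : ∀ j, 0 < (lam j).im) (T : ℝ) (hT : 0 < T) :
    ∑ ν : Fin n → Fin M, Real.exp (T * (rate lam (fun j => ν j)).re) ≤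
      ∏ j, (1 - Real.exp (-(2 * T * (lam j).im)))⁻¹ := by
  have h1 : ∀ ν : Fin n → Fin M, Real.exp (T * (rate lam (fun j => ν j)).re) ≤
      ∏ j, Real.exp (-(2 * T * (lam j).im)) ^ (ν j : ℕ) := by
    intro ν
    simp_rw [← Real.exp_nat_mul]
    rw [← Real.exp_sum, Real.exp_le_exp, rate_re, mul_neg, Finset.mul_sum, ← Finset.sum_neg_distrib]
    refine Finset.sum_le_sum fun j _ => ?_
    have := mul_pos hT (hlam j)
    nlinarith
  refine (Finset.sum_le_sum fun ν _ => h1 ν).trans ?_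
  have := Finset.prod_univ_sum (fun _ : Fin n => (Finset.univ : Finset (Fin M)))
          (fun j k => Real.exp (-(2 * T * (lam j).im)) ^ (k : ℕ))
  rw [Fintype.piFinset_univ] at this
  rw [← this]
  refine Finset.prod_le_prod (fun j _ => Finset.sum_nonneg fun k _ => by positivity) fun j _ => ?_
  have hr : Real.exp (-(2 * T * (lam j).im)) < 1 := by
    rw [Real.exp_lt_one_iff]
    have := mul_pos hT (hlam j)
    linarith
  rw [Fin.sum_univ_eq_sum_range (fun k => Real.exp (-(2 * T * (lam j).im)) ^ k)]
  rw [← tsum_geometric_of_lt_one (Real.exp_pos _).le hr]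
  exact (summable_geometric_of_lt_one (Real.exp_pos _).le hr).sum_le_tsum _
    (fun _ _ => by positivity)

lemma main_abstract {n M : ℕ} (lam : Fin n → ℂ) (hlam : ∀ j, 0 < (lam j).im)
    (δ : ℝ) (hδ : 0 < δ) (v : (Fin n → Fin M) → H)
    (hacc : ∀ θ : Fin n → ℝ, (∀ j, 0 ≤ θ j ∧ θ j ≤ δ) → ∀ c : (Fin n → Fin M) → ℂ,
      (inner ℂ (∑ ν, c ν • v ν)
        (∑ ν, (rate (fun j => lam j + θ j) (fun j => ν j) * c ν) • v ν)).re ≤ 0)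
    (c : (Fin n → Fin M) → ℂ) (h : ℝ) (hh : 0 < h) (z : ℂ) (R : ℝ) (hR : ‖z‖ ≤ R)
    (d : ℝ) (hd : 0 < d)
    (hdν : ∀ ν : Fin n → ℕ, d ≤ ‖-(h * rate lam ν) - z‖) :
    ‖∑ ν, (c ν / (-(h * rate lam (fun j => ν j)) - z)) • v ν‖ ≤
      Real.exp (2 * Real.pi / δ * R / h) *
        ((∏ j, (1 - Real.exp (-(2 * (Real.pi / δ) * (lam j).im)))⁻¹) / d + 2 * Real.pi / δ / h) *
        ‖∑ ν, c ν • v ν‖ := by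
  set C0 := ∏ j, (1 - Real.exp (-(2 * (Real.pi / δ) * (lam j).im)))⁻¹ with hC0
  set S := ‖∑ ν, c ν • v ν‖ with hS
  set T := 2 * Real.pi / δ with hTd
  have hT : 0 < T := by positivity
  have hR0 : 0 ≤ R := (norm_nonneg _).trans hR
  set a : (Fin n → Fin M) → ℂ := fun ν => c ν / (-(h * rate lam (fun j => ν j)) - z) with ha
  set κ : (Fin n → Fin M) → ℂ := fun ν => z / h + rate lam (fun j => ν j) with hκ
  set y : ℝ → H := fun t => ∑ ν, (Complex.exp (t * κ ν) * a ν) • v ν with hy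
  have hhc : (h : ℂ) ≠ 0 := by exact_mod_cast hh.ne'
  have hne : ∀ ν : Fin n → Fin M, -(h * rate lam (fun j => ν j)) - z ≠ 0 := by
    intro ν h0
    have := hdν (fun j => ν j)
    rw [h0, norm_zero] at this
    linarith
  have hcon : ∀ t : ℝ, 0 ≤ t → ‖∑ ν, (Complex.exp (t * rate lam (fun j => ν j)) * c ν) • v ν‖ ≤ S := by
    intro t ht
    have h0 := hacc 0 (fun j => ⟨le_rfl, hδ.le⟩)
    simp only [Pi.zero_apply, Complex.ofReal_zero, add_zero] at h0
    exact contraction_expSum v _ h0 c ht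
  have hexp : ∀ t : ℝ, 0 ≤ t → t ≤ T → ‖Complex.exp (t * (z / h))‖ ≤ Real.exp (T * R / h) := by
    intro t ht htT
    refine (Complex.norm_exp_le_exp_norm _).trans ?_
    rw [Real.exp_le_exp, norm_mul, norm_div, Complex.norm_real, Complex.norm_real,
      Real.norm_of_nonneg ht, Real.norm_of_nonneg hh.le, mul_div_assoc]
    gcongr
  have hder : ∀ t : ℝ, HasDerivAt y (∑ ν, (κ ν * (Complex.exp (t * κ ν) * a ν)) • v ν) t :=
    fun t => hasDerivAt_expSum v κ a t
  have hder_eq : ∀ t : ℝ, (∑ ν, (κ ν * (Complex.exp (t * κ ν) * a ν)) • v ν)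
      = (-(1 / h) * Complex.exp (t * (z / h)) : ℂ) •
        ∑ ν, (Complex.exp (t * rate lam (fun j => ν j)) * c ν) • v ν := by
    intro t
    rw [Finset.smul_sum]
    refine Finset.sum_congr rfl fun ν _ => ?_
    rw [smul_smul]
    congr 1
    have e1 : Complex.exp (t * κ ν) = Complex.exp (t * (z / h)) * Complex.exp (t * rate lam (fun j => ν j)) := by
      rw [← Complex.exp_add]; congr 1; simp only [hκ]; ring
    have e2 : κ ν * a ν = -(1 / h) * c ν := by
      simp only [hκ, ha]
      have := hne ν
      field_simp
      ring
    rw [e1]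
    linear_combination (Complex.exp (t * (z / h)) * Complex.exp (t * rate lam (fun j => ν j))) * e2
  have hmv : ‖y T - y 0‖ ≤ (1 / h * Real.exp (T * R / h) * S) * (T - 0) := by
    refine norm_image_sub_le_of_norm_deriv_le_segment' (f := y)
      (fun t ht => (hder t).hasDerivWithinAt) ?_ T ⟨hT.le, le_rfl⟩
    intro t ht
    rw [hder_eq t, norm_smul, norm_mul]
    have : ‖(-(1 / h) : ℂ)‖ = 1 / h := by
      rw [norm_neg, norm_div, Complex.norm_real, Real.norm_of_nonneg hh.le]; simp
    rw [this]
    have := hcon t ht.1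
    have := hexp t ht.1 ht.2.le
    gcongr
  have hyT : ‖y T‖ ≤ Real.exp (T * R / h) * (C0 / d) * S := by
    refine (norm_sum_le _ _).trans ?_
    have hterm : ∀ ν : Fin n → Fin M, ‖(Complex.exp (T * κ ν) * a ν) • v ν‖ ≤
        Real.exp (T * R / h) * (1 / d) * S * Real.exp (Real.pi / δ * (rate lam (fun j => ν j)).re) := by
      intro ν
      have e1 : (Complex.exp (T * κ ν) * a ν) • v ν =
          (Complex.exp (T * (z / h)) * Complex.exp (T * rate lam (fun j => ν j)) *
            (1 / (-(h * rate lam (fun j => ν j)) - z))) • (c ν • v ν) := by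
        rw [smul_smul, ← Complex.exp_add]
        congr 1
        have : (T : ℂ) * κ ν = T * (z / h) + T * rate lam (fun j => ν j) := by simp only [hκ]; ring
        rw [this]
        simp only [ha]; ring
      have h1 := coeff_bound lam δ hδ v hacc c ν
      have h2 := hexp T hT.le le_rfl
      have h3 : ‖Complex.exp (T * rate lam (fun j => ν j))‖ = Real.exp (T * (rate lam (fun j => ν j)).re) := by
        rw [Complex.norm_exp, Complex.re_ofReal_mul]
      have h4 : ‖1 / (-(h * rate lam (fun j => ν j)) - z)‖ ≤ 1 / d := by
        rw [norm_div, norm_one]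
        exact one_div_le_one_div_of_le hd (hdν _)
      rw [e1, norm_smul, norm_mul, norm_mul, h3]
      calc _ ≤ Real.exp (T * R / h) * Real.exp (T * (rate lam (fun j => ν j)).re) * (1 / d) *
            (Real.exp (-(Real.pi / δ * (rate lam (fun j => ν j)).re)) * S) := by gcongr
        _ = Real.exp (T * R / h) * (1 / d) * S * (Real.exp (T * (rate lam (fun j => ν j)).re) * Real.exp (-(Real.pi / δ * (rate lam (fun j => ν j)).re))) := by ring
        _ = _ := by
          rw [← Real.exp_add]
          congr 2
          simp only [hTd]; ring
    refine (Finset.sum_le_sum fun ν _ => hterm ν).trans ?_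
    rw [← Finset.mul_sum]
    have := box_sum_bound (M := M) lam hlam (Real.pi / δ) (by positivity)
    calc _ ≤ Real.exp (T * R / h) * (1 / d) * S * C0 := by gcongr
      _ = _ := by ring
  have hy0 : y 0 = ∑ ν, a ν • v ν := by simp [hy]
  rw [← hy0]
  calc ‖y 0‖ = ‖y T - (y T - y 0)‖ := by congr 1; abel
    _ ≤ ‖y T‖ + ‖y T - y 0‖ := norm_sub_le _ _
    _ ≤ _ := add_le_add hyT hmv
    _ = _ := by ring

end AbstractHilbert


lemma exists_equiv_of_map_eq {ι α : Type*} [Fintype ι] [DecidableEq α] (d d' : ι → α)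
    (h : Multiset.map d Finset.univ.val = Multiset.map d' Finset.univ.val) :
    ∃ π : ι ≃ ι, ∀ i, d (π i) = d' i := by
  have hc : ∀ a, Nonempty ({i // d' i = a} ≃ {i // d i = a}) := by
    intro a
    rw [← Fintype.card_eq, Fintype.card_subtype, Fintype.card_subtype]
    have := congrArg (Multiset.count a) h
    rw [Multiset.count_map, Multiset.count_map] at this
    simp only [eq_comm (a := a)] at this
    exact this.symm
  exact ⟨Equiv.ofFiberEquiv fun a => (hc a).some, fun i => Equiv.ofFiberEquiv_map _ i⟩

section LinAlg
variable {n : ℕ}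

/-- bilinear version of the symplectic form -/
noncomputable def sympB (n : ℕ) : (Fin n ⊕ Fin n → ℂ) →ₗ[ℂ] (Fin n ⊕ Fin n → ℂ) →ₗ[ℂ] ℂ :=
  LinearMap.mk₂ ℂ sympForm
    (by intro X Y Z; simp only [sympForm, Pi.add_apply, add_mul, Finset.sum_add_distrib]; ring)
    (by intro c X Y; simp only [sympForm, Pi.smul_apply, smul_eq_mul, mul_assoc, ← Finset.mul_sum]; ring)
    (by intro X Y Z; simp only [sympForm, Pi.add_apply, mul_add, Finset.sum_add_distrib]; ring)
    (by intro c X Y; simp only [sympForm, Pi.smul_apply, smul_eq_mul, mul_left_comm _ c, ← Finset.mul_sum]; ring)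

@[simp] lemma sympB_apply (X Y : Fin n ⊕ Fin n → ℂ) : sympB n X Y = sympForm X Y := rfl

lemma sympForm_swap (X Y : Fin n ⊕ Fin n → ℂ) : sympForm X Y = -sympForm Y X := by
  simp only [sympForm, mul_comm]; ring

lemma sympForm_nondeg (Y : Fin n ⊕ Fin n → ℂ) (h : ∀ X, sympForm X Y = 0) : Y = 0 := by
  funext a
  rcases a with j | j
  · have := h (Pi.single (Sum.inr j) 1)
    simpa [sympForm, Pi.single_apply] using this
  · have := h (Pi.single (Sum.inl j) 1)
    simpa [sympForm, Pi.single_apply] using this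

lemma sympForm_sum_left {ι : Type*} (s : Finset ι) (g : ι → Fin n ⊕ Fin n → ℂ) (Y) :
    sympForm (∑ i ∈ s, g i) Y = ∑ i ∈ s, sympForm (g i) Y := by
  simp only [← sympB_apply, map_sum, LinearMap.sum_apply]

lemma sympForm_sum_right {ι : Type*} (s : Finset ι) (g : ι → Fin n ⊕ Fin n → ℂ) (Y) :
    sympForm Y (∑ i ∈ s, g i) = ∑ i ∈ s, sympForm Y (g i) := by
  simp only [← sympB_apply, map_sum]

lemma sympForm_add_left (X Y Z : Fin n ⊕ Fin n → ℂ) :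
    sympForm (X + Y) Z = sympForm X Z + sympForm Y Z := by
  simp only [← sympB_apply, map_add, LinearMap.add_apply]
lemma sympForm_add_right (X Y Z : Fin n ⊕ Fin n → ℂ) :
    sympForm Z (X + Y) = sympForm Z X + sympForm Z Y := by
  simp only [← sympB_apply, map_add]
lemma sympForm_sub_right (X Y Z : Fin n ⊕ Fin n → ℂ) :
    sympForm Z (X - Y) = sympForm Z X - sympForm Z Y := by
  simp only [← sympB_apply, map_sub]
lemma sympForm_smul_left (c : ℂ) (X Y : Fin n ⊕ Fin n → ℂ) :
    sympForm (c • X) Y = c * sympForm X Y := by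
  simp only [← sympB_apply, map_smul, LinearMap.smul_apply, smul_eq_mul]
lemma sympForm_smul_right (c : ℂ) (X Y : Fin n ⊕ Fin n → ℂ) :
    sympForm X (c • Y) = c * sympForm X Y := by
  simp only [← sympB_apply, map_smul, smul_eq_mul]

/-- real vectors inside complex ones -/
def toC (X : Fin n ⊕ Fin n → ℝ) : Fin n ⊕ Fin n → ℂ := fun a => (X a : ℂ)

/-- Symplectic normal form data. -/
structure NF (e f : Fin n → (Fin n ⊕ Fin n → ℂ)) (lam : Fin n → ℂ) : Prop where
  him : ∀ j, 0 < (lam j).im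
  ee : ∀ j k, sympForm (e j) (e k) = 0
  ff : ∀ j k, sympForm (f j) (f k) = 0
  ef : ∀ j k, sympForm (e j) (f k) = if j = k then 1 else 0
  span : ∀ X, X = ∑ j, (sympForm X (f j) • e j + sympForm (e j) X • f j)
  pos : ∀ X : Fin n ⊕ Fin n → ℝ, X ≠ 0 →
    0 < (∑ j, lam j * (sympForm (f j) (toC X) * sympForm (e j) (toC X))).re

lemma qPolar_symm (A B C : Matrix (Fin n) (Fin n) ℂ) (hAs : A.IsSymm) (hCs : C.IsSymm)
    (X Y : Fin n ⊕ Fin n → ℂ) : qPolar A B C X Y = qPolar A B C Y X := by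
  unfold qPolar
  have h1 : ∀ (M : Matrix (Fin n) (Fin n) ℂ), M.IsSymm → ∀ x y : Fin n → ℂ,
      (∑ j, ∑ k, M j k * x k * y j) = ∑ j, ∑ k, M j k * y k * x j := by
    intro M hM x y
    rw [Finset.sum_comm]
    refine Finset.sum_congr rfl fun j _ => Finset.sum_congr rfl fun k _ => ?_
    rw [hM.apply k j]
    ring
  have e1 := h1 A hAs (fun k => X (Sum.inl k)) (fun k => Y (Sum.inl k))
  have e2 := h1 C hCs (fun k => X (Sum.inr k)) (fun k => Y (Sum.inr k))
  linear_combination e1 + e2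

lemma qPolar_self (A B C : Matrix (Fin n) (Fin n) ℂ) (X : Fin n ⊕ Fin n → ℂ) :
    qPolar A B C X X = qForm A B C (fun j => X (Sum.inl j)) (fun j => X (Sum.inr j)) := by
  unfold qPolar qForm
  ring

lemma exists_eigenbasis (F : Matrix (Fin n ⊕ Fin n) (Fin n ⊕ Fin n) ℂ)
    (hdiag : ∃ P : Matrix (Fin n ⊕ Fin n) (Fin n ⊕ Fin n) ℂ, IsUnit P ∧
      ∃ d : (Fin n ⊕ Fin n) → ℂ, F = P * Matrix.diagonal d * P⁻¹)
    (lam : Fin n → ℂ)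
    (hchar : F.charpoly =
      ∏ j, ((Polynomial.X - Polynomial.C (lam j)) * (Polynomial.X + Polynomial.C (lam j)))) :
    ∃ g : Module.Basis (Fin n ⊕ Fin n) ℂ (Fin n ⊕ Fin n → ℂ),
      (∀ j, F.mulVec (g (Sum.inl j)) = lam j • g (Sum.inl j)) ∧
      (∀ j, F.mulVec (g (Sum.inr j)) = (-lam j) • g (Sum.inr j)) := by
  obtain ⟨P, hP, d, hFd⟩ := hdiag
  have hc : F.charpoly = ∏ i, (Polynomial.X - Polynomial.C (d i)) := by
    rw [← Matrix.charpoly_diagonal, hFd]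
    have := Matrix.charpoly_units_conj hP.unit (Matrix.diagonal d)
    rw [← this]
    simp
  have hm : Multiset.map d Finset.univ.val =
      Multiset.map (Sum.elim lam (fun j => -lam j)) (Finset.univ : Finset (Fin n ⊕ Fin n)).val := by
    have h2 : ∏ i, (Polynomial.X - Polynomial.C (d i)) =
        ∏ i, (Polynomial.X - Polynomial.C (Sum.elim lam (fun j => -lam j) i)) := by
      rw [← hc, hchar, Fintype.prod_sum_type, Finset.prod_mul_distrib]
      simp
    have h3 := congrArg Polynomial.roots h2
    have h4 : ∀ w : Fin n ⊕ Fin n → ℂ, (∏ i, (Polynomial.X - Polynomial.C (w i))).roots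
        = Multiset.map w Finset.univ.val := by
      intro w
      rw [← Polynomial.roots_multiset_prod_X_sub_C (Multiset.map w Finset.univ.val),
        Multiset.map_map]
      rfl
    rw [h4, h4] at h3
    exact h3
  obtain ⟨π, hπ⟩ := exists_equiv_of_map_eq _ _ hm
  have hli : LinearIndependent ℂ P.col := Matrix.linearIndependent_cols_of_isUnit hP
  have hli2 : LinearIndependent ℂ (P.col ∘ π) := hli.comp _ π.injective
  have heig : ∀ i, F.mulVec (P.col i) = d i • P.col i := by
    intro i
    have hFP : F * P = P * Matrix.diagonal d := by
      rw [hFd, mul_assoc, Matrix.nonsing_inv_mul _ ((Matrix.isUnit_iff_isUnit_det _).1 hP), mul_one]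
    funext a
    have := congrFun (congrFun hFP a) i
    rw [Matrix.mul_diagonal] at this
    simp only [Matrix.mulVec, Matrix.mul_apply, dotProduct, Matrix.col_apply, Pi.smul_apply,
      smul_eq_mul] at this ⊢
    rw [this]; ring
  refine ⟨Module.Basis.mk hli2 (hli2.span_eq_top_of_card_eq_finrank' (by simp)).ge, ?_, ?_⟩
  · intro j
    simp only [Module.Basis.mk_apply, Function.comp]
    rw [heig, hπ]; simp
  · intro j
    simp only [Module.Basis.mk_apply, Function.comp]
    rw [heig, hπ]; simp

lemma exists_NF
    (A B C : Matrix (Fin n) (Fin n) ℂ) (hAs : A.IsSymm) (hCs : C.IsSymm)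
    (hpos : ∀ x ξ : Fin n → ℝ, ¬(x = 0 ∧ ξ = 0) →
      0 < (qForm A B C (fun j => (x j : ℂ)) (fun j => (ξ j : ℂ))).re)
    (F : Matrix (Fin n ⊕ Fin n) (Fin n ⊕ Fin n) ℂ)
    (hF : ∀ X Y, sympForm X (F.mulVec Y) = qPolar A B C X Y)
    (hdiag : ∃ P : Matrix (Fin n ⊕ Fin n) (Fin n ⊕ Fin n) ℂ, IsUnit P ∧
      ∃ d : (Fin n ⊕ Fin n) → ℂ, F = P * Matrix.diagonal d * P⁻¹)
    (lam : Fin n → ℂ) (hlam : ∀ j, 0 < (lam j).im)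
    (hchar : F.charpoly =
      ∏ j, ((Polynomial.X - Polynomial.C (lam j)) * (Polynomial.X + Polynomial.C (lam j)))) :
    ∃ e f, NF e f lam ∧ ∀ X Y, qPolar A B C X Y =
      ∑ j, lam j * (sympForm (f j) X * sympForm (e j) Y + sympForm (e j) X * sympForm (f j) Y) := by
  obtain ⟨g, hge, hgf⟩ := exists_eigenbasis F hdiag lam hchar
  set e : Fin n → _ := fun j => g (Sum.inl j) with he
  set f₀ : Fin n → _ := fun j => g (Sum.inr j) with hf₀
  have hskew : ∀ X Y, sympForm (F.mulVec X) Y = -sympForm X (F.mulVec Y) := by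
    intro X Y
    rw [sympForm_swap, hF, hF, qPolar_symm A B C hAs hCs]
  have hsum_ne : ∀ j k, lam j + lam k ≠ 0 := by
    intro j k h0
    have := congrArg Complex.im h0
    simp only [Complex.add_im, Complex.zero_im] at this
    linarith [hlam j, hlam k]
  have hee : ∀ j k, sympForm (e j) (e k) = 0 := by
    intro j k
    have h1 := hskew (e j) (e k)
    rw [hge, hge, sympForm_smul_left, sympForm_smul_right] at h1
    have : (lam j + lam k) * sympForm (e j) (e k) = 0 := by linear_combination h1
    exact (mul_eq_zero.1 this).resolve_left (hsum_ne j k)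
  have hff₀ : ∀ j k, sympForm (f₀ j) (f₀ k) = 0 := by
    intro j k
    have h1 := hskew (f₀ j) (f₀ k)
    rw [hgf, hgf, sympForm_smul_left, sympForm_smul_right] at h1
    have : (lam j + lam k) * sympForm (f₀ j) (f₀ k) = 0 := by linear_combination -h1
    exact (mul_eq_zero.1 this).resolve_left (hsum_ne j k)
  have hef₀ : ∀ j k, lam j * sympForm (e j) (f₀ k) = lam k * sympForm (e j) (f₀ k) := by
    intro j k
    have h1 := hskew (e j) (f₀ k)
    rw [hge, hgf, sympForm_smul_left, sympForm_smul_right] at h1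
    linear_combination h1
  have hnd : ∀ Z, (∀ j, sympForm (e j) Z = 0) → (∀ j, sympForm (f₀ j) Z = 0) → Z = 0 := by
    intro Z h1 h2
    apply sympForm_nondeg
    intro X
    rw [← g.sum_repr X, Fintype.sum_sum_type, sympForm_add_left, sympForm_sum_left, sympForm_sum_left]
    simp only [sympForm_smul_left]
    simp only [he, hf₀] at h1 h2
    simp [h1, h2]
  set S : Matrix (Fin n) (Fin n) ℂ := fun j k => sympForm (e j) (f₀ k) with hS
  have hSu : IsUnit S := by
    rw [← Matrix.mulVec_injective_iff_isUnit]
    rw [← Matrix.coe_mulVecLin, ← LinearMap.ker_eq_bot, LinearMap.ker_eq_bot']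
    intro c hc
    rw [Matrix.mulVecLin_apply] at hc
    have hY : ∑ k, c k • f₀ k = 0 := by
      apply hnd
      · intro j
        rw [sympForm_sum_right]
        have := congrFun hc j
        simp only [Matrix.mulVec, dotProduct, hS, Pi.zero_apply] at this
        rw [← this]
        refine Finset.sum_congr rfl fun k _ => ?_
        rw [sympForm_smul_right, mul_comm]
      · intro j
        rw [sympForm_sum_right]
        refine Finset.sum_eq_zero fun k _ => ?_
        rw [sympForm_smul_right, hff₀, mul_zero]
    have hli : LinearIndependent ℂ f₀ := g.linearIndependent.comp _ Sum.inr_injective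
    funext k
    exact Fintype.linearIndependent_iff.1 hli c hY k
  have hSdet := (Matrix.isUnit_iff_isUnit_det _).1 hSu
  have hdet1 : S * S⁻¹ = 1 := Matrix.mul_nonsing_inv _ hSdet
  have hdet2 : S⁻¹ * S = 1 := Matrix.nonsing_inv_mul _ hSdet
  have hcomm : Matrix.diagonal lam * S = S * Matrix.diagonal lam := by
    ext j k
    rw [Matrix.diagonal_mul, Matrix.mul_diagonal, mul_comm _ (lam k)]
    exact hef₀ j k
  have hcomm' : S⁻¹ * Matrix.diagonal lam = Matrix.diagonal lam * S⁻¹ := by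
    calc S⁻¹ * Matrix.diagonal lam = S⁻¹ * (Matrix.diagonal lam * S) * S⁻¹ := by
          rw [mul_assoc, mul_assoc, hdet1, mul_one]
      _ = _ := by rw [hcomm, ← mul_assoc, hdet2, one_mul]
  set f : Fin n → (Fin n ⊕ Fin n → ℂ) := fun k => ∑ l, S⁻¹ l k • f₀ l with hf
  have hef : ∀ j k, sympForm (e j) (f k) = if j = k then 1 else 0 := by
    intro j k
    have := congrFun (congrFun hdet1 j) k
    rw [Matrix.mul_apply, Matrix.one_apply] at this
    rw [← this, hf, sympForm_sum_right]
    refine Finset.sum_congr rfl fun l _ => ?_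
    rw [sympForm_smul_right, mul_comm]
  have hff : ∀ j k, sympForm (f j) (f k) = 0 := by
    intro j k
    simp only [hf, sympForm_sum_right, sympForm_sum_left, sympForm_smul_right, sympForm_smul_left, hff₀]
    simp
  have hFf : ∀ k, F.mulVec (f k) = (-lam k) • f k := by
    intro k
    simp only [hf]
    rw [Matrix.mulVec_sum, Finset.smul_sum]
    refine Finset.sum_congr rfl fun l _ => ?_
    have := congrFun (congrFun hcomm' l) k
    rw [Matrix.diagonal_mul, Matrix.mul_diagonal] at this
    rw [Matrix.mulVec_smul, hgf, smul_smul, smul_smul]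
    congr 1
    linear_combination this
  have hf₀f : ∀ l, f₀ l = ∑ k, S k l • f k := by
    intro l
    simp only [hf, Finset.smul_sum, smul_smul]
    rw [Finset.sum_comm]
    simp only [← Finset.sum_smul]
    have : ∀ i, (∑ k, S k l * S⁻¹ i k) = if i = l then 1 else 0 := by
      intro i
      have := congrFun (congrFun hdet2 i) l
      rw [Matrix.mul_apply, Matrix.one_apply] at this
      rw [← this]
      exact Finset.sum_congr rfl fun k _ => mul_comm _ _
    simp [this]
  have hnd' : ∀ Z, (∀ j, sympForm (e j) Z = 0) → (∀ j, sympForm (f j) Z = 0) → Z = 0 := by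
    intro Z h1 h2
    refine hnd Z h1 fun j => ?_
    rw [hf₀f, sympForm_sum_left]
    exact Finset.sum_eq_zero fun k _ => by rw [sympForm_smul_left, h2, mul_zero]
  have hspan : ∀ X, X = ∑ j, (sympForm X (f j) • e j + sympForm (e j) X • f j) := by
    intro X
    rw [← sub_eq_zero]
    apply hnd'
    · intro j
      rw [sympForm_sub_right, sympForm_sum_right]
      simp [sympForm_add_right, sympForm_smul_right, hee, hef]
    · intro j
      rw [sympForm_sub_right, sympForm_sum_right]
      simp only [sympForm_add_right, sympForm_smul_right, hff]
      simp only [sympForm_swap (f j) (e _), hef]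
      rw [sympForm_swap (f j) X]
      simp
  have hq : ∀ X Y, qPolar A B C X Y =
      ∑ j, lam j * (sympForm (f j) X * sympForm (e j) Y + sympForm (e j) X * sympForm (f j) Y) := by
    intro X Y
    rw [← hF]
    conv_lhs => rw [hspan Y]
    rw [Matrix.mulVec_sum, sympForm_sum_right]
    refine Finset.sum_congr rfl fun j _ => ?_
    rw [Matrix.mulVec_add, Matrix.mulVec_smul, Matrix.mulVec_smul, hge, hFf, sympForm_add_right]
    simp only [sympForm_smul_right]
    rw [sympForm_swap X (f j), sympForm_swap X (g (Sum.inl j)), sympForm_swap Y (f j)]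
    ring
  refine ⟨e, f, ⟨hlam, hee, hff, hef, hspan, ?_⟩, hq⟩
  intro X hX
  have h1 := hpos (fun j => X (Sum.inl j)) (fun j => X (Sum.inr j)) (by
    rintro ⟨h1, h2⟩
    apply hX
    funext a
    rcases a with j | j
    · exact congrFun h1 j
    · exact congrFun h2 j)
  have h2 := qPolar_self A B C (toC X)
  rw [hq] at h2
  simp only [toC] at h2
  rw [← h2] at h1
  have h3 : (∑ j, lam j * (sympForm (f j) (toC X) * sympForm (e j) (toC X) + sympForm (e j) (toC X) * sympForm (f j) (toC X)))
    = ((2 : ℝ) : ℂ) * ∑ j, lam j * (sympForm (f j) (toC X) * sympForm (e j) (toC X)) := by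
    rw [Finset.mul_sum]
    refine Finset.sum_congr rfl fun j _ => ?_
    push_cast; ring
  have h4 := h1.trans_eq (congrArg Complex.re h3)
  rw [Complex.re_ofReal_mul] at h4
  linarith

end LinAlg


section NFsec
variable {n : ℕ}

/-- the antisymplectic involution `(y,η) ↦ (-y,η)` -/
def tau (Y : Fin n ⊕ Fin n → ℂ) : Fin n ⊕ Fin n → ℂ :=
  Sum.elim (fun j => -Y (Sum.inl j)) (fun j => Y (Sum.inr j))

lemma sympForm_tau_tau (X Y : Fin n ⊕ Fin n → ℂ) : sympForm (tau X) (tau Y) = -sympForm X Y := by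
  simp only [sympForm, tau, Sum.elim_inl, Sum.elim_inr, mul_neg, neg_mul, Finset.sum_neg_distrib]
  ring

lemma tau_tau (X : Fin n ⊕ Fin n → ℂ) : tau (tau X) = X := by
  funext a; rcases a with j | j <;> simp [tau]

lemma sympForm_tau (X Y : Fin n ⊕ Fin n → ℂ) : sympForm (tau X) Y = -sympForm X (tau Y) := by
  rw [← sympForm_tau_tau, tau_tau]

lemma NF.transpose {e f : Fin n → (Fin n ⊕ Fin n → ℂ)} {lam : Fin n → ℂ} (h : NF e f lam) :
    NF (fun j => tau (f j)) (fun j => tau (e j)) lam where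
  him := h.him
  ee j k := by simp [sympForm_tau_tau, h.ff]
  ff j k := by simp [sympForm_tau_tau, h.ee]
  ef j k := by
    simp only [sympForm_tau_tau]
    rw [sympForm_swap, h.ef]
    simp [eq_comm]
  span X := by
    have h1 := congrArg tau (h.span (tau X))
    rw [tau_tau] at h1
    conv_lhs => rw [h1]
    funext a
    have h2 : ∀ j, sympForm (tau X) (f j) = -sympForm X (tau (f j)) := fun j => sympForm_tau _ _
    have h3 : ∀ j, sympForm (e j) (tau X) = -sympForm (tau (e j)) X := fun j => by
      rw [sympForm_tau]; ring
    have h4 : ∀ j, sympForm X (tau (e j)) = -sympForm (tau (e j)) X := fun j => sympForm_swap _ _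
    have h5 : ∀ j, sympForm (tau (f j)) X = -sympForm X (tau (f j)) := fun j => sympForm_swap _ _
    simp only [h2, h3, h4, h5]
    rcases a with j | j
    · simp only [tau, Sum.elim_inl, Finset.sum_apply, Pi.add_apply, Pi.smul_apply, smul_eq_mul]
      rw [← Finset.sum_neg_distrib]
      exact Finset.sum_congr rfl fun k _ => by ring
    · simp only [tau, Sum.elim_inr, Finset.sum_apply, Pi.add_apply, Pi.smul_apply, smul_eq_mul]
      exact Finset.sum_congr rfl fun k _ => by ring
  pos X hX := by
    set X' : Fin n ⊕ Fin n → ℝ := Sum.elim (fun j => -X (Sum.inl j)) (fun j => X (Sum.inr j)) with hX'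
    have h1 : toC X' = tau (toC X) := by
      funext a; rcases a with j | j <;> simp [toC, tau, hX']
    have h2 : X' ≠ 0 := by
      intro h0
      apply hX
      funext a
      have := congrFun h0 a
      rcases a with j | j <;> simpa [hX'] using this
    have h3 := h.pos X' h2
    rw [h1] at h3
    convert h3 using 3
    rw [sympForm_tau, sympForm_tau]
    ring

/-- complex conjugation of vectors -/
noncomputable def cj (v : Fin n ⊕ Fin n → ℂ) : Fin n ⊕ Fin n → ℂ := fun a => (starRingEnd ℂ) (v a)

/-- real part -/
def reV (v : Fin n ⊕ Fin n → ℂ) : Fin n ⊕ Fin n → ℝ := fun a => (v a).re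
/-- imaginary part -/
def imV (v : Fin n ⊕ Fin n → ℂ) : Fin n ⊕ Fin n → ℝ := fun a => (v a).im

lemma eq_re_im (v : Fin n ⊕ Fin n → ℂ) : v = toC (reV v) + Complex.I • toC (imV v) := by
  funext a
  simp only [toC, reV, imV, Pi.add_apply, Pi.smul_apply, smul_eq_mul]
  rw [mul_comm, Complex.re_add_im]

lemma cj_eq_re_im (v : Fin n ⊕ Fin n → ℂ) :
    cj v = toC (reV v) + (-Complex.I) • toC (imV v) := by
  funext a
  simp only [cj, toC, reV, imV, Pi.add_apply, Pi.smul_apply, smul_eq_mul]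
  apply Complex.ext <;> simp

lemma polar_conj (e f : Fin n → (Fin n ⊕ Fin n → ℂ)) (s : Fin n → ℂ) (v : Fin n ⊕ Fin n → ℂ) :
    ∑ j, s j * (sympForm (f j) (cj v) * sympForm (e j) v + sympForm (e j) (cj v) * sympForm (f j) v)
    = ((2 : ℝ) : ℂ) * (∑ j, s j * (sympForm (f j) (toC (reV v)) * sympForm (e j) (toC (reV v)))
      + ∑ j, s j * (sympForm (f j) (toC (imV v)) * sympForm (e j) (toC (imV v)))) := by
  rw [← Finset.sum_add_distrib, Finset.mul_sum]
  refine Finset.sum_congr rfl fun j _ => ?_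
  have h1 : ∀ g : Fin n ⊕ Fin n → ℂ, sympForm g v = sympForm g (toC (reV v)) + Complex.I * sympForm g (toC (imV v)) := by
    intro g
    conv_lhs => rw [eq_re_im v]
    rw [sympForm_add_right, sympForm_smul_right]
  have h2 : ∀ g : Fin n ⊕ Fin n → ℂ, sympForm g (cj v) = sympForm g (toC (reV v)) - Complex.I * sympForm g (toC (imV v)) := by
    intro g
    rw [cj_eq_re_im v]
    rw [sympForm_add_right, sympForm_smul_right]; ring
  rw [h1, h1, h2, h2]
  push_cast
  linear_combination (-2 * s j * sympForm (f j) (toC (imV v)) * sympForm (e j) (toC (imV v))) * Complex.I_sq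

lemma NF.polar_pos {e f : Fin n → (Fin n ⊕ Fin n → ℂ)} {lam : Fin n → ℂ} (h : NF e f lam)
    (v : Fin n ⊕ Fin n → ℂ) (hv : v ≠ 0) :
    0 < (∑ j, lam j * (sympForm (f j) (cj v) * sympForm (e j) v
      + sympForm (e j) (cj v) * sympForm (f j) v)).re := by
  rw [polar_conj, Complex.re_ofReal_mul, Complex.add_re]
  have h0 : ∀ X, 0 ≤ (∑ j, lam j * (sympForm (f j) (toC X) * sympForm (e j) (toC X))).re := by
    intro X
    by_cases hX : X = 0
    · subst hX
      have : toC (0 : Fin n ⊕ Fin n → ℝ) = 0 := by funext a; simp [toC]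
      simp [this, sympForm]
    · exact (h.pos X hX).le
  have h1 := h0 (reV v)
  have h2 := h0 (imV v)
  by_cases hr : reV v = 0
  · have hi : imV v ≠ 0 := by
      intro hi
      apply hv
      rw [eq_re_im v, hr, hi]
      funext a; simp [toC]
    have := h.pos _ hi
    linarith
  · have := h.pos _ hr
    linarith

lemma toC_smul (a : ℝ) (X : Fin n ⊕ Fin n → ℝ) : toC (a • X) = (a : ℂ) • toC X := by
  funext b; simp [toC]

lemma continuous_sympForm_toC (g : Fin n ⊕ Fin n → ℂ) :
    Continuous fun X : Fin n ⊕ Fin n → ℝ => sympForm g (toC X) := by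
  unfold sympForm toC
  fun_prop

lemma NF.perturb {e f : Fin n → (Fin n ⊕ Fin n → ℂ)} {lam : Fin n → ℂ} (h : NF e f lam) :
    ∃ δ > 0, ∀ θ : Fin n → ℝ, (∀ j, 0 ≤ θ j ∧ θ j ≤ δ) → ∀ X : Fin n ⊕ Fin n → ℝ,
      0 ≤ (∑ j, (lam j + θ j) * (sympForm (f j) (toC X) * sympForm (e j) (toC X))).re := by
  set p : (Fin n ⊕ Fin n → ℝ) → ℝ := fun X =>
    (∑ j, lam j * (sympForm (f j) (toC X) * sympForm (e j) (toC X))).re with hp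
  set r : (Fin n ⊕ Fin n → ℝ) → ℝ := fun X =>
    ∑ j, ‖sympForm (f j) (toC X) * sympForm (e j) (toC X)‖ with hr
  have hpc : Continuous p := by
    refine Complex.continuous_re.comp (continuous_finsetSum _ fun j _ => ?_)
    exact continuous_const.mul ((continuous_sympForm_toC _).mul (continuous_sympForm_toC _))
  have hrc : Continuous r := by
    refine continuous_finsetSum _ fun j _ => ?_
    exact ((continuous_sympForm_toC _).mul (continuous_sympForm_toC _)).norm
  have hps : ∀ (a : ℝ) X, p (a • X) = a ^ 2 * p X := by
    intro a X
    simp only [hp]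
    rw [← Complex.re_ofReal_mul, Finset.mul_sum]
    congr 1
    refine Finset.sum_congr rfl fun j _ => ?_
    rw [toC_smul, sympForm_smul_right, sympForm_smul_right]
    push_cast; ring
  have hrs : ∀ (a : ℝ) X, r (a • X) = a ^ 2 * r X := by
    intro a X
    simp only [hr]
    rw [Finset.mul_sum]
    refine Finset.sum_congr rfl fun j _ => ?_
    rw [toC_smul, sympForm_smul_right, sympForm_smul_right]
    simp only [norm_mul, Complex.norm_real, Real.norm_eq_abs]
    rw [← sq_abs a]; ring
  have hrn : ∀ X, 0 ≤ r X := fun X => Finset.sum_nonneg fun j _ => norm_nonneg _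
  have hcomp : IsCompact (Metric.sphere (0 : Fin n ⊕ Fin n → ℝ) 1) := isCompact_sphere _ _
  have hmain : ∃ δ > 0, ∀ X ∈ Metric.sphere (0 : Fin n ⊕ Fin n → ℝ) 1, δ * r X ≤ p X := by
    by_cases hne : (Metric.sphere (0 : Fin n ⊕ Fin n → ℝ) 1).Nonempty
    · obtain ⟨X₀, hX₀, hmin⟩ := hcomp.exists_isMinOn hne hpc.continuousOn
      obtain ⟨X₁, hX₁, hmax⟩ := hcomp.exists_isMaxOn hne hrc.continuousOn
      have hp0 : 0 < p X₀ := h.pos X₀ (by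
        rintro rfl
        simp at hX₀)
      refine ⟨p X₀ / (r X₁ + 1), div_pos hp0 (by linarith [hrn X₁]), fun X hX => ?_⟩
      have h1 : p X₀ ≤ p X := hmin hX
      have h2 : r X ≤ r X₁ := hmax hX
      have h3 := hrn X₁
      refine le_trans ?_ h1
      rw [div_mul_eq_mul_div, div_le_iff₀ (by linarith)]
      nlinarith
    · exact ⟨1, one_pos, fun X hX => (hne ⟨X, hX⟩).elim⟩
  obtain ⟨δ, hδ, hmain⟩ := hmain
  refine ⟨δ, hδ, fun θ hθ X => ?_⟩
  have hall : δ * r X ≤ p X := by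
    by_cases hX : X = 0
    · subst hX
      have h1 := hps 0 0
      have h2 := hrs 0 0
      simp only [smul_zero] at h1 h2
      rw [h1, h2]; simp
    · have hn : 0 < ‖X‖ := norm_pos_iff.2 hX
      have h1 := hmain (‖X‖⁻¹ • X) (by simp [norm_smul, hn.ne'])
      rw [hps, hrs] at h1
      have : 0 < ‖X‖⁻¹ ^ 2 := by positivity
      nlinarith
  have h1 : (∑ j, (lam j + θ j) * (sympForm (f j) (toC X) * sympForm (e j) (toC X))).re
      = p X + ∑ j, θ j * (sympForm (f j) (toC X) * sympForm (e j) (toC X)).re := by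
    simp only [hp, Complex.re_sum]
    rw [← Finset.sum_add_distrib]
    refine Finset.sum_congr rfl fun j _ => ?_
    rw [add_mul, Complex.add_re, Complex.re_ofReal_mul]
  have h2 : -(δ * r X) ≤ ∑ j, θ j * (sympForm (f j) (toC X) * sympForm (e j) (toC X)).re := by
    simp only [hr]
    rw [Finset.mul_sum, ← Finset.sum_neg_distrib]
    refine Finset.sum_le_sum fun j _ => ?_
    have h3 := Complex.abs_re_le_norm (sympForm (f j) (toC X) * sympForm (e j) (toC X))
    have h4 := neg_abs_le (sympForm (f j) (toC X) * sympForm (e j) (toC X)).re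
    obtain ⟨h5, h6⟩ := hθ j
    nlinarith [norm_nonneg (sympForm (f j) (toC X) * sympForm (e j) (toC X)), abs_nonneg (sympForm (f j) (toC X) * sympForm (e j) (toC X)).re]
  rw [h1]; linarith

lemma sympForm_cj_cj (v w : Fin n ⊕ Fin n → ℂ) :
    sympForm (cj v) (cj w) = (starRingEnd ℂ) (sympForm v w) := by
  simp [sympForm, cj, map_sum]

lemma cj_cj (v : Fin n ⊕ Fin n → ℂ) : cj (cj v) = v := by funext a; simp [cj]

lemma NF.neg_lagr {e f : Fin n → (Fin n ⊕ Fin n → ℂ)} {lam : Fin n → ℂ} (h : NF e f lam)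
    (c : Fin n → ℂ) (hc : c ≠ 0) :
    (sympForm (cj (∑ j, c j • e j)) (∑ j, c j • e j)).im < 0 := by
  set X : ℝ → (Fin n ⊕ Fin n → ℂ) := fun t => ∑ j, (Complex.exp (t * (Complex.I * lam j)) * c j) • e j with hX
  have hXf : ∀ t k, sympForm (X t) (f k) = Complex.exp (t * (Complex.I * lam k)) * c k := by
    intro t k
    simp [hX, sympForm_sum_left, sympForm_smul_left, h.ef]
  have hXe : ∀ t k, sympForm (e k) (X t) = 0 := by
    intro t k
    simp [hX, sympForm_sum_right, sympForm_smul_right, h.ee]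
  have hXne : ∀ t, X t ≠ 0 := by
    intro t h0
    apply hc
    funext k
    have := hXf t k
    rw [h0] at this
    simp only [sympForm, Pi.zero_apply, zero_mul, Finset.sum_const_zero, sub_zero] at this
    exact (mul_eq_zero.1 this.symm).resolve_left (Complex.exp_ne_zero _)
  set X' : ℝ → (Fin n ⊕ Fin n → ℂ) := fun t =>
    ∑ j, ((Complex.I * lam j) * (Complex.exp (t * (Complex.I * lam j)) * c j)) • e j with hX'
  have hder : ∀ t a, HasDerivAt (fun t => X t a) (X' t a) t := by
    intro t a
    simp only [hX, hX', Finset.sum_apply, Pi.smul_apply]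
    refine HasDerivAt.fun_sum fun i _ => ?_
    have h2 : HasDerivAt (fun t : ℝ => (t : ℂ) * (Complex.I * lam i)) (1 * (Complex.I * lam i)) t :=
      (Complex.ofRealCLM.hasDerivAt (x := t)).mul_const _
    exact (((h2.cexp).mul_const (c i)).congr_deriv (by ring)).smul_const (e i a)
  have hderc : ∀ t a, HasDerivAt (fun t => cj (X t) a) (cj (X' t) a) t := by
    intro t a
    exact (Complex.conjCLE.toContinuousLinearMap.hasFDerivAt).comp_hasDerivAt t (hder t a)
  set φ : ℝ → ℝ := fun t => (sympForm (cj (X t)) (X t)).im with hφ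
  have hφd : ∀ t, HasDerivAt φ (sympForm (cj (X' t)) (X t) + sympForm (cj (X t)) (X' t)).im t := by
    intro t
    have h1 : HasDerivAt (fun t => sympForm (cj (X t)) (X t))
        (sympForm (cj (X' t)) (X t) + sympForm (cj (X t)) (X' t)) t := by
      unfold sympForm
      have h2 : HasDerivAt (fun t => ∑ j, cj (X t) (Sum.inr j) * X t (Sum.inl j))
          (∑ j, (cj (X' t) (Sum.inr j) * X t (Sum.inl j) + cj (X t) (Sum.inr j) * X' t (Sum.inl j))) t :=
        HasDerivAt.fun_sum fun j _ => (hderc t _).mul (hder t _)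
      have h3 : HasDerivAt (fun t => ∑ j, cj (X t) (Sum.inl j) * X t (Sum.inr j))
          (∑ j, (cj (X' t) (Sum.inl j) * X t (Sum.inr j) + cj (X t) (Sum.inl j) * X' t (Sum.inr j))) t :=
        HasDerivAt.fun_sum fun j _ => (hderc t _).mul (hder t _)
      refine (h2.sub h3).congr_deriv ?_
      simp only [Finset.sum_add_distrib]
      ring
    exact (Complex.imCLM.hasFDerivAt).comp_hasDerivAt t h1
  have hφpos : ∀ t, 0 < (sympForm (cj (X' t)) (X t) + sympForm (cj (X t)) (X' t)).im := by
    intro t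
    have h1 : sympForm (cj (X' t)) (X t) = -(starRingEnd ℂ) (sympForm (cj (X t)) (X' t)) := by
      rw [← sympForm_cj_cj, cj_cj, sympForm_swap]
    have h2 : sympForm (cj (X t)) (X' t) = Complex.I * ∑ j, lam j *
        (sympForm (f j) (cj (X t)) * sympForm (e j) (X t) + sympForm (e j) (cj (X t)) * sympForm (f j) (X t)) := by
      simp only [hX', sympForm_sum_right, sympForm_smul_right, hXe]
      rw [Finset.mul_sum]
      refine Finset.sum_congr rfl fun j _ => ?_
      rw [← hXf t j, sympForm_swap (cj (X t)) (e j), sympForm_swap (X t) (f j)]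
      ring
    have h3 := h.polar_pos (X t) (hXne t)
    rw [h1, Complex.add_im, Complex.neg_im, Complex.conj_im, h2]
    simp only [Complex.mul_im, Complex.I_re, Complex.I_im, zero_mul, one_mul, zero_add]
    linarith
  have hmono : StrictMono φ := by
    refine strictMono_of_deriv_pos fun t => ?_
    rw [(hφd t).deriv]
    exact hφpos t
  have hlim : Filter.Tendsto φ Filter.atTop (nhds 0) := by
    have h1 : ∀ a, Filter.Tendsto (fun t => X t a) Filter.atTop (nhds 0) := by
      intro a
      simp only [hX, Finset.sum_apply, Pi.smul_apply, smul_eq_mul]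
      rw [show (0 : ℂ) = ∑ j : Fin n, 0 * c j * e j a by simp]
      refine tendsto_finsetSum _ fun j _ => ?_
      refine Filter.Tendsto.mul_const _ (Filter.Tendsto.mul_const _ ?_)
      rw [tendsto_zero_iff_norm_tendsto_zero]
      have h2 : ∀ t : ℝ, ‖Complex.exp (t * (Complex.I * lam j))‖ = Real.exp (-(t * (lam j).im)) := by
        intro t
        rw [Complex.norm_exp]
        congr 1
        simp
      simp_rw [h2]
      exact Real.tendsto_exp_neg_atTop_nhds_zero.comp
        (Filter.Tendsto.atTop_mul_const (h.him j) Filter.tendsto_id)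
    have h2 : ∀ a, Filter.Tendsto (fun t => cj (X t) a) Filter.atTop (nhds 0) := by
      intro a
      have := (Complex.continuous_conj.tendsto 0).comp (h1 a)
      simpa [cj, Function.comp_def] using this
    have h3 : Filter.Tendsto (fun t => sympForm (cj (X t)) (X t)) Filter.atTop (nhds 0) := by
      unfold sympForm
      rw [show (0 : ℂ) = (∑ j : Fin n, 0 * 0) - (∑ j : Fin n, 0 * 0) by simp]
      exact (tendsto_finsetSum _ fun j _ => (h2 _).mul (h1 _)).sub
        (tendsto_finsetSum _ fun j _ => (h2 _).mul (h1 _))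
    have := (Complex.continuous_im.tendsto 0).comp h3
    rw [Complex.zero_im] at this
    exact this
  have h1 : φ 0 < φ 1 := hmono one_pos
  have h2 : φ 1 ≤ 0 := hmono.monotone.ge_of_tendsto hlim 1
  have h3 : X 0 = ∑ j, c j • e j := by simp [hX]
  have h4 : φ 0 < 0 := by linarith
  simpa [hφ, h3] using h4

lemma NF.ground {e f : Fin n → (Fin n ⊕ Fin n → ℂ)} {lam : Fin n → ℂ} (h : NF e f lam) :
    ∃ K : Matrix (Fin n) (Fin n) ℂ, K.IsSymm ∧
      (∀ x : Fin n → ℝ, x ≠ 0 → 0 < (∑ j, ∑ k, K j k * x j * x k).im) ∧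
      ∀ j, ∀ x : Fin n → ℂ, sympForm (e j) (Sum.elim x (K.mulVec x)) = 0 := by
  set Ex : Matrix (Fin n) (Fin n) ℂ := fun k j => e j (Sum.inl k) with hEx
  set Eξ : Matrix (Fin n) (Fin n) ℂ := fun k j => e j (Sum.inr k) with hEξ
  have hu : IsUnit Ex := by
    rw [← Matrix.mulVec_injective_iff_isUnit]
    rw [← Matrix.coe_mulVecLin, ← LinearMap.ker_eq_bot, LinearMap.ker_eq_bot']
    intro c hc
    rw [Matrix.mulVecLin_apply] at hc
    by_contra hne
    have h1 := h.neg_lagr c hne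
    have h2 : ∀ k, (∑ j, c j • e j) (Sum.inl k) = 0 := by
      intro k
      have := congrFun hc k
      simp only [Matrix.mulVec, dotProduct, hEx, Pi.zero_apply] at this
      rw [← this, Finset.sum_apply]
      exact Finset.sum_congr rfl fun j _ => by simp [mul_comm]
    have h3 : sympForm (cj (∑ j, c j • e j)) (∑ j, c j • e j) = 0 := by
      unfold sympForm cj
      simp only [h2]
      simp
    rw [h3] at h1
    simp at h1
  have hdet := (Matrix.isUnit_iff_isUnit_det _).1 hu
  set K := Eξ * Ex⁻¹ with hK
  have hgraph : ∀ x : Fin n → ℂ, Sum.elim x (K.mulVec x) = ∑ j, (Ex⁻¹.mulVec x) j • e j := by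
    intro x
    have h1 : x = Ex.mulVec (Ex⁻¹.mulVec x) := by
      rw [Matrix.mulVec_mulVec, Matrix.mul_nonsing_inv _ hdet, Matrix.one_mulVec]
    have h2 : K.mulVec x = Eξ.mulVec (Ex⁻¹.mulVec x) := by
      rw [Matrix.mulVec_mulVec]
    funext a
    rw [Finset.sum_apply]
    rcases a with k | k
    · rw [Sum.elim_inl]
      conv_lhs => rw [h1]
      rw [Matrix.mulVec, dotProduct]
      exact Finset.sum_congr rfl fun j _ => by simp [hEx, mul_comm]
    · rw [Sum.elim_inr, h2, Matrix.mulVec, dotProduct]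
      exact Finset.sum_congr rfl fun j _ => by simp [hEξ, mul_comm]
  have hlag : ∀ x y : Fin n → ℂ, sympForm (Sum.elim x (K.mulVec x)) (Sum.elim y (K.mulVec y)) = 0 := by
    intro x y
    rw [hgraph, hgraph]
    simp [sympForm_sum_left, sympForm_sum_right, sympForm_smul_left, sympForm_smul_right, h.ee]
  refine ⟨K, ?_, ?_, ?_⟩
  · ext j k
    have := hlag (Pi.single j 1) (Pi.single k 1)
    simp [sympForm, Pi.single_apply] at this
    rw [Matrix.transpose_apply]
    linear_combination this
  · intro x hx
    set xc : Fin n → ℂ := fun j => (x j : ℂ) with hxc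
    have hc : Ex⁻¹.mulVec xc ≠ 0 := by
      intro h0
      apply hx
      have h1 : xc = Ex.mulVec (Ex⁻¹.mulVec xc) := by
        rw [Matrix.mulVec_mulVec, Matrix.mul_nonsing_inv _ hdet, Matrix.one_mulVec]
      rw [h0, Matrix.mulVec_zero] at h1
      funext j
      have := congrFun h1 j
      simpa [hxc] using this
    have h1 := h.neg_lagr _ hc
    rw [← hgraph] at h1
    have h2 : (∑ j, ∑ k, K j k * x j * x k) = ∑ j, xc j * K.mulVec xc j := by
      refine Finset.sum_congr rfl fun j _ => ?_
      rw [Matrix.mulVec, dotProduct, Finset.mul_sum]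
      exact Finset.sum_congr rfl fun k _ => by simp only [hxc]; ring
    have h3 : sympForm (cj (Sum.elim xc (K.mulVec xc))) (Sum.elim xc (K.mulVec xc))
        = (starRingEnd ℂ) (∑ j, xc j * K.mulVec xc j) - ∑ j, xc j * K.mulVec xc j := by
      simp only [sympForm, cj, Sum.elim_inl, Sum.elim_inr, map_sum, map_mul]
      simp [hxc, mul_comm]
    rw [h3, Complex.sub_im, Complex.conj_im] at h1
    rw [h2]
    linarith
  · intro j x
    rw [hgraph]
    simp [sympForm_sum_right, sympForm_smul_right, h.ee]

end NFsec


section Ops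
variable {n : ℕ}

/-- Schwartz functions on `ℝⁿ` -/
abbrev SS (n : ℕ) := SchwartzMap (EuclideanSpace ℝ (Fin n)) ℂ

/-- the coordinate function -/
noncomputable def coordFn (k : Fin n) : EuclideanSpace ℝ (Fin n) → ℂ := fun x => (x k : ℂ)

lemma coordFn_eq (k : Fin n) : (coordFn k) =
    fun x => (Complex.ofRealCLM.comp (EuclideanSpace.proj k : EuclideanSpace ℝ (Fin n) →L[ℝ] ℝ)) x := by
  funext x; simp [coordFn]

lemma coordFn_tg (k : Fin n) : (coordFn k).HasTemperateGrowth := by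
  rw [coordFn_eq]
  exact ContinuousLinearMap.hasTemperateGrowth _

/-- multiplication by `x_k` -/
noncomputable def Xop (k : Fin n) : Module.End ℂ (SS n) :=
  (SchwartzMap.smulLeftCLM ℂ (coordFn k) : SS n →L[ℂ] SS n).toLinearMap

/-- `(h/i) ∂_k` -/
noncomputable def Dop (h : ℝ) (k : Fin n) : Module.End ℂ (SS n) :=
  ((h : ℂ) / Complex.I) • (LineDeriv.lineDerivOpCLM ℂ (SS n) (EuclideanSpace.single k (1 : ℝ))).toLinearMap

lemma Xop_apply (k : Fin n) (u : SS n) (x) : Xop k u x = (x k : ℂ) * u x := by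
  simp [Xop, SchwartzMap.smulLeftCLM_apply_apply (coordFn_tg k), coordFn]

lemma Dop_apply (h : ℝ) (k : Fin n) (u : SS n) (x) :
    Dop h k u x = (h : ℂ) / Complex.I * fderiv ℝ u x (EuclideanSpace.single k (1 : ℝ)) := by
  simp [Dop, LineDeriv.lineDerivOpCLM_apply, SchwartzMap.lineDerivOp_apply_eq_fderiv]

/-- coordinates of the vector-valued Weyl symbol -/
noncomputable def Zop (h : ℝ) (a : Fin n ⊕ Fin n) : Module.End ℂ (SS n) :=
  Sum.elim Xop (Dop h) a

/-- quantization of the linear form `X ↦ σ(Y,X)` -/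
noncomputable def Op (h : ℝ) (Y : Fin n ⊕ Fin n → ℂ) : Module.End ℂ (SS n) :=
  ∑ a, sympForm Y (Pi.single a 1) • Zop h a

lemma sympForm_single_inl (Y : Fin n ⊕ Fin n → ℂ) (k : Fin n) :
    sympForm Y (Pi.single (Sum.inl k) 1) = Y (Sum.inr k) := by
  simp [sympForm, Pi.single_apply]

lemma sympForm_single_inr (Y : Fin n ⊕ Fin n → ℂ) (k : Fin n) :
    sympForm Y (Pi.single (Sum.inr k) 1) = - Y (Sum.inl k) := by
  simp [sympForm, Pi.single_apply]

/-- the vector `(x g, hD g)` at a point -/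
noncomputable def vec (h : ℝ) (g : SS n) (x : EuclideanSpace ℝ (Fin n)) : Fin n ⊕ Fin n → ℂ :=
  fun a => Zop h a g x

lemma Op_apply (h : ℝ) (Y : Fin n ⊕ Fin n → ℂ) (g : SS n) (x) :
    Op h Y g x = sympForm Y (vec h g x) := by
  have h1 : Op h Y g x = ∑ a, sympForm Y (Pi.single a 1) * Zop h a g x := by
    simp [Op, LinearMap.sum_apply]
  rw [h1, Fintype.sum_sum_type]
  simp only [sympForm_single_inl, sympForm_single_inr, neg_mul, Finset.sum_neg_distrib]
  simp only [sympForm, vec, sub_eq_add_neg]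

lemma Op_add (h : ℝ) (Y Z : Fin n ⊕ Fin n → ℂ) : Op h (Y + Z) = Op h Y + Op h Z := by
  ext g x; simp [Op_apply, sympForm_add_left]

lemma Op_smul (h : ℝ) (c : ℂ) (Y : Fin n ⊕ Fin n → ℂ) : Op h (c • Y) = c • Op h Y := by
  ext g x; simp [Op_apply, sympForm_smul_left]

lemma Op_sum {ι : Type*} (s : Finset ι) (h : ℝ) (Y : ι → (Fin n ⊕ Fin n → ℂ)) :
    Op h (∑ i ∈ s, Y i) = ∑ i ∈ s, Op h (Y i) := by
  ext g x; simp [Op_apply, sympForm_sum_left, LinearMap.sum_apply]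

lemma fderiv_Xop (j : Fin n) (u : SS n) (x m) :
    fderiv ℝ (Xop j u) x m = (m j : ℂ) * u x + (x j : ℂ) * fderiv ℝ u x m := by
  have h1 : (Xop j u : EuclideanSpace ℝ (Fin n) → ℂ) = fun y => coordFn j y * u y := by
    funext y; rw [Xop_apply]; rfl
  have h2 : HasFDerivAt (coordFn j)
      (Complex.ofRealCLM.comp (EuclideanSpace.proj j : EuclideanSpace ℝ (Fin n) →L[ℝ] ℝ)) x := by
    rw [coordFn_eq]; exact ContinuousLinearMap.hasFDerivAt _
  have h3 : HasFDerivAt (fun y => coordFn j y * u y) _ x := h2.mul (u.hasFDerivAt x)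
  rw [h1, h3.fderiv]
  simp [coordFn]
  ring

lemma comm_XX (j k : Fin n) : Xop j * Xop k = Xop k * Xop j := by
  ext u x; simp [Xop_apply]; ring

lemma comm_DX (h : ℝ) (k j : Fin n) :
    Dop h k * Xop j = Xop j * Dop h k + ((h : ℂ) / Complex.I * if k = j then 1 else 0) • 1 := by
  ext u x
  simp only [Module.End.mul_apply, LinearMap.add_apply, _root_.add_apply, LinearMap.smul_apply,
    _root_.smul_apply, Module.End.one_apply, Xop_apply, Dop_apply, fderiv_Xop, smul_eq_mul]
  by_cases hkj : k = j
  · subst hkj; simp; ring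
  · have : j ≠ k := fun h => hkj h.symm
    simp [hkj, this]; ring

lemma fderiv2_eq (u : SS n) (x m m') :
    fderiv ℝ (fun y => fderiv ℝ u y m) x m' = fderiv ℝ (fderiv ℝ u) x m' m := by
  have h1 : DifferentiableAt ℝ (fderiv ℝ u) x := by
    have := (u.smooth 2).fderiv_right (m := 1) (by norm_num)
    exact this.differentiable (by norm_num) x
  rw [fderiv_clm_apply h1 (differentiableAt_const m)]
  simp

lemma fderiv2_symm (u : SS n) (x m m') :
    fderiv ℝ (fun y => fderiv ℝ u y m) x m' = fderiv ℝ (fun y => fderiv ℝ u y m') x m := by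
  rw [fderiv2_eq, fderiv2_eq]
  have := (u.smooth 2).contDiffAt (x := x)
  exact (this.isSymmSndFDerivAt (by simp)).eq m' m

lemma DD_apply (h : ℝ) (j k : Fin n) (u : SS n) (x) :
    Dop h j (Dop h k u) x = ((h : ℂ) / Complex.I) ^ 2 *
      fderiv ℝ (fun y => fderiv ℝ u y (EuclideanSpace.single k 1)) x (EuclideanSpace.single j 1) := by
  rw [Dop_apply]
  have h1 : (Dop h k u : EuclideanSpace ℝ (Fin n) → ℂ) =
      fun y => (h : ℂ) / Complex.I * fderiv ℝ u y (EuclideanSpace.single k 1) := by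
    funext y; rw [Dop_apply]
  have h2 : DifferentiableAt ℝ (fun y => fderiv ℝ u y (EuclideanSpace.single k 1)) x := by
    have := (u.smooth 2).fderiv_right (m := 1) (by norm_num)
    exact (this.differentiable (by norm_num) x).clm_apply (differentiableAt_const _)
  rw [h1, fderiv_const_mul h2]
  simp
  ring

lemma comm_DD (h : ℝ) (j k : Fin n) : Dop h j * Dop h k = Dop h k * Dop h j := by
  ext u x
  simp only [Module.End.mul_apply, DD_apply]
  rw [fderiv2_symm]

lemma comm_ZZ (h : ℝ) (a b : Fin n ⊕ Fin n) :
    Zop h a * Zop h b - Zop h b * Zop h a =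
      ((h : ℂ) / Complex.I * sympForm (Pi.single a 1) (Pi.single b 1)) • 1 := by
  rcases a with j | j <;> rcases b with k | k <;>
    simp only [Zop, Sum.elim_inl, Sum.elim_inr, sympForm_single_inl, sympForm_single_inr]
  · rw [comm_XX]; simp
  · rw [comm_DX]
    by_cases hjk : j = k
    · subst hjk; simp
    · have : k ≠ j := fun h => hjk h.symm
      simp [this, hjk]
  · rw [comm_DX]
    by_cases hjk : j = k
    · subst hjk; simp
    · have : k ≠ j := fun h => hjk h.symm
      simp [this, hjk]
  · rw [comm_DD]; simp

lemma comm_Op (h : ℝ) (Y Z : Fin n ⊕ Fin n → ℂ) :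
    Op h Y * Op h Z - Op h Z * Op h Y = ((h : ℂ) / Complex.I * sympForm Y Z) • 1 := by
  have h1 : Op h Y * Op h Z - Op h Z * Op h Y =
      ∑ a, ∑ b, (sympForm Y (Pi.single a 1) * sympForm Z (Pi.single b 1)) •
        (Zop h a * Zop h b - Zop h b * Zop h a) := by
    simp only [Op, Finset.sum_mul_sum, smul_sub, Finset.sum_sub_distrib, smul_mul_smul_comm]
    congr 1
    rw [Finset.sum_comm]
    refine Finset.sum_congr rfl fun a _ => Finset.sum_congr rfl fun b _ => ?_
    rw [mul_comm]
  rw [h1]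
  simp only [comm_ZZ, smul_smul, ← Finset.sum_smul]
  congr 1
  simp only [Fintype.sum_sum_type, sympForm_single_inl, sympForm_single_inr]
  simp [Pi.single_apply, Finset.sum_add_distrib, sympForm, Finset.mul_sum, mul_sub]
  congr 1
  · congr 1
    exact Finset.sum_congr rfl fun a _ => by ring
  · exact Finset.sum_congr rfl fun a _ => by ring

lemma integrable_mul (u g : SS n) : Integrable (fun x => u x * g x) := by
  have := (SchwartzMap.smulLeftCLM ℂ (u : EuclideanSpace ℝ (Fin n) → ℂ) g).integrable (μ := volume)
  rw [SchwartzMap.smulLeftCLM_apply u.hasTemperateGrowth] at this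
  simpa using this

lemma transp_Z (h : ℝ) (a : Fin n ⊕ Fin n) (u g : SS n) :
    ∫ x, Zop h a u x * g x = Sum.elim (fun _ => (1 : ℂ)) (fun _ => -1) a * ∫ x, u x * Zop h a g x := by
  rcases a with k | k
  · simp only [Zop, Sum.elim_inl, one_mul]
    congr 1
    funext x
    rw [Xop_apply, Xop_apply]; ring
  · simp only [Zop, Sum.elim_inr, neg_mul, one_mul]
    have h1 : ∀ x, Dop h k u x = (h : ℂ) / Complex.I *
        (LineDeriv.lineDerivOp (EuclideanSpace.single k (1 : ℝ)) u : SS n) x := by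
      intro x; rw [Dop_apply, SchwartzMap.lineDerivOp_apply_eq_fderiv]
    have h2 : ∀ x, Dop h k g x = (h : ℂ) / Complex.I *
        (LineDeriv.lineDerivOp (EuclideanSpace.single k (1 : ℝ)) g : SS n) x := by
      intro x; rw [Dop_apply, SchwartzMap.lineDerivOp_apply_eq_fderiv]
    simp only [h1, h2, mul_assoc, mul_left_comm _ ((h : ℂ) / Complex.I), integral_const_mul]
    rw [SchwartzMap.integral_mul_lineDerivOp_right_eq_neg_left]
    ring

lemma Op_apply' (h : ℝ) (Y : Fin n ⊕ Fin n → ℂ) (g : SS n) (x) :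
    Op h Y g x = ∑ a, sympForm Y (Pi.single a 1) * Zop h a g x := by
  simp [Op, LinearMap.sum_apply]

lemma transp_Op (h : ℝ) (Y : Fin n ⊕ Fin n → ℂ) (u g : SS n) :
    ∫ x, Op h Y u x * g x = ∫ x, u x * Op h (tau Y) g x := by
  simp only [Op_apply', Finset.sum_mul, Finset.mul_sum]
  rw [integral_finsetSum, integral_finsetSum]
  · refine Finset.sum_congr rfl fun a _ => ?_
    simp only [mul_assoc, mul_left_comm _ (sympForm (tau Y) _), integral_const_mul]
    rw [transp_Z, ← mul_assoc]
    congr 1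
    rcases a with k | k <;> simp [sympForm_single_inl, sympForm_single_inr, tau]
  · intro a _
    simp only [mul_left_comm _ (sympForm (tau Y) _)]
    exact (integrable_mul _ _).const_mul _
  · intro a _
    simp only [mul_assoc]
    exact (integrable_mul _ _).const_mul _

/-- the quantized quadratic form in symplectic eigencoordinates -/
noncomputable def Qop (h : ℝ) (e f : Fin n → (Fin n ⊕ Fin n → ℂ)) (s : Fin n → ℂ) :
    Module.End ℂ (SS n) :=
  ∑ j, s j • (Op h (e j) * Op h (f j) + Op h (f j) * Op h (e j))

lemma Qop_apply (h : ℝ) (e f : Fin n → (Fin n ⊕ Fin n → ℂ)) (s : Fin n → ℂ) (u : SS n) (x) :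
    Qop h e f s u x = ∑ j, s j * (Op h (e j) (Op h (f j) u) x + Op h (f j) (Op h (e j) u) x) := by
  simp [Qop, LinearMap.sum_apply, mul_add]

lemma transp_Q (h : ℝ) (e f : Fin n → (Fin n ⊕ Fin n → ℂ)) (s : Fin n → ℂ) (u g : SS n) :
    ∫ x, Qop h e f s u x * g x =
      ∫ x, u x * Qop h (fun j => tau (f j)) (fun j => tau (e j)) s g x := by
  have h2 : ∀ Y Z : Fin n ⊕ Fin n → ℂ, ∫ x, Op h Y (Op h Z u) x * g x =
      ∫ x, u x * Op h (tau Z) (Op h (tau Y) g) x := by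
    intro Y Z; rw [transp_Op, transp_Op]
  simp only [Qop_apply, Finset.sum_mul, Finset.mul_sum, mul_add, add_mul]
  rw [integral_finsetSum, integral_finsetSum]
  · refine Finset.sum_congr rfl fun j _ => ?_
    simp only [mul_assoc, mul_left_comm _ (s j)]
    rw [integral_add, integral_add, integral_const_mul, integral_const_mul, h2, h2,
      integral_const_mul, integral_const_mul]
    all_goals exact (integrable_mul _ _).const_mul _
  · intro j _
    simp only [mul_left_comm _ (s j)]
    exact ((integrable_mul _ _).const_mul _).add ((integrable_mul _ _).const_mul _)
  · intro j _
    simp only [mul_assoc]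
    exact ((integrable_mul _ _).const_mul _).add ((integrable_mul _ _).const_mul _)

/-- complex conjugate of a Schwartz function -/
noncomputable def cS (u : SS n) : SS n :=
  SchwartzMap.postcompCLM (𝕜 := ℝ) (Complex.conjCLE : ℂ →L[ℝ] ℂ) u

lemma cS_apply (u : SS n) (x) : cS u x = (starRingEnd ℂ) (u x) := by
  simp [cS, SchwartzMap.postcompCLM_apply]

lemma Op_cS (h : ℝ) (Y : Fin n ⊕ Fin n → ℂ) (g : SS n) (x) :
    Op h (tau Y) (cS g) x = sympForm Y (cj (vec h g x)) := by
  have h1 : ∀ k, fderiv ℝ (cS g) x (EuclideanSpace.single k (1 : ℝ)) =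
      (starRingEnd ℂ) (fderiv ℝ g x (EuclideanSpace.single k (1 : ℝ))) := by
    intro k
    have h2 : (cS g : EuclideanSpace ℝ (Fin n) → ℂ) = fun y => Complex.conjCLE (g y) := by
      funext y; rw [cS_apply]; rfl
    have h3 := (Complex.conjCLE : ℂ →L[ℝ] ℂ).hasFDerivAt.comp x (g.hasFDerivAt x)
    have h4 : HasFDerivAt (fun y => Complex.conjCLE (g y)) _ x := h3
    rw [h2, h4.fderiv]
    simp
  rw [Op_apply]
  simp only [sympForm, tau, vec, cj, Zop, Sum.elim_inl, Sum.elim_inr, Xop_apply, Dop_apply, cS_apply,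
    h1, map_mul, map_div₀, Complex.conj_ofReal, Complex.conj_I]
  congr 1
  refine Finset.sum_congr rfl fun j _ => ?_
  rw [div_neg]
  ring

lemma accretive {e f : Fin n → (Fin n ⊕ Fin n → ℂ)} (s : Fin n → ℂ) (h : ℝ)
    (hp : ∀ X : Fin n ⊕ Fin n → ℝ,
      0 ≤ (∑ j, s j * (sympForm (f j) (toC X) * sympForm (e j) (toC X))).re) (g : SS n) :
    0 ≤ (inner ℂ (g.toLp 2) ((Qop h e f s g).toLp 2)).re := by
  rw [SchwartzMap.inner_toL2_toL2_eq g (Qop h e f s g) volume]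
  have h2 : ∀ Y Z : Fin n ⊕ Fin n → ℂ, ∫ x, cS g x * Op h Y (Op h Z g) x =
      ∫ x, sympForm Y (cj (vec h g x)) * sympForm Z (vec h g x) := by
    intro Y Z
    have := transp_Op h (tau Y) (cS g) (Op h Z g)
    rw [tau_tau] at this
    rw [← this]
    congr 1; funext x
    rw [Op_cS, Op_apply]
  have hIntg : ∀ Y Z : Fin n ⊕ Fin n → ℂ, Integrable
      fun x => sympForm Y (cj (vec h g x)) * sympForm Z (vec h g x) := by
    intro Y Z
    have := integrable_mul (Op h (tau Y) (cS g)) (Op h Z g)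
    simp only [Op_cS] at this
    simpa only [Op_apply] using this
  have h3 : ∫ x, inner ℂ (g x) (Qop h e f s g x) =
      ∫ x, ∑ j, s j * (sympForm (f j) (cj (vec h g x)) * sympForm (e j) (vec h g x)
        + sympForm (e j) (cj (vec h g x)) * sympForm (f j) (vec h g x)) := by
    have h4 : ∀ x, inner ℂ (g x) (Qop h e f s g x) = cS g x * Qop h e f s g x := by
      intro x
      rw [cS_apply, RCLike.inner_apply, mul_comm]
    simp only [h4]
    simp only [Qop_apply, Finset.mul_sum, mul_add, mul_left_comm _ (s _)]
    rw [integral_finsetSum, integral_finsetSum]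
    · refine Finset.sum_congr rfl fun j _ => ?_
      rw [integral_add, integral_add, integral_const_mul, integral_const_mul, h2, h2,
        integral_const_mul, integral_const_mul, add_comm]
      · exact (hIntg _ _).const_mul _
      · exact (hIntg _ _).const_mul _
      · exact (integrable_mul _ _).const_mul _
      · exact (integrable_mul _ _).const_mul _
    · intro j _
      exact ((hIntg _ _).const_mul _).add ((hIntg _ _).const_mul _)
    · intro j _
      exact ((integrable_mul _ _).const_mul _).add ((integrable_mul _ _).const_mul _)
  rw [h3]
  have h5 := Complex.reCLM.integral_comp_comm (μ := volume) (φ := fun x => ∑ j, s j * (sympForm (f j) (cj (vec h g x)) * sympForm (e j) (vec h g x)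
        + sympForm (e j) (cj (vec h g x)) * sympForm (f j) (vec h g x)))
      (integrable_finsetSum _ fun j _ => ((hIntg _ _).add (hIntg _ _)).const_mul _)
  simp only [Complex.reCLM_apply] at h5
  rw [← h5]
  refine integral_nonneg fun x => ?_
  simp only [Pi.zero_apply]
  rw [polar_conj, Complex.re_ofReal_mul, Complex.add_re]
  have := hp (reV (vec h g x))
  have := hp (imV (vec h g x))
  positivity

lemma qPolar_single (A B C : Matrix (Fin n) (Fin n) ℂ) (j k : Fin n) :
    qPolar A B C (Pi.single (Sum.inl j) 1) (Pi.single (Sum.inl k) 1) = A k j ∧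
    qPolar A B C (Pi.single (Sum.inl j) 1) (Pi.single (Sum.inr k) 1) = B k j ∧
    qPolar A B C (Pi.single (Sum.inr j) 1) (Pi.single (Sum.inl k) 1) = B j k ∧
    qPolar A B C (Pi.single (Sum.inr j) 1) (Pi.single (Sum.inr k) 1) = C k j := by
  simp [qPolar, Pi.single_apply]

lemma weyl_eq (A B C : Matrix (Fin n) (Fin n) ℂ) (hAs : A.IsSymm)
    {e f : Fin n → (Fin n ⊕ Fin n → ℂ)} {lam : Fin n → ℂ}
    (hq : ∀ X Y, qPolar A B C X Y = ∑ j, lam j * (sympForm (f j) X * sympForm (e j) Y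
      + sympForm (e j) X * sympForm (f j) Y)) (h : ℝ) (u : SS n) (x) :
    weylQuant A B C h (fun y => u y) x = Qop h e f lam u x := by
  have h1 : Qop h e f lam = ∑ a, ∑ b, qPolar A B C (Pi.single a 1) (Pi.single b 1) •
      (Zop h a * Zop h b) := by
    simp only [hq, Qop, Op, Finset.sum_mul_sum, smul_mul_smul_comm, ← Finset.sum_add_distrib,
      ← add_smul, Finset.smul_sum, smul_smul, Finset.sum_smul]
    rw [Finset.sum_comm]
    refine Finset.sum_congr rfl fun a _ => ?_
    rw [Finset.sum_comm]
    refine Finset.sum_congr rfl fun b _ => ?_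
    refine Finset.sum_congr rfl fun j _ => ?_
    rw [add_comm]
  have h2 : Qop h e f lam u x = ∑ a, ∑ b, qPolar A B C (Pi.single a 1) (Pi.single b 1) *
      Zop h a (Zop h b u) x := by
    rw [h1]; simp [LinearMap.sum_apply]
  have h3 : ∀ k j, Dop h k (Xop j u) x =
      (h : ℂ) / Complex.I * (if k = j then 1 else 0) * u x + (x j : ℂ) * Dop h k u x := by
    intro k j
    have := congrArg (fun T : Module.End ℂ (SS n) => T u x) (comm_DX h k j)
    simp only [Module.End.mul_apply, LinearMap.add_apply, _root_.add_apply, LinearMap.smul_apply,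
      _root_.smul_apply, Module.End.one_apply, smul_eq_mul] at this
    rw [this, Xop_apply]; ring
  rw [h2]
  simp only [Fintype.sum_sum_type, fun j k => (qPolar_single A B C j k).1,
    fun j k => (qPolar_single A B C j k).2.1, fun j k => (qPolar_single A B C j k).2.2.1,
    fun j k => (qPolar_single A B C j k).2.2.2, Zop, Sum.elim_inl, Sum.elim_inr, DD_apply, h3,
    Xop_apply, Finset.sum_add_distrib]
  simp only [Dop_apply]
  have hI : ((h : ℂ) / Complex.I) ^ 2 = -(h : ℂ) ^ 2 := by
    rw [div_pow, Complex.I_sq, div_neg, div_one]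
  have e1 : ∑ j, ∑ k, A k j * ((x j : ℂ) * ((x k : ℂ) * u x)) =
      (∑ j, ∑ k, A j k * (x j : ℂ) * (x k : ℂ)) * u x := by
    simp only [Finset.sum_mul]
    refine Finset.sum_congr rfl fun j _ => Finset.sum_congr rfl fun k _ => ?_
    rw [← hAs.apply k j]; ring
  have e2 : ∑ j, ∑ k, C k j * (((h : ℂ) / Complex.I) ^ 2 *
      fderiv ℝ (fun y => fderiv ℝ u y (EuclideanSpace.single k 1)) x (EuclideanSpace.single j 1)) =
      - ((h : ℂ) ^ 2 * ∑ j, ∑ k, C j k *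
        fderiv ℝ (fun y => fderiv ℝ u y (EuclideanSpace.single k 1)) x
          (EuclideanSpace.single j 1)) := by
    simp only [hI, Finset.mul_sum, ← Finset.sum_neg_distrib]
    rw [Finset.sum_comm]
    refine Finset.sum_congr rfl fun j _ => Finset.sum_congr rfl fun k _ => ?_
    rw [fderiv2_symm]; ring
  rw [e1, e2]
  unfold weylQuant
  have e3 : ∑ k, ∑ j, B k j * ((h : ℂ) / Complex.I * (if k = j then 1 else 0) * u x) =
      ((h : ℂ) / Complex.I) * (∑ j, B j j) * u x := by
    simp only [Finset.mul_sum, Finset.sum_mul]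
    refine Finset.sum_congr rfl fun j _ => ?_
    rw [Finset.sum_eq_single j]
    · simp; ring
    · intro k _ hk
      simp [Ne.symm hk]
    · simp
  have e4 : ∑ k, ∑ j, B k j * ((x j : ℂ) * ((h : ℂ) / Complex.I * fderiv ℝ u x (EuclideanSpace.single k 1)))
      = ((h : ℂ) / Complex.I) * ∑ k, (∑ l, B k l * (x l : ℂ)) *
        fderiv ℝ u x (EuclideanSpace.single k 1) := by
    simp only [Finset.mul_sum, Finset.sum_mul]
    refine Finset.sum_congr rfl fun j _ => Finset.sum_congr rfl fun k _ => ?_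
    ring
  have e5 : ∑ j, ∑ k, B k j * ((x j : ℂ) * ((h : ℂ) / Complex.I * fderiv ℝ u x (EuclideanSpace.single k 1)))
      = ((h : ℂ) / Complex.I) * ∑ k, (∑ l, B k l * (x l : ℂ)) *
        fderiv ℝ u x (EuclideanSpace.single k 1) := by
    rw [Finset.sum_comm, e4]
  simp only [mul_add, Finset.sum_add_distrib]
  rw [e3, e4, e5]
  ring

end Ops


section Tower
variable {n : ℕ} {V : Type*} [AddCommGroup V] [Module ℂ V]

lemma exists_tower (B : Fin n → Module.End ℂ V) (hB : ∀ j k, B j * B k = B k * B j) (v0 : V) :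
    ∃ ψ : (Fin n → ℕ) → V, ψ 0 = v0 ∧ ∀ ν j, ψ (ν + Pi.single j 1) = B j (ψ ν) := by
  let φ : ∀ _ : Fin n, Multiplicative ℕ →* Module.End ℂ V := fun j => powersHom _ (B j)
  have hc : Pairwise fun i j => ∀ x y, Commute (φ i x) (φ j y) := by
    intro i j _ x y
    exact Commute.pow_pow (hB i j) _ _
  let Φ := MonoidHom.noncommPiCoprod φ hc
  refine ⟨fun ν => Φ (fun j => Multiplicative.ofAdd (ν j)) v0, ?_, ?_⟩
  · have : (fun j : Fin n => Multiplicative.ofAdd ((0 : Fin n → ℕ) j)) = 1 := rfl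
    simp only [this, map_one, Module.End.one_apply]
  · intro ν j
    have h1 : (fun k : Fin n => Multiplicative.ofAdd ((ν + Pi.single j 1 : Fin n → ℕ) k)) =
        Pi.mulSingle j (Multiplicative.ofAdd 1) * (fun k => Multiplicative.ofAdd (ν k)) := by
      funext k
      by_cases hk : k = j
      · subst hk; simp [mul_comm]
      · simp [hk]
    have h2 : Φ (Pi.mulSingle j (Multiplicative.ofAdd 1)) = B j := by
      rw [MonoidHom.noncommPiCoprod_mulSingle]
      simp [φ]
    simp only [h1, map_mul, h2, Module.End.mul_apply]

lemma nu_induction {P : (Fin n → ℕ) → Prop} (h0 : P 0) (hs : ∀ ν j, P ν → P (ν + Pi.single j 1))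
    (ν : Fin n → ℕ) : P ν := by
  induction hN : ∑ j, ν j generalizing ν with
  | zero =>
    have : ν = 0 := by
      funext j
      exact (Finset.sum_eq_zero_iff.mp hN) j (Finset.mem_univ j)
    rwa [this]
  | succ N ih =>
    obtain ⟨j, hj⟩ : ∃ j, ν j ≠ 0 := by
      by_contra hcon
      push Not at hcon
      simp [hcon] at hN
    have h1 : ν = (ν - Pi.single j 1) + Pi.single j 1 := by
      funext k
      by_cases hk : k = j
      · subst hk; simp; omega
      · simp [hk]
    rw [h1]
    apply hs
    apply ih
    have h2 := congrArg (fun w : Fin n → ℕ => ∑ j, w j) h1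
    simp only [Pi.add_apply, Finset.sum_add_distrib, Finset.sum_pi_single', Finset.mem_univ, if_true] at h2
    simp only [hN] at h2
    have h3 : ∑ k, (Pi.single j 1 : Fin n → ℕ) k = 1 := by simp
    omega

end Tower

section Ladder
variable {n : ℕ} {e f : Fin n → (Fin n ⊕ Fin n → ℂ)} {lam : Fin n → ℂ}

lemma NF.commAB (hN : NF e f lam) (h : ℝ) (j k : Fin n) :
    Op h (e j) * Op h (f k) = Op h (f k) * Op h (e j) + ((h : ℂ) / Complex.I * if j = k then 1 else 0) • 1 := by
  rw [← hN.ef, ← comm_Op]; abel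

lemma NF.commBB (hN : NF e f lam) (h : ℝ) (j k : Fin n) :
    Op h (f j) * Op h (f k) = Op h (f k) * Op h (f j) := by
  have := comm_Op h (f j) (f k)
  rw [hN.ff] at this
  rw [← sub_eq_zero, this]; simp

lemma NF.number (hN : NF e f lam) (h : ℝ) (ψ : (Fin n → ℕ) → SS n)
    (hA : ∀ j, Op h (e j) (ψ 0) = 0) (hB : ∀ ν j, ψ (ν + Pi.single j 1) = Op h (f j) (ψ ν))
    (j : Fin n) (ν : Fin n → ℕ) :
    Op h (f j) (Op h (e j) (ψ ν)) = ((h : ℂ) / Complex.I * ν j) • ψ ν := by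
  induction ν using nu_induction with
  | h0 => simp [hA]
  | hs ν k ih =>
    rw [hB]
    have h1 := congrArg (fun T : Module.End ℂ (SS n) => T (ψ ν)) (hN.commAB h j k)
    have h2 := fun w => congrArg (fun T : Module.End ℂ (SS n) => T w) (hN.commBB h j k)
    simp only [Module.End.mul_apply, LinearMap.add_apply, LinearMap.smul_apply,
      Module.End.one_apply] at h1 h2
    rw [h1, map_add, h2, ih, map_smul, map_smul]
    by_cases hjk : j = k
    · subst hjk
      rw [← add_smul]
      congr 1
      simp; ring
    · simp [hjk]

lemma NF.eigen (hN : NF e f lam) (h : ℝ) (ψ : (Fin n → ℕ) → SS n)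
    (hA : ∀ j, Op h (e j) (ψ 0) = 0) (hB : ∀ ν j, ψ (ν + Pi.single j 1) = Op h (f j) (ψ ν))
    (s : Fin n → ℂ) (ν : Fin n → ℕ) :
    Qop h e f s (ψ ν) = (-(h * rate s ν)) • ψ ν := by
  have h1 : Qop h e f s (ψ ν) = ∑ j, (s j * ((h : ℂ) / Complex.I * (2 * ν j + 1))) • ψ ν := by
    simp only [Qop, LinearMap.sum_apply, LinearMap.smul_apply, LinearMap.add_apply, Module.End.mul_apply]
    refine Finset.sum_congr rfl fun j _ => ?_
    have h1 := congrArg (fun T : Module.End ℂ (SS n) => T (ψ ν)) (hN.commAB h j j)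
    simp only [Module.End.mul_apply, LinearMap.add_apply, LinearMap.smul_apply,
      Module.End.one_apply, if_true, mul_one] at h1
    rw [h1, hN.number h ψ hA hB, ← add_smul, ← add_smul, smul_smul]
    congr 1; ring
  rw [h1, ← Finset.sum_smul]
  congr 1
  simp only [rate, Finset.mul_sum, ← Finset.sum_neg_distrib]
  refine Finset.sum_congr rfl fun j _ => ?_
  rw [Complex.div_I]; ring

lemma NF.invar (hN : NF e f lam) (h : ℝ) (ψ : (Fin n → ℕ) → SS n)
    (hA : ∀ j, Op h (e j) (ψ 0) = 0) (hB : ∀ ν j, ψ (ν + Pi.single j 1) = Op h (f j) (ψ ν))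
    (Y : Fin n ⊕ Fin n → ℂ) (g : SS n) (hg : g ∈ Submodule.span ℂ (Set.range ψ)) :
    Op h Y g ∈ Submodule.span ℂ (Set.range ψ) := by
  have hmem : ∀ ν, ψ ν ∈ Submodule.span ℂ (Set.range ψ) := fun ν => Submodule.subset_span ⟨ν, rfl⟩
  have hext : ∀ T : Module.End ℂ (SS n), (∀ ν, T (ψ ν) ∈ Submodule.span ℂ (Set.range ψ)) →
      ∀ g ∈ Submodule.span ℂ (Set.range ψ), T g ∈ Submodule.span ℂ (Set.range ψ) := by
    intro T hT g hg
    induction hg using Submodule.span_induction with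
    | mem x hx => obtain ⟨ν, rfl⟩ := hx; exact hT ν
    | zero => simp
    | add x y _ _ hx hy => rw [map_add]; exact Submodule.add_mem _ hx hy
    | smul a x _ hx => rw [map_smul]; exact Submodule.smul_mem _ _ hx
  have hf : ∀ j, ∀ g ∈ Submodule.span ℂ (Set.range ψ), Op h (f j) g ∈ Submodule.span ℂ (Set.range ψ) :=
    fun j => hext _ fun ν => by rw [← hB]; exact hmem _
  have he : ∀ j, ∀ g ∈ Submodule.span ℂ (Set.range ψ), Op h (e j) g ∈ Submodule.span ℂ (Set.range ψ) := by
    intro j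
    refine hext _ fun ν => ?_
    induction ν using nu_induction with
    | h0 => simp [hA]
    | hs ν k ih =>
      rw [hB]
      have h1 := congrArg (fun T : Module.End ℂ (SS n) => T (ψ ν)) (hN.commAB h j k)
      simp only [Module.End.mul_apply, LinearMap.add_apply, LinearMap.smul_apply,
        Module.End.one_apply] at h1
      rw [h1]
      exact Submodule.add_mem _ (hf k _ ih) (Submodule.smul_mem _ _ (hmem ν))
  rw [hN.span Y, Op_sum, LinearMap.sum_apply]
  refine Submodule.sum_mem _ fun j _ => ?_
  rw [Op_add, Op_smul, Op_smul]
  exact Submodule.add_mem _ (Submodule.smul_mem _ _ (he j g hg)) (Submodule.smul_mem _ _ (hf j g hg))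

lemma NF.invarX (hN : NF e f lam) (h : ℝ) (ψ : (Fin n → ℕ) → SS n)
    (hA : ∀ j, Op h (e j) (ψ 0) = 0) (hB : ∀ ν j, ψ (ν + Pi.single j 1) = Op h (f j) (ψ ν))
    (k : Fin n) (g : SS n) (hg : g ∈ Submodule.span ℂ (Set.range ψ)) :
    Xop k g ∈ Submodule.span ℂ (Set.range ψ) := by
  have := hN.invar h ψ hA hB (Pi.single (Sum.inr k) 1) g hg
  convert this using 1
  ext x
  rw [Op_apply]
  simp [sympForm, Pi.single_apply, vec, Zop]

end Ladder


section Gauss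
variable {n : ℕ}

lemma norm_iteratedFDeriv_cexp (i : ℕ) (z : ℂ) : ‖iteratedFDeriv ℝ i Complex.exp z‖ = ‖Complex.exp z‖ := by
  have h1 : ContDiffAt ℂ i Complex.exp z := Complex.contDiff_exp.contDiffAt
  rw [← h1.restrictScalars_iteratedFDeriv (𝕜 := ℝ), Function.comp_apply,
    ContinuousMultilinearMap.norm_restrictScalars, norm_iteratedFDeriv_eq_norm_iteratedDeriv,
    iteratedDeriv_eq_iterate, Complex.iter_deriv_exp]

lemma pow_gauss_bound (m : ℝ) (hm : 0 < m) (p : ℕ) :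
    ∃ C, ∀ t : ℝ, 0 ≤ t → (1 + t) ^ p * Real.exp (-(m * t ^ 2)) ≤ C := by
  refine ⟨p.factorial * Real.exp (1 + 1 / (4 * m)), fun t ht => ?_⟩
  have h1 := Real.pow_div_factorial_le_exp (x := 1 + t) (by positivity) p
  rw [div_le_iff₀ (by positivity)] at h1
  calc (1 + t) ^ p * Real.exp (-(m * t ^ 2)) ≤ (Real.exp (1 + t) * p.factorial) * Real.exp (-(m * t ^ 2)) := by
        gcongr
    _ = p.factorial * Real.exp ((1 + t) + (-(m * t ^ 2))) := by rw [Real.exp_add (1 + t)]; ring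
    _ ≤ _ := by
        refine mul_le_mul_of_nonneg_left (Real.exp_le_exp.mpr ?_) (by positivity)
        have : 1 / (4 * m) - t + m * t ^ 2 = m * (t - 1 / (2 * m)) ^ 2 := by
          field_simp; ring
        have := mul_nonneg hm.le (sq_nonneg (t - 1 / (2 * m)))
        linarith

lemma exists_gauss (q : EuclideanSpace ℝ (Fin n) → ℂ) (hq : q.HasTemperateGrowth) (m : ℝ) (hm : 0 < m)
    (hre : ∀ x, (q x).re ≤ -(m * ‖x‖ ^ 2)) : ∃ ψ : SS n, ∀ x, ψ x = Complex.exp (q x) := by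
  refine ⟨⟨Complex.exp ∘ q, ?_, ?_⟩, fun x => rfl⟩
  · exact ((Complex.contDiff_exp (𝕜 := ℂ)).restrict_scalars ℝ).comp hq.1
  · intro k N
    obtain ⟨l, C, hC, hb⟩ := hq.norm_iteratedFDeriv_le_uniform N
    obtain ⟨D, hD⟩ := pow_gauss_bound m hm (k + l * N)
    refine ⟨N.factorial * (C + 1) ^ N * D, fun x => ?_⟩
    have h1 : ‖iteratedFDeriv ℝ N (Complex.exp ∘ q) x‖ ≤
        N.factorial * ‖Complex.exp (q x)‖ * ((C + 1) * (1 + ‖x‖) ^ l) ^ N := by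
      refine norm_iteratedFDeriv_comp_le (N := ((⊤ : ℕ∞) : WithTop ℕ∞)) ((Complex.contDiff_exp (𝕜 := ℂ)).restrict_scalars ℝ) hq.1
        (by exact_mod_cast le_top) x (fun i _ => (norm_iteratedFDeriv_cexp i _).le) ?_
      intro i hi hiN
      have hl : (1 : ℝ) ≤ (1 + ‖x‖) ^ l := one_le_pow₀ (by linarith [norm_nonneg x])
      have h2 : (1 : ℝ) ≤ (C + 1) * (1 + ‖x‖) ^ l := by nlinarith
      calc _ ≤ C * (1 + ‖x‖) ^ l := hb i hiN x
        _ ≤ (C + 1) * (1 + ‖x‖) ^ l := by gcongr; linarith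
        _ ≤ _ := le_self_pow₀ h2 (by omega)
    have h3 : ‖Complex.exp (q x)‖ ≤ Real.exp (-(m * ‖x‖ ^ 2)) := by
      rw [Complex.norm_exp]; exact Real.exp_le_exp.mpr (hre x)
    calc ‖x‖ ^ k * ‖iteratedFDeriv ℝ N (Complex.exp ∘ q) x‖
        ≤ (1 + ‖x‖) ^ k * (N.factorial * Real.exp (-(m * ‖x‖ ^ 2)) * ((C + 1) * (1 + ‖x‖) ^ l) ^ N) := by
          refine mul_le_mul (pow_le_pow_left₀ (norm_nonneg _) (by linarith) _) (h1.trans ?_)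
            (norm_nonneg _) (by positivity)
          gcongr
      _ = N.factorial * (C + 1) ^ N * ((1 + ‖x‖) ^ (k + l * N) * Real.exp (-(m * ‖x‖ ^ 2))) := by
          rw [pow_add, pow_mul, mul_pow]; ring
      _ ≤ _ := by
          refine mul_le_mul_of_nonneg_left (hD _ (norm_nonneg _)) (by positivity)

/-- the quadratic phase -/
noncomputable def phase (K : Matrix (Fin n) (Fin n) ℂ) (h : ℝ) (x : EuclideanSpace ℝ (Fin n)) : ℂ :=
  Complex.I / (2 * h) * ∑ j, ∑ k, K j k * (coordFn j x * coordFn k x)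

lemma phase_tg (K : Matrix (Fin n) (Fin n) ℂ) (h : ℝ) : (phase K h).HasTemperateGrowth := by
  have h1 : ∀ j k : Fin n, Function.HasTemperateGrowth (fun x => K j k * (coordFn j x * coordFn k x)) :=
    fun j k => (Function.HasTemperateGrowth.const (K j k)).mul ((coordFn_tg j).mul (coordFn_tg k))
  exact (Function.HasTemperateGrowth.const _).mul
    (Function.HasTemperateGrowth.sum fun j _ => Function.HasTemperateGrowth.sum fun k _ => h1 j k)

lemma phase_re (K : Matrix (Fin n) (Fin n) ℂ)
    (hK : ∀ x : Fin n → ℝ, x ≠ 0 → 0 < (∑ j, ∑ k, K j k * x j * x k).im) (h : ℝ) (hh : 0 < h) :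
    ∃ m > 0, ∀ x, (phase K h x).re ≤ -(m * ‖x‖ ^ 2) := by
  have hcont : Continuous fun x : EuclideanSpace ℝ (Fin n) => -(phase K h x).re :=
    (Complex.continuous_re.comp (phase_tg K h).1.continuous).neg
  have hneg : ∀ x : EuclideanSpace ℝ (Fin n), x ≠ 0 → 0 < -(phase K h x).re := by
    intro x hx
    have h1 := hK x (fun h0 => hx (by ext j; exact congrFun h0 j))
    have h2 : phase K h x = ((1 / (2 * h) : ℝ) : ℂ) * (Complex.I * ∑ j, ∑ k, K j k * x j * x k) := by
      simp only [phase, coordFn, mul_assoc]; push_cast; ring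
    rw [h2, Complex.re_ofReal_mul, Complex.I_mul_re, mul_neg, neg_neg]
    positivity
  obtain ⟨m, hm, hmb⟩ := (isCompact_sphere (0 : EuclideanSpace ℝ (Fin n)) 1).exists_forall_le'
    hcont.continuousOn (a := 0) (fun x hx => hneg x (by rintro rfl; simp at hx))
  refine ⟨m, hm, fun x => ?_⟩
  by_cases hx : x = 0
  · subst hx; simp [phase, coordFn]
  have hx' : 0 < ‖x‖ := norm_pos_iff.mpr hx
  have h1 := hmb (‖x‖⁻¹ • x) (by simp [norm_smul, hx'.ne'])
  have h2 : phase K h x = ((‖x‖ ^ 2 : ℝ) : ℂ) * phase K h (‖x‖⁻¹ • x) := by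
    have hx2 : (‖x‖ : ℂ) ≠ 0 := by exact_mod_cast hx'.ne'
    simp only [phase, coordFn, Finset.mul_sum]
    refine Finset.sum_congr rfl fun j _ => Finset.sum_congr rfl fun k _ => ?_
    simp only [PiLp.smul_apply, smul_eq_mul]
    push_cast
    field_simp
  rw [h2, Complex.re_ofReal_mul]
  nlinarith [sq_nonneg ‖x‖]

lemma fderiv_phase (K : Matrix (Fin n) (Fin n) ℂ) (hs : K.IsSymm) (h : ℝ) (hh : 0 < h) (x) (m : Fin n) :
    fderiv ℝ (phase K h) x (EuclideanSpace.single m 1) =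
      Complex.I / h * K.mulVec (fun j => (x j : ℂ)) m := by
  have h2 : ∀ j, HasFDerivAt (coordFn j)
      (Complex.ofRealCLM.comp (EuclideanSpace.proj j : EuclideanSpace ℝ (Fin n) →L[ℝ] ℝ)) x := by
    intro j
    rw [coordFn_eq]; exact ContinuousLinearMap.hasFDerivAt _
  have h3 : HasFDerivAt (phase K h) _ x := (HasFDerivAt.fun_sum (u := Finset.univ) fun j _ =>
    HasFDerivAt.fun_sum (u := Finset.univ) fun k _ => ((h2 j).mul (h2 k)).const_mul (K j k)).const_mul
      (Complex.I / (2 * h))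
  rw [h3.fderiv]
  have hsg : ∀ j, (((EuclideanSpace.proj j : EuclideanSpace ℝ (Fin n) →L[ℝ] ℝ) (EuclideanSpace.single m (1 : ℝ)) : ℝ) : ℂ) =
      if j = m then 1 else 0 := by
    intro j
    by_cases hj : j = m <;> simp [hj]
  simp only [_root_.smul_apply, _root_.sum_apply, _root_.add_apply, ContinuousLinearMap.comp_apply,
    Complex.ofRealCLM_apply, hsg, smul_eq_mul, coordFn]
  have e1 : ∑ j, ∑ k, K j k * ((x j : ℂ) * (if k = m then 1 else 0) + (x k : ℂ) * (if j = m then 1 else 0))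
      = 2 * K.mulVec (fun j => (x j : ℂ)) m := by
    simp only [mul_add, Finset.sum_add_distrib]
    rw [two_mul]
    congr 1
    · simp only [Matrix.mulVec, dotProduct]
      refine Finset.sum_congr rfl fun j _ => ?_
      rw [← hs.apply m j]
      simp
    · rw [Finset.sum_comm]
      simp only [Matrix.mulVec, dotProduct]
      refine Finset.sum_congr rfl fun j _ => ?_
      simp
  rw [e1]
  have hne : (h : ℂ) ≠ 0 := by exact_mod_cast hh.ne'
  field_simp

lemma NF.exists_psi {e f : Fin n → (Fin n ⊕ Fin n → ℂ)} {lam : Fin n → ℂ} (hN : NF e f lam)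
    (h : ℝ) (hh : 0 < h) : ∃ ψ : (Fin n → ℕ) → SS n, (∀ j, Op h (e j) (ψ 0) = 0) ∧
      (∀ ν j, ψ (ν + Pi.single j 1) = Op h (f j) (ψ ν)) ∧ (∀ x, ψ 0 x ≠ 0) ∧
      ∃ m > 0, ∀ x, ‖ψ 0 x‖ ≤ Real.exp (-(m * ‖x‖ ^ 2)) := by
  obtain ⟨K, hs, hpos, hann⟩ := hN.ground
  obtain ⟨m, hm, hre⟩ := phase_re K hpos h hh
  obtain ⟨ψ₀, hψ₀⟩ := exists_gauss _ (phase_tg K h) m hm hre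
  obtain ⟨ψ, h0, hB⟩ := exists_tower (fun j => Op h (f j)) (fun j k => hN.commBB h j k) ψ₀
  refine ⟨ψ, ?_, hB, ?_, m, hm, ?_⟩
  · intro j
    ext x
    rw [h0, Op_apply]
    have hv : vec h ψ₀ x = ψ₀ x • Sum.elim (fun j => (x j : ℂ)) (K.mulVec fun j => (x j : ℂ)) := by
      have hd : ∀ k, fderiv ℝ ψ₀ x (EuclideanSpace.single k 1) =
          ψ₀ x * (Complex.I / h * K.mulVec (fun j => (x j : ℂ)) k) := by
        intro k
        have h1 : (ψ₀ : EuclideanSpace ℝ (Fin n) → ℂ) = fun y => Complex.exp (phase K h y) := funext hψ₀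
        have h2 : HasFDerivAt (phase K h) (fderiv ℝ (phase K h) x) x :=
          ((phase_tg K h).1.differentiable (by simp) x).hasFDerivAt
        rw [h1, h2.cexp.fderiv, ← fderiv_phase K hs h hh]
        simp
      have hne : (h : ℂ) ≠ 0 := by exact_mod_cast hh.ne'
      funext a
      rcases a with k | k
      · simp [vec, Zop, Xop_apply, mul_comm]
      · simp only [vec, Zop, Sum.elim_inr, Dop_apply, hd, Pi.smul_apply, smul_eq_mul]
        field_simp
    rw [hv, sympForm_smul_right, hann, mul_zero]
    rfl
  · intro x; rw [h0, hψ₀]; exact Complex.exp_ne_zero _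
  · intro x; rw [h0, hψ₀, Complex.norm_exp]; exact Real.exp_le_exp.mpr (hre x)

end Gauss


section Density
variable {n : ℕ}
open FourierTransform
open scoped ContDiff RealInnerProductSpace

lemma fourierInt_zero (G : EuclideanSpace ℝ (Fin n) → ℂ) (hG : Integrable G)
    (h0 : ∀ ξ, ∫ x, Real.fourierChar (-⟪x, ξ⟫) • G x = 0) : G =ᵐ[volume] 0 := by
  have key : ∀ φ : SS n, ∫ x, φ x * G x = 0 := by
    intro φ
    have h1 := (VectorFourier.integral_fourierIntegral_smul_eq_flip
      (L := innerₗ (EuclideanSpace ℝ (Fin n)))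
      Real.continuous_fourierChar continuous_inner ((𝓕⁻ φ : SS n).integrable (μ := volume)) hG)
    have h2 : ∀ x, VectorFourier.fourierIntegral Real.fourierChar volume
        (innerₗ (EuclideanSpace ℝ (Fin n))).flip G x = 0 := by
      intro ξ
      rw [VectorFourier.fourierIntegral]
      simpa [real_inner_comm] using h0 ξ
    have h3 : ∀ x, VectorFourier.fourierIntegral Real.fourierChar volume
        (innerₗ (EuclideanSpace ℝ (Fin n))) (𝓕⁻ φ : SS n) x = φ x := by
      intro x
      have : (𝓕 (𝓕⁻ φ : SS n) : SS n) x = φ x := by rw [FourierTransform.fourier_fourierInv_eq]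
      rw [← this, SchwartzMap.fourier_coe]
      rfl
    simp only [h2, h3, smul_zero, integral_zero] at h1
    simpa using h1
  apply ae_eq_zero_of_integral_contDiff_smul_eq_zero hG.locallyIntegrable
  intro g g_smooth g_cpt
  have hg₁ : HasCompactSupport (Complex.ofRealCLM ∘ g) := g_cpt.comp_left rfl
  have hg₂ : ContDiff ℝ ∞ (Complex.ofRealCLM ∘ g) := by fun_prop
  have := key (hg₁.toSchwartzMap hg₂)
  simpa using this

lemma gauss_memLp (c m : ℝ) (hm : 0 < m) :
    MemLp (fun x : EuclideanSpace ℝ (Fin n) => Real.exp (c * ‖x‖) * Real.exp (-(m * ‖x‖ ^ 2))) 2 := by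
  have hcont : Continuous (fun x : EuclideanSpace ℝ (Fin n) =>
    Real.exp (c * ‖x‖) * Real.exp (-(m * ‖x‖ ^ 2))) := by fun_prop
  rw [memLp_two_iff_integrable_sq hcont.aestronglyMeasurable]
  have hIntg : Integrable (fun x : EuclideanSpace ℝ (Fin n) => Real.exp (-(m * ‖x‖ ^ 2))) := by
    have := (GaussianFourier.integrable_cexp_neg_mul_sq_norm_add (V := EuclideanSpace ℝ (Fin n))
      (b := (m : ℂ)) (by simpa) 0 0).norm
    refine this.congr (Filter.Eventually.of_forall fun x => ?_)
    simp only [Complex.norm_exp]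
    congr 1
    have : (-(m : ℂ) * (‖x‖ : ℂ) ^ 2 + 0 * ((inner ℝ (0 : EuclideanSpace ℝ (Fin n)) x : ℝ) : ℂ))
      = ((-(m * ‖x‖ ^ 2) : ℝ) : ℂ) := by push_cast; ring
    rw [this, Complex.ofReal_re]
  refine (hIntg.const_mul (Real.exp (c ^ 2 / m))).mono' (hcont.pow 2).aestronglyMeasurable
    (Filter.Eventually.of_forall fun x => ?_)
  rw [Real.norm_of_nonneg (by positivity), ← Real.exp_add, ← Real.exp_add, ← Real.exp_nat_mul]
  apply Real.exp_le_exp.2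
  have : 0 ≤ (m * ‖x‖ - c) ^ 2 / m := by positivity
  have h2 : (m * ‖x‖ - c) ^ 2 / m = m * ‖x‖ ^ 2 - 2 * c * ‖x‖ + c ^ 2 / m := by
    field_simp; ring
  push_cast
  linarith

lemma moments_zero (F : EuclideanSpace ℝ (Fin n) → ℂ) (hF : MemLp F 2) (p : SS n) (m : ℝ) (hm : 0 < m)
    (hp : ∀ x, ‖p x‖ ≤ Real.exp (-(m * ‖x‖ ^ 2))) (ξ : EuclideanSpace ℝ (Fin n))
    (h0 : ∀ k : ℕ, ∫ x, F x * ((⟪x, ξ⟫ : ℂ) ^ k * p x) = 0) :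
    ∫ x, Real.fourierChar (-⟪x, ξ⟫) • (F x * p x) = 0 := by
  set c : ℝ := 2 * Real.pi * ‖ξ‖ with hc
  have hs := hasSum_integral_of_dominated_convergence (μ := (volume : Measure (EuclideanSpace ℝ (Fin n))))
    (F := fun (k : ℕ) x => ((2 * Real.pi * (-⟪x, ξ⟫ : ℝ) * Complex.I : ℂ) ^ k / (k.factorial : ℂ)) * (F x * p x))
    (f := fun x => Real.fourierChar (-⟪x, ξ⟫) • (F x * p x))
    (fun k x => ((c * ‖x‖) ^ k / (k.factorial : ℝ)) * (‖F x‖ * Real.exp (-(m * ‖x‖ ^ 2)))) ?_ ?_ ?_ ?_ ?_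
  · have hz : ∀ k : ℕ, ∫ x, ((2 * Real.pi * (-⟪x, ξ⟫ : ℝ) * Complex.I : ℂ) ^ k / (k.factorial : ℂ)) * (F x * p x) = 0 := by
      intro k
      have : ∀ x, ((2 * Real.pi * (-⟪x, ξ⟫ : ℝ) * Complex.I : ℂ) ^ k / (k.factorial : ℂ)) * (F x * p x)
        = ((-2 * Real.pi * Complex.I) ^ k / (k.factorial : ℂ)) * (F x * ((⟪x, ξ⟫ : ℂ) ^ k * p x)) := by
        intro x
        push_cast
        have : (2 * Real.pi * (-⟪x, ξ⟫ : ℝ) * Complex.I : ℂ) = (-2 * Real.pi * Complex.I) * (⟪x, ξ⟫ : ℂ) := by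
          push_cast; ring
        push_cast at this
        rw [this, mul_pow]; ring
      simp only [this]
      rw [integral_const_mul, h0 k, mul_zero]
    simp only [hz] at hs
    exact (hs.unique hasSum_zero)
  · intro k
    refine AEStronglyMeasurable.mul ?_ (hF.1.mul p.continuous.aestronglyMeasurable)
    exact Continuous.aestronglyMeasurable (by fun_prop)
  · intro k
    refine Filter.Eventually.of_forall fun x => ?_
    rw [norm_mul, norm_mul, norm_div, norm_pow]
    have h1 : ‖(2 * Real.pi * (-⟪x, ξ⟫ : ℝ) * Complex.I : ℂ)‖ ≤ c * ‖x‖ := by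
      rw [norm_mul, norm_mul, norm_mul, Complex.norm_I, Complex.norm_real, Complex.norm_real, norm_neg]
      simp only [Complex.norm_ofNat, mul_one, Real.norm_of_nonneg Real.pi_pos.le, hc]
      have := norm_inner_le_norm (𝕜 := ℝ) x ξ
      calc 2 * Real.pi * ‖⟪x, ξ⟫‖ ≤ 2 * Real.pi * (‖x‖ * ‖ξ‖) := by gcongr
        _ = _ := by ring
    simp only [Complex.norm_natCast]
    have := hp x
    gcongr
  · refine Filter.Eventually.of_forall fun x => ?_
    exact (Real.summable_pow_div_factorial _).mul_right _
  · have : ∀ x : EuclideanSpace ℝ (Fin n), ∑' k : ℕ, ((c * ‖x‖) ^ k / (k.factorial : ℝ)) * (‖F x‖ * Real.exp (-(m * ‖x‖ ^ 2)))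
        = ‖F x‖ * (Real.exp (c * ‖x‖) * Real.exp (-(m * ‖x‖ ^ 2))) := by
      intro x
      have hx := (NormedSpace.expSeries_div_hasSum_exp (c * ‖x‖)).tsum_eq
      rw [tsum_mul_right, hx, ← Real.exp_eq_exp_ℝ]
      ring
    simp only [this]
    exact hF.norm.integrable_mul (gauss_memLp c m hm)
  · refine Filter.Eventually.of_forall fun x => ?_
    have h1 := (NormedSpace.expSeries_div_hasSum_exp (2 * Real.pi * (-⟪x, ξ⟫ : ℝ) * Complex.I : ℂ)).mul_right (F x * p x)
    have h2 : (Real.fourierChar (-⟪x, ξ⟫) : ℂ) = NormedSpace.exp (2 * Real.pi * (-⟪x, ξ⟫ : ℝ) * Complex.I : ℂ) := by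
      rw [Real.fourierChar_apply, Complex.exp_eq_exp_ℂ]
      push_cast; rfl
    rw [Circle.smul_def, smul_eq_mul, h2]
    exact h1

lemma NF.dense {e f : Fin n → (Fin n ⊕ Fin n → ℂ)} {lam : Fin n → ℂ} (hN : NF e f lam) (h : ℝ)
    (ψ : (Fin n → ℕ) → SS n) (hA : ∀ j, Op h (e j) (ψ 0) = 0)
    (hB : ∀ ν j, ψ (ν + Pi.single j 1) = Op h (f j) (ψ ν))
    (hne : ∀ x, ψ 0 x ≠ 0) (m : ℝ) (hm : 0 < m) (hp : ∀ x, ‖ψ 0 x‖ ≤ Real.exp (-(m * ‖x‖ ^ 2))) :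
    ((Submodule.span ℂ (Set.range ψ)).map
      (SchwartzMap.toLpCLM ℂ ℂ 2 (volume : Measure (EuclideanSpace ℝ (Fin n)))).toLinearMap).topologicalClosure = ⊤ := by
  rw [Submodule.topologicalClosure_eq_top_iff, Submodule.eq_bot_iff]
  intro F hF
  rw [Submodule.mem_orthogonal'] at hF
  have hmem : ∀ (ξ : EuclideanSpace ℝ (Fin n)) (k : ℕ), ∃ g ∈ Submodule.span ℂ (Set.range ψ),
      ∀ x, g x = (⟪x, ξ⟫ : ℂ) ^ k * ψ 0 x := by
    intro ξ k
    induction k with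
    | zero => exact ⟨ψ 0, Submodule.subset_span ⟨0, rfl⟩, fun x => by simp⟩
    | succ k ih =>
      obtain ⟨g, hg, hgx⟩ := ih
      refine ⟨∑ j, (ξ j : ℂ) • Xop j g, Submodule.sum_mem _ fun j _ =>
        Submodule.smul_mem _ _ (hN.invarX h ψ hA hB j g hg), fun x => ?_⟩
      have : (⟪x, ξ⟫ : ℂ) = ∑ j, (ξ j : ℂ) * (x j : ℂ) := by
        rw [PiLp.inner_apply]; push_cast; simp
      rw [SchwartzMap.sum_apply]
      simp only [SchwartzMap.smul_apply, Xop_apply, hgx, smul_eq_mul]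
      rw [pow_succ, mul_comm _ (⟪x, ξ⟫ : ℂ), this, mul_assoc, Finset.sum_mul]
      exact Finset.sum_congr rfl fun j _ => by ring
  have hFm := Lp.memLp F
  have hcF : MemLp (fun x => (starRingEnd ℂ) (F x)) 2 := hFm.star
  have hG0 : ∀ g ∈ Submodule.span ℂ (Set.range ψ), ∫ x, (starRingEnd ℂ) (F x) * g x = 0 := by
    intro g hg
    have := hF _ (Submodule.mem_map_of_mem hg)
    rw [L2.inner_def] at this
    rw [← this]
    apply integral_congr_ae
    filter_upwards [SchwartzMap.coeFn_toLp g 2 (volume : Measure (EuclideanSpace ℝ (Fin n)))] with x hx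
    simp only [ContinuousLinearMap.coe_coe, SchwartzMap.toLpCLM_apply, hx, RCLike.inner_apply]
    ring
  have hz := fourierInt_zero (fun x => (starRingEnd ℂ) (F x) * ψ 0 x)
    (hcF.integrable_mul ((ψ 0).memLp 2 _)) (fun ξ => by
      apply moments_zero _ hcF (ψ 0) m hm hp ξ
      intro k
      obtain ⟨g, hg, hgx⟩ := hmem ξ k
      rw [← hG0 g hg]
      simp only [hgx])
  rw [Lp.eq_zero_iff_ae_eq_zero]
  filter_upwards [hz] with x hx
  simpa [hne x] using hx

end Density


section Final
variable {n : ℕ}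

lemma span_fin {V : Type*} [AddCommGroup V] [Module ℂ V] (ψ : (Fin n → ℕ) → V) (g : V)
    (hg : g ∈ Submodule.span ℂ (Set.range ψ)) :
    ∃ (M : ℕ) (c : (Fin n → Fin M) → ℂ), g = ∑ ν, c ν • ψ (fun j => ν j) := by
  obtain ⟨c, hc⟩ := Finsupp.mem_span_range_iff_exists_finsupp.1 hg
  set M := c.support.sup (fun ν => ∑ j, ν j) + 1 with hM
  refine ⟨M, fun ν => c (fun j => ν j), ?_⟩
  have hinj : Function.Injective (fun (ν : Fin n → Fin M) (j : Fin n) => (ν j : ℕ)) := by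
    intro a b hab
    funext j
    exact Fin.ext (congrFun hab j)
  have hsub : c.support ⊆ Finset.univ.image (fun (ν : Fin n → Fin M) (j : Fin n) => (ν j : ℕ)) := by
    intro ν hν
    have hlt : ∀ j, ν j < M := by
      intro j
      have h1 : ν j ≤ ∑ i, ν i := Finset.single_le_sum (fun i _ => Nat.zero_le (ν i)) (Finset.mem_univ j)
      have h2 : ∑ i, ν i ≤ c.support.sup (fun ν => ∑ j, ν j) :=
        Finset.le_sup (f := fun ν : Fin n → ℕ => ∑ j, ν j) hν
      omega
    exact Finset.mem_image.2 ⟨fun j => ⟨ν j, hlt j⟩, Finset.mem_univ _, rfl⟩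
  rw [← hc, Finsupp.sum_of_support_subset c hsub _ (by simp), Finset.sum_image (fun a _ b _ hab => hinj hab)]

lemma norm_toLp_l2 (u : SS n) : ‖u.toLp 2 (volume : Measure (EuclideanSpace ℝ (Fin n)))‖ = l2Norm (fun x => u x) := by
  rw [SchwartzMap.norm_toLp' (by simp) (by simp), l2Norm, Real.sqrt_eq_rpow]
  norm_num

lemma norm_cS (u : SS n) : ‖(cS u).toLp 2 (volume : Measure (EuclideanSpace ℝ (Fin n)))‖ = l2Norm (fun x => u x) := by
  rw [norm_toLp_l2, l2Norm, l2Norm]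
  simp [cS_apply]

lemma inner_cS (u g : SS n) : inner ℂ ((cS u).toLp 2 (volume : Measure (EuclideanSpace ℝ (Fin n))))
    (g.toLp 2 volume) = ∫ x, u x * g x := by
  rw [SchwartzMap.inner_toL2_toL2_eq (cS u) g volume]
  refine integral_congr_ae (Filter.Eventually.of_forall fun x => ?_)
  simp [cS_apply, RCLike.inner_apply, mul_comm]

lemma norm_le_of_dense {H : Type*} [NormedAddCommGroup H] [InnerProductSpace ℂ H]
    (S : Submodule ℂ H) (hS : S.topologicalClosure = ⊤) (x : H) (K : ℝ) (hK0 : 0 ≤ K)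
    (hK : ∀ g ∈ S, ‖inner ℂ x g‖ ≤ K * ‖g‖) : ‖x‖ ≤ K := by
  have hd : Dense (S : Set H) := by
    rw [Submodule.dense_iff_topologicalClosure_eq_top]; exact hS
  have h1 : ‖inner ℂ x x‖ ≤ K * ‖x‖ :=
    hd.induction (P := fun g => ‖inner ℂ x g‖ ≤ K * ‖g‖) (fun g hg => hK g hg)
      (isClosed_le (by fun_prop) (by fun_prop)) x
  rw [inner_self_eq_norm_sq_to_K] at h1
  by_cases hx : ‖x‖ = 0
  · rw [hx]; exact hK0
  · have hx' : 0 < ‖x‖ := lt_of_le_of_ne (norm_nonneg _) (Ne.symm hx)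
    simp at h1
    nlinarith

lemma NF.resolvent {e f : Fin n → (Fin n ⊕ Fin n → ℂ)} {lam : Fin n → ℂ} (hN : NF e f lam)
    (hlam : ∀ j, 0 < (lam j).im)
    (δ : ℝ) (hδ : 0 < δ)
    (hpert : ∀ θ : Fin n → ℝ, (∀ j, 0 ≤ θ j ∧ θ j ≤ δ) → ∀ X : Fin n ⊕ Fin n → ℝ,
      0 ≤ (∑ j, (lam j + θ j) * (sympForm (f j) (toC X) * sympForm (e j) (toC X))).re)
    (h : ℝ) (hh : 0 < h) (z : ℂ) (R : ℝ) (hR : ‖z‖ ≤ R)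
    (d : ℝ) (hd : 0 < d) (hdν : ∀ ν : Fin n → ℕ, d ≤ ‖-(h * rate lam ν) - z‖) :
    ∃ S : Submodule ℂ (SS n), (S.map (SchwartzMap.toLpCLM ℂ ℂ 2
      (volume : Measure (EuclideanSpace ℝ (Fin n)))).toLinearMap).topologicalClosure = ⊤ ∧
      ∀ g ∈ S, ∃ w : SS n, Qop h e f lam w - z • w = g ∧
        ‖w.toLp 2 (volume : Measure (EuclideanSpace ℝ (Fin n)))‖ ≤
        Real.exp (2 * Real.pi / δ * R / h) *
        ((∏ j, (1 - Real.exp (-(2 * (Real.pi / δ) * (lam j).im)))⁻¹) / d + 2 * Real.pi / δ / h) *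
        ‖g.toLp 2 (volume : Measure (EuclideanSpace ℝ (Fin n)))‖ := by
  obtain ⟨ψ, hA, hB, hne, m, hm, hp⟩ := hN.exists_psi h hh
  refine ⟨_, hN.dense h ψ hA hB hne m hm hp, fun g hg => ?_⟩
  obtain ⟨M, c, rfl⟩ := span_fin ψ g hg
  have hlin : ∀ a : (Fin n → Fin M) → ℂ,
      (∑ ν, a ν • ψ (fun j => ν j)).toLp 2 (volume : Measure (EuclideanSpace ℝ (Fin n)))
      = ∑ ν, a ν • (ψ (fun j => ν j)).toLp 2 (volume : Measure (EuclideanSpace ℝ (Fin n))) := by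
    intro a
    have h1 := map_sum (SchwartzMap.toLpCLM ℂ ℂ 2 (volume : Measure (EuclideanSpace ℝ (Fin n))))
      (fun ν => a ν • ψ (fun j => ν j)) Finset.univ
    simp only [map_smul] at h1
    exact h1
  have hQ : ∀ (s : Fin n → ℂ) (a : (Fin n → Fin M) → ℂ), Qop h e f s (∑ ν, a ν • ψ (fun j => ν j))
      = ∑ ν, (-(h * rate s (fun j => ν j)) * a ν) • ψ (fun j => ν j) := by
    intro s a
    rw [map_sum]
    refine Finset.sum_congr rfl fun ν _ => ?_
    rw [map_smul, hN.eigen h ψ hA hB, smul_smul, mul_comm]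
  refine ⟨∑ ν, (c ν / (-(h * rate lam (fun j => ν j)) - z)) • ψ (fun j => ν j), ?_, ?_⟩
  · rw [hQ, Finset.smul_sum, ← Finset.sum_sub_distrib]
    refine Finset.sum_congr rfl fun ν _ => ?_
    rw [smul_smul, ← sub_smul]
    congr 1
    have : -(h * rate lam (fun j => ν j)) - z ≠ 0 := by
      intro h0
      have := hdν (fun j => ν j)
      rw [h0, norm_zero] at this
      linarith
    field_simp
  · rw [hlin, hlin]
    refine main_abstract lam hlam δ hδ _ ?_ c h hh z R hR d hd hdν
    intro θ hθ a
    have h1 := accretive (e := e) (f := f) (fun j => lam j + θ j) h (hpert θ hθ) (∑ ν, a ν • ψ (fun j => ν j))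
    rw [hQ, hlin, hlin] at h1
    have h2 : ∑ ν : Fin n → Fin M, (-(h * rate (fun j => lam j + θ j) (fun j => ν j)) * a ν) •
        (ψ (fun j => ν j)).toLp 2 (volume : Measure (EuclideanSpace ℝ (Fin n)))
        = (-(h : ℂ)) • ∑ ν : Fin n → Fin M, (rate (fun j => lam j + θ j) (fun j => ν j) * a ν) •
        (ψ (fun j => ν j)).toLp 2 (volume : Measure (EuclideanSpace ℝ (Fin n))) := by
      rw [Finset.smul_sum]
      refine Finset.sum_congr rfl fun ν _ => ?_
      rw [smul_smul]; congr 1; ring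
    rw [h2, inner_smul_right, ← Complex.ofReal_neg, Complex.re_ofReal_mul] at h1
    nlinarith

lemma final_const (P T D R h d : ℝ) (hP : 0 ≤ P) (hT : 0 ≤ T) (hR : 0 ≤ R) (hh : 0 < h)
    (hd : 0 < d) (hdD : d ≤ D) :
    d * (Real.exp (T * R / h) * (P / d + T / h)) ≤
      (P + D * T + T * R + 1) * Real.exp ((P + D * T + T * R + 1) / h) := by
  have hD : 0 < D := hd.trans_le hdD
  have h1 : d * (Real.exp (T * R / h) * (P / d + T / h)) = Real.exp (T * R / h) * (P + d * T * (1 / h)) := by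
    field_simp
  have h2 : 1 / h ≤ Real.exp (1 / h) := by linarith [Real.add_one_le_exp (1 / h)]
  have h3 : 1 ≤ Real.exp (1 / h) := Real.one_le_exp (by positivity)
  have h4 : P + d * T * (1 / h) ≤ (P + D * T) * Real.exp (1 / h) := by
    have : d * T * (1 / h) ≤ D * T * Real.exp (1 / h) := by gcongr
    nlinarith
  rw [h1]
  calc Real.exp (T * R / h) * (P + d * T * (1 / h))
      ≤ Real.exp (T * R / h) * ((P + D * T) * Real.exp (1 / h)) := by gcongr
    _ = (P + D * T) * Real.exp ((T * R + 1) / h) := by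
        rw [add_div, Real.exp_add]; ring
    _ ≤ _ := by
        have hTR : 0 ≤ T * R := by positivity
        have hDT : 0 ≤ D * T := by positivity
        have i1 : P + D * T ≤ P + D * T + T * R + 1 := by linarith
        have i2 : T * R + 1 ≤ P + D * T + T * R + 1 := by linarith
        exact mul_le_mul i1 (Real.exp_le_exp.2 (div_le_div_of_nonneg_right i2 hh.le))
          (Real.exp_pos _).le (by linarith)

end Final

theorem statement_2 {n : ℕ} (hn : 1 ≤ n)
    (A B C : Matrix (Fin n) (Fin n) ℂ) (hAs : A.IsSymm) (hCs : C.IsSymm)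
    (hpos : ∀ x ξ : Fin n → ℝ, ¬(x = 0 ∧ ξ = 0) →
      0 < (qForm A B C (fun j => (x j : ℂ)) (fun j => (ξ j : ℂ))).re)
    (F : Matrix (Fin n ⊕ Fin n) (Fin n ⊕ Fin n) ℂ)
    (hF : ∀ X Y, sympForm X (F.mulVec Y) = qPolar A B C X Y)
    (hdiag : ∃ P : Matrix (Fin n ⊕ Fin n) (Fin n ⊕ Fin n) ℂ, IsUnit P ∧
      ∃ d : (Fin n ⊕ Fin n) → ℂ, F = P * Matrix.diagonal d * P⁻¹)
    (lam : Fin n → ℂ) (hlam : ∀ j, 0 < (lam j).im)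
    (hchar : F.charpoly =
      ∏ j, ((Polynomial.X - Polynomial.C (lam j)) * (Polynomial.X + Polynomial.C (lam j))))
    (Ω : Set ℂ) (hΩ : Bornology.IsBounded Ω) :
    ∃ h₀ > 0, ∃ A' > 0, ∀ h : ℝ, 0 < h → h ≤ h₀ →
      ∀ z ∈ Ω, z ∉ specSet lam h →
      ∀ u : SchwartzMap (EuclideanSpace ℝ (Fin n)) ℂ,
        Metric.infDist z (specSet lam h) * l2Norm (fun x => u x) ≤
          A' * Real.exp (A' / h) *
            l2Norm (fun x => weylQuant A B C h (fun y => u y) x - z * u x) := by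
  obtain ⟨e, f, hN, hq⟩ := exists_NF A B C hAs hCs hpos F hF hdiag lam hlam hchar
  have hNt := hN.transpose
  obtain ⟨δ, hδ, hpert⟩ := hNt.perturb
  obtain ⟨R, hR0, hR⟩ := hΩ.exists_pos_norm_le
  set P := ∏ j, (1 - Real.exp (-(2 * (Real.pi / δ) * (lam j).im)))⁻¹ with hP
  have hP0 : 0 ≤ P := by
    refine Finset.prod_nonneg fun j _ => inv_nonneg.2 (sub_nonneg.2 (Real.exp_le_one_iff.2 ?_))
    have := hlam j
    have := Real.pi_pos
    rw [neg_nonpos]; positivity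
  set T := 2 * Real.pi / δ with hT
  have hT0 : 0 ≤ T := by have := Real.pi_pos; positivity
  set D := R + ‖∑ j, lam j‖ with hD
  have hD0 : 0 ≤ D := by positivity
  refine ⟨1, one_pos, P + D * T + T * R + 1, by positivity, ?_⟩
  intro h hh hh1 z hz _ u
  set d := Metric.infDist z (specSet lam h) with hd
  set Aq := P + D * T + T * R + 1 with hAq
  have hspec : ∀ ν : Fin n → ℕ, -(h * rate lam ν) ∈ specSet lam h := by
    intro ν
    refine ⟨ν, ?_⟩
    rw [rate, Complex.div_I]; ring
  rcases (Metric.infDist_nonneg : 0 ≤ Metric.infDist z (specSet lam h)).eq_or_lt with h0 | hdpos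
  · rw [hd, ← h0, zero_mul]
    exact mul_nonneg (by positivity) (Real.sqrt_nonneg _)
  have hdν : ∀ ν : Fin n → ℕ, d ≤ ‖-(h * rate lam ν) - z‖ := by
    intro ν
    have := Metric.infDist_le_dist_of_mem (x := z) (hspec ν)
    rwa [dist_comm, dist_eq_norm] at this
  have hdD : d ≤ D := by
    refine (hdν 0).trans ((norm_sub_le _ _).trans ?_)
    have h1 : ‖-(h * rate lam 0)‖ ≤ ‖∑ j, lam j‖ := by
      rw [norm_neg, norm_mul, rate, norm_mul, Complex.norm_I, Complex.norm_real, Real.norm_of_nonneg hh.le]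
      simp only [Pi.zero_apply, Nat.cast_zero, mul_zero, zero_add, mul_one, one_mul]
      exact mul_le_of_le_one_left (norm_nonneg _) hh1
    linarith [hR z hz]
  obtain ⟨S, hS, hres⟩ := hNt.resolvent hlam δ hδ hpert h hh z R (hR z hz) d hdpos hdν
  set W : SS n := Qop h e f lam u - z • u with hW
  have hWn : l2Norm (fun x => weylQuant A B C h (fun y => u y) x - z * u x) = l2Norm (fun x => W x) := by
    congr 1
    funext x
    rw [weyl_eq A B C hAs hq h u x]
    simp [hW]
  set K := Real.exp (T * R / h) * (P / d + T / h) with hK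
  have hK0 : 0 ≤ K := by positivity
  have hmain : l2Norm (fun x => u x) ≤ K * l2Norm (fun x => W x) := by
    rw [← norm_cS u]
    refine norm_le_of_dense _ hS _ _ (mul_nonneg hK0 (Real.sqrt_nonneg _)) ?_
    rintro _ ⟨g, hg, rfl⟩
    obtain ⟨w, hw, hwb⟩ := hres g hg
    have h1 : ∫ x, u x * g x = ∫ x, W x * w x := by
      rw [← hw]
      have e1 : ∀ x, u x * (Qop h (fun j => tau (f j)) (fun j => tau (e j)) lam w - z • w) x
          = u x * Qop h (fun j => tau (f j)) (fun j => tau (e j)) lam w x - z * (u x * w x) := by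
        intro x; simp; ring
      have e2 : ∀ x, W x * w x = Qop h e f lam u x * w x - z * (u x * w x) := by
        intro x; simp [hW]; ring
      simp only [e1, e2]
      rw [integral_sub (integrable_mul _ _) ((integrable_mul u w).const_mul z),
        integral_sub (integrable_mul _ _) ((integrable_mul u w).const_mul z), transp_Q]
    have h2 : ‖inner ℂ ((cS u).toLp 2 (volume : Measure (EuclideanSpace ℝ (Fin n)))) (g.toLp 2 volume)‖
        ≤ l2Norm (fun x => W x) * (K * ‖g.toLp 2 (volume : Measure (EuclideanSpace ℝ (Fin n)))‖) := by
      rw [inner_cS, h1, ← inner_cS, ← norm_cS W]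
      refine (norm_inner_le_norm _ _).trans ?_
      gcongr
    calc _ ≤ _ := h2
      _ = _ := by rw [← mul_assoc, mul_comm (l2Norm _) K]; rfl
  rw [hWn]
  calc d * l2Norm (fun x => u x) ≤ d * (K * l2Norm (fun x => W x)) := by gcongr
    _ = (d * K) * l2Norm (fun x => W x) := by ring
    _ ≤ _ := by
      refine mul_le_mul_of_nonneg_right ?_ (Real.sqrt_nonneg _)
      exact final_const P T D R h d hP0 hT0 hR0.le hh hdpos hdD
end

section
/- Let u be an entire (everywhere holomorphic) function on ℂⁿ and let N ≥ 1 be an integer such that ∂^α u(0) = 0 for every multi-index α with |α| < N. Let 0 < C₀ < C₁ < ∞. Then sup_{|x| ≤ C₀} |u(x)| ≤ N·(C₁/(C₁−C₀))·(C₀/C₁)^N · sup_{|x| ≤ C₁} |u(x)|. -/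
/-- The complex partial derivative `∂u/∂x_j` of a function on ℂⁿ. -/
noncomputable def pDeriv {n : ℕ} (j : Fin n)
    (u : EuclideanSpace ℂ (Fin n) → ℂ) : EuclideanSpace ℂ (Fin n) → ℂ :=
  fun x => fderiv ℂ u x (EuclideanSpace.single j 1)

/-- The iterated complex partial derivative `∂^α u` for a multi-index `α ∈ ℕⁿ`. -/
noncomputable def mDeriv {n : ℕ} (α : Fin n → ℕ)
    (u : EuclideanSpace ℂ (Fin n) → ℂ) : EuclideanSpace ℂ (Fin n) → ℂ :=
  ((List.finRange n).foldr (fun j f => (pDeriv j)^[α j] ∘ f) id) u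

open Metric Set Filter Topology MeasureTheory

lemma pDeriv_eq_deriv {n : ℕ} (u : EuclideanSpace ℂ (Fin n) → ℂ) (hu : Differentiable ℂ u)
    (x v : EuclideanSpace ℂ (Fin n)) (t : ℂ) :
    HasDerivAt (fun z : ℂ => u (x + z • v)) (fderiv ℂ u (x + t • v) v) t := by
  have h1 : HasDerivAt (fun z : ℂ => x + z • v) v t := by
    simpa using ((hasDerivAt_id t).smul_const v).const_add x
  exact (hu (x + t • v)).hasFDerivAt.comp_hasDerivAt t h1

/-- Cauchy estimate for the full derivative on balls. -/
lemma fderiv_bound {n : ℕ} (u : EuclideanSpace ℂ (Fin n) → ℂ) (hu : Differentiable ℂ u)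
    (R : ℝ) : ∃ C : ℝ, ∀ y : EuclideanSpace ℂ (Fin n), ‖y‖ ≤ R → ‖fderiv ℂ u y‖ ≤ C := by
  obtain ⟨C, hC⟩ := (isCompact_closedBall (0 : EuclideanSpace ℂ (Fin n)) (R + 1)).exists_bound_of_continuousOn
    hu.continuous.continuousOn
  refine ⟨max C 0, fun y hy => ?_⟩
  refine ContinuousLinearMap.opNorm_le_of_unit_norm (𝕜 := ℂ) (le_max_right _ _) fun v hv => ?_
  have hd := pDeriv_eq_deriv u hu y v 0
  have h2 := Complex.norm_deriv_le_of_forall_mem_sphere_norm_le (c := 0) (R := 1) (C := C)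
    (f := fun z : ℂ => u (y + z • v)) one_pos
    (Differentiable.diffContOnCl (by fun_prop)) (by
      intro z hz
      apply hC
      rw [mem_closedBall_zero_iff]
      refine (norm_add_le _ _).trans ?_
      have : ‖z‖ = 1 := by simpa using hz
      rw [norm_smul, this, hv]; linarith)
  rw [hd.deriv] at h2
  simp only [zero_smul, add_zero, div_one] at h2
  exact h2.trans (le_max_left _ _)

lemma differentiable_dir {n : ℕ} (u : EuclideanSpace ℂ (Fin n) → ℂ) (hu : Differentiable ℂ u)
    (v : EuclideanSpace ℂ (Fin n)) : Differentiable ℂ (fun x => fderiv ℂ u x v) := by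
  set c : ℝ → ℂ := fun θ => deriv (circleMap 0 1) θ * ((circleMap 0 1 θ - 0) ^ 2)⁻¹ with hc
  have hcc : Continuous c := by
    have : ∀ θ, circleMap 0 1 θ ≠ 0 := fun θ => circleMap_ne_center one_ne_zero
    simp only [hc, deriv_circleMap, sub_zero]
    refine Continuous.mul (by fun_prop) (Continuous.inv₀ (by fun_prop) ?_)
    intro θ; exact pow_ne_zero _ (this θ)
  have hcn : ∀ θ, ‖c θ‖ = 1 := by intro θ; simp [hc]
  have key : (fun x => fderiv ℂ u x v) = fun x => (2 * Real.pi * Complex.I : ℂ)⁻¹ •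
      ∫ θ in (0:ℝ)..2 * Real.pi, c θ • u (x + circleMap 0 1 θ • v) := by
    funext x
    have h := Complex.two_pi_I_inv_smul_circleIntegral_sub_sq_inv_smul_of_differentiable
      (U := univ) isOpen_univ (c := 0) (w₀ := 0) (R := 1) (f := fun z : ℂ => u (x + z • v))
      (subset_univ _) (by fun_prop) (by simp)
    rw [(pDeriv_eq_deriv u hu x v 0).deriv] at h
    simp only [zero_smul, add_zero] at h
    rw [← h]
    simp only [circleIntegral, hc, smul_smul]
  rw [key]
  intro x₀
  apply DifferentiableAt.fun_const_smul
  obtain ⟨C, hC⟩ := fderiv_bound u hu (‖x₀‖ + 1 + ‖v‖)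
  have hmain := intervalIntegral.hasFDerivAt_integral_of_dominated_of_fderiv_le
    (𝕜 := ℂ) (μ := volume) (a := 0) (b := 2 * Real.pi) (bound := fun _ => C) (s := ball x₀ 1)
    (F := fun x θ => c θ • u (x + circleMap 0 1 θ • v))
    (F' := fun x θ => c θ • fderiv ℂ u (x + circleMap 0 1 θ • v)) (x₀ := x₀)
    (ball_mem_nhds _ one_pos)
    (Eventually.of_forall fun x => by
      refine Continuous.aestronglyMeasurable ?_
      exact hcc.smul (hu.continuous.comp (by fun_prop)))
    (by
      refine Continuous.intervalIntegrable ?_ _ _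
      exact hcc.smul (hu.continuous.comp (by fun_prop)))
    (by
      refine AEStronglyMeasurable.smul hcc.aestronglyMeasurable ?_
      refine Measurable.aestronglyMeasurable ?_
      refine (measurable_fderiv ℂ u).comp ?_
      exact Continuous.measurable (by fun_prop))
    (by
      refine Eventually.of_forall fun θ _ x hx => ?_
      rw [norm_smul, hcn, one_mul]
      apply hC
      refine (norm_add_le _ _).trans ?_
      have h1 : ‖x‖ ≤ ‖x₀‖ + 1 := by
        have := norm_le_norm_add_norm_sub' x x₀
        rw [mem_ball_iff_norm] at hx
        linarith
      have h2 : ‖circleMap 0 1 θ • v‖ = ‖v‖ := by simp [norm_smul]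
      linarith)
    (by simp)
    (by
      refine Eventually.of_forall fun θ _ x hx => ?_
      have := (hu (x + circleMap 0 1 θ • v)).hasFDerivAt.comp x
        ((hasFDerivAt_id x).add_const (circleMap 0 1 θ • v))
      rw [ContinuousLinearMap.comp_id] at this
      exact this.const_smul (c θ))
  exact hmain.differentiableAt

lemma pDeriv_diff {n : ℕ} (j : Fin n) {u : EuclideanSpace ℂ (Fin n) → ℂ}
    (hu : Differentiable ℂ u) : Differentiable ℂ (pDeriv j u) :=
  differentiable_dir u hu _

lemma differentiable_fderiv {n : ℕ} {u : EuclideanSpace ℂ (Fin n) → ℂ}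
    (hu : Differentiable ℂ u) : Differentiable ℂ (fderiv ℂ u) := by
  have : ∀ y, ContDiffAt ℂ 1 (fderiv ℂ u) y := by
    intro y
    refine ContDiff.contDiffAt (contDiff_clm_apply_iff.2 fun v => ?_)
    rw [contDiff_one_iff_fderiv]
    refine ⟨differentiable_dir u hu v, ?_⟩
    exact continuous_clm_apply.2 fun w =>
      (differentiable_dir _ (differentiable_dir u hu v) w).continuous
  exact fun y => (this y).differentiableAt one_ne_zero

lemma pDeriv_comm {n : ℕ} (i j : Fin n) {u : EuclideanSpace ℂ (Fin n) → ℂ}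
    (hu : Differentiable ℂ u) : pDeriv i (pDeriv j u) = pDeriv j (pDeriv i u) := by
  have h : ∀ (i j : Fin n) x, pDeriv i (pDeriv j u) x =
      fderiv ℂ (fderiv ℂ u) x (EuclideanSpace.single i 1) (EuclideanSpace.single j 1) := by
    intro i j x
    have h1 := ((differentiable_fderiv hu x).hasFDerivAt.clm_apply
      (hasFDerivAt_const (EuclideanSpace.single j (1:ℂ)) x)).fderiv
    show fderiv ℂ (fun y => fderiv ℂ u y (EuclideanSpace.single j 1)) x _ = _
    rw [h1]; simp
  funext x
  rw [h, h]
  exact second_derivative_symmetric (fun y => (hu y).hasFDerivAt)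
    (differentiable_fderiv hu x).hasFDerivAt _ _

lemma iter_diff {n : ℕ} (i : Fin n) (m : ℕ) {u : EuclideanSpace ℂ (Fin n) → ℂ}
    (hu : Differentiable ℂ u) : Differentiable ℂ ((pDeriv i)^[m] u) := by
  induction m with
  | zero => exact hu
  | succ m ih => rw [Function.iterate_succ_apply']; exact pDeriv_diff i ih

lemma iter_comm {n : ℕ} (i j : Fin n) (m : ℕ) {u : EuclideanSpace ℂ (Fin n) → ℂ}
    (hu : Differentiable ℂ u) :
    (pDeriv i)^[m] (pDeriv j u) = pDeriv j ((pDeriv i)^[m] u) := by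
  induction m with
  | zero => rfl
  | succ m ih =>
    rw [Function.iterate_succ_apply', Function.iterate_succ_apply', ih,
      pDeriv_comm _ _ (iter_diff i m hu)]

lemma fold_diff {n : ℕ} (α : Fin n → ℕ) (l : List (Fin n)) {u : EuclideanSpace ℂ (Fin n) → ℂ}
    (hu : Differentiable ℂ u) :
    Differentiable ℂ ((l.foldr (fun j f => (pDeriv j)^[α j] ∘ f) id) u) := by
  induction l with
  | nil => exact hu
  | cons i l ih => exact iter_diff i _ ih

lemma fold_comm {n : ℕ} (α : Fin n → ℕ) (l : List (Fin n)) (j : Fin n)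
    {u : EuclideanSpace ℂ (Fin n) → ℂ} (hu : Differentiable ℂ u) :
    (l.foldr (fun j f => (pDeriv j)^[α j] ∘ f) id) (pDeriv j u) =
    pDeriv j ((l.foldr (fun j f => (pDeriv j)^[α j] ∘ f) id) u) := by
  induction l with
  | nil => rfl
  | cons i l ih =>
    simp only [List.foldr_cons, Function.comp_apply]
    rw [ih, iter_comm _ _ _ (fold_diff α l hu)]

lemma fold_notMem {n : ℕ} (α : Fin n → ℕ) (l : List (Fin n)) (j : Fin n) (hj : j ∉ l)
    (u : EuclideanSpace ℂ (Fin n) → ℂ) :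
    (l.foldr (fun i f => (pDeriv i)^[(α + Pi.single j 1 : Fin n → ℕ) i] ∘ f) id) u =
    (l.foldr (fun i f => (pDeriv i)^[α i] ∘ f) id) u := by
  induction l with
  | nil => rfl
  | cons i l ih =>
    simp only [List.mem_cons, not_or] at hj
    simp only [List.foldr_cons, Function.comp_apply]
    rw [ih hj.2]
    simp [Pi.single_apply, Ne.symm hj.1]

lemma fold_mem {n : ℕ} (α : Fin n → ℕ) (l : List (Fin n)) (j : Fin n) (hj : j ∈ l)
    (hl : l.Nodup) {u : EuclideanSpace ℂ (Fin n) → ℂ} (hu : Differentiable ℂ u) :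
    (l.foldr (fun i f => (pDeriv i)^[(α + Pi.single j 1 : Fin n → ℕ) i] ∘ f) id) u =
    (l.foldr (fun i f => (pDeriv i)^[α i] ∘ f) id) (pDeriv j u) := by
  induction l with
  | nil => simp at hj
  | cons i l ih =>
    rw [List.nodup_cons] at hl
    simp only [List.foldr_cons, Function.comp_apply]
    by_cases hij : j = i
    · subst hij
      rw [fold_notMem α l j hl.1, fold_comm α l j hu]
      simp [Function.iterate_succ_apply]
    · rw [ih ((List.mem_cons.1 hj).resolve_left hij) hl.2]
      simp [Pi.single_apply, Ne.symm hij]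

lemma mDeriv_pDeriv {n : ℕ} (α : Fin n → ℕ) (j : Fin n)
    {u : EuclideanSpace ℂ (Fin n) → ℂ} (hu : Differentiable ℂ u) :
    mDeriv α (pDeriv j u) = mDeriv (α + Pi.single j 1) u :=
  (fold_mem α _ j (List.mem_finRange j) (List.nodup_finRange n) hu).symm

lemma fold_zero {n : ℕ} (l : List (Fin n)) (u : EuclideanSpace ℂ (Fin n) → ℂ) :
    (l.foldr (fun i f => (pDeriv i)^[(0 : Fin n → ℕ) i] ∘ f) id) u = u := by
  induction l with
  | nil => rfl
  | cons i l ih =>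
    simp only [List.foldr_cons, Function.comp_apply]
    rw [ih]; rfl

lemma iteratedDeriv_line {n : ℕ} (x : EuclideanSpace ℂ (Fin n)) (k : ℕ) :
    ∀ (u : EuclideanSpace ℂ (Fin n) → ℂ), Differentiable ℂ u →
    (∀ α : Fin n → ℕ, (∑ j, α j) = k → mDeriv α u 0 = 0) →
    iteratedDeriv k (fun z : ℂ => u (z • x)) 0 = 0 := by
  induction k with
  | zero =>
    intro u hu h
    have := h 0 (by simp)
    rw [mDeriv, fold_zero] at this
    simpa using this
  | succ k ih =>
    intro u hu h
    have hd : deriv (fun z : ℂ => u (z • x)) =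
        fun z => ∑ j, x j * pDeriv j u (z • x) := by
      funext z
      have h1 := (pDeriv_eq_deriv u hu 0 x z).deriv
      simp only [zero_add] at h1
      rw [h1]
      have hx : x = ∑ j, x j • EuclideanSpace.single j (1:ℂ) := by
        ext i
        simp [Pi.single_apply]
      conv_lhs => rw [hx]
      rw [map_sum]
      refine Finset.sum_congr rfl fun j _ => ?_
      rw [map_smul, ← hx]; rfl
    rw [iteratedDeriv_succ', hd]
    have hdj : ∀ j, Differentiable ℂ (fun z : ℂ => pDeriv j u (z • x)) := fun j =>
      (pDeriv_diff j hu).comp (by fun_prop)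
    rw [iteratedDeriv_fun_sum (fun j _ =>
      (((hdj j).const_mul (x j)).contDiff).contDiffAt)]
    refine Finset.sum_eq_zero fun j _ => ?_
    rw [iteratedDeriv_const_mul_field, ih _ (pDeriv_diff j hu), mul_zero]
    intro α hα
    rw [mDeriv_pDeriv α j hu]
    apply h
    simp [Finset.sum_add_distrib, hα]

/-- If `u` is entire on ℂⁿ with `∂^α u(0) = 0` for all `|α| < N` (`N ≥ 1`), and
`0 < C₀ < C₁`, then `sup_{|x|≤C₀} |u| ≤ N (C₁/(C₁−C₀)) (C₀/C₁)^N sup_{|x|≤C₁} |u|`. -/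
theorem statement_3 {n : ℕ} (u : EuclideanSpace ℂ (Fin n) → ℂ)
    (hu : Differentiable ℂ u) (N : ℕ) (hN : 1 ≤ N)
    (hvan : ∀ α : Fin n → ℕ, (∑ j, α j) < N → mDeriv α u 0 = 0)
    (C₀ C₁ : ℝ) (h0 : 0 < C₀) (h01 : C₀ < C₁) :
    ∀ x : EuclideanSpace ℂ (Fin n), ‖x‖ ≤ C₀ →
      ‖u x‖ ≤ ((N : ℝ) * (C₁ / (C₁ - C₀)) * (C₀ / C₁) ^ N) *
        ⨆ y : Metric.closedBall (0 : EuclideanSpace ℂ (Fin n)) C₁,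
          ‖u (y : EuclideanSpace ℂ (Fin n))‖ := by
  intro x hx
  set M := ⨆ y : Metric.closedBall (0 : EuclideanSpace ℂ (Fin n)) C₁,
          ‖u (y : EuclideanSpace ℂ (Fin n))‖ with hM
  have hC1 : 0 < C₁ := h0.trans h01
  have hle : ∀ y : EuclideanSpace ℂ (Fin n), ‖y‖ ≤ C₁ → ‖u y‖ ≤ M := by
    intro y hy
    obtain ⟨C, hC⟩ := (isCompact_closedBall (0 : EuclideanSpace ℂ (Fin n)) C₁).exists_bound_of_continuousOn
      hu.continuous.continuousOn
    exact le_ciSup (f := fun y : Metric.closedBall (0 : EuclideanSpace ℂ (Fin n)) C₁ =>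
      ‖u (y : EuclideanSpace ℂ (Fin n))‖) ⟨C, by rintro _ ⟨z, rfl⟩; exact hC z z.2⟩
      ⟨y, by simpa using hy⟩
  have hM0 : 0 ≤ M := (norm_nonneg _).trans (hle 0 (by simpa using hC1.le))
  have hgd : Differentiable ℂ (fun z : ℂ => u (z • x)) := hu.comp (by fun_prop)
  have hit : ∀ k < N, iteratedDeriv k (fun z : ℂ => u (z • x)) 0 = 0 := fun k hk =>
    iteratedDeriv_line x k u hu fun α hα => hvan α (hα ▸ hk)
  have hu0 : u 0 = 0 := by simpa using hit 0 hN
  obtain ⟨m, rfl⟩ : ∃ m, N = m + 1 := ⟨N - 1, by omega⟩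
  have hord := (natCast_le_analyticOrderAt_iff_iteratedDeriv_eq_zero (hgd.analyticAt 0)).2 hit
  obtain ⟨G, hG, hGe⟩ := (natCast_le_analyticOrderAt (hgd.analyticAt 0)).1 hord
  have hlit : (fun z : ℂ => u (z • x) - u ((0:ℂ) • x)) =o[𝓝 0] (fun w : ℂ => ‖w - 0‖ ^ m) := by
    have h1 : (fun z : ℂ => u (z • x) - u ((0:ℂ) • x)) =ᶠ[𝓝 0] fun z => z ^ m * (z * G z) := by
      filter_upwards [hGe] with z hz
      rw [hz]; simp [hu0, pow_succ, mul_assoc]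
    refine h1.trans_isLittleO ?_
    have h2 : Tendsto (fun z => z * G z) (𝓝 0) (𝓝 0) := by
      have : Tendsto (fun z => z * G z) (𝓝 0) (𝓝 (0 * G 0)) :=
        (continuousAt_id.mul hG.continuousAt).tendsto
      simpa using this
    have h3 := (Asymptotics.isBigO_refl (fun z : ℂ => z ^ m) (𝓝 0)).mul_isLittleO
      ((Asymptotics.isLittleO_one_iff ℂ).2 h2)
    simpa using h3.norm_right
  have hsch := Complex.dist_le_mul_div_pow_of_mapsTo_ball_of_isLittleO
    (f := fun z : ℂ => u (z • x)) (c := 0) (z := 1) (R₁ := C₁ / C₀) (R₂ := M) (n := m)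
    hgd.differentiableOn (by
      intro z hz
      simp only [zero_smul, hu0, mem_closedBall_zero_iff]
      apply hle
      rw [mem_ball_zero_iff, lt_div_iff₀ h0] at hz
      rw [norm_smul]
      exact (mul_le_mul_of_nonneg_left hx (norm_nonneg _)).trans hz.le) hlit
      (by rw [mem_ball_zero_iff, norm_one, lt_div_iff₀ h0]; linarith)
  simp only [one_smul, zero_smul, hu0, dist_zero_right, norm_one, one_div_div] at hsch
  refine hsch.trans ?_
  rw [mul_comm]
  refine mul_le_mul_of_nonneg_right ?_ hM0
  refine le_mul_of_one_le_left (by positivity) ?_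
  have hA : (1:ℝ) ≤ ((m + 1 : ℕ) : ℝ) := by exact_mod_cast hN
  have hB : 1 ≤ C₁ / (C₁ - C₀) := by
    rw [le_div_iff₀ (by linarith)]; linarith
  exact one_le_mul_of_one_le_of_one_le hA hB
end

section
/- For all M₀ > 0, C > 0, and L ≥ 1, there exist A > 0 and h₀ > 0 such that for all h ∈ (0, h₀], all integers N ≥ 1 with Nh ≤ M₀, all z ∈ ℂ with dist(z, { μ_α : α ∈ ℕⁿ }) ≥ h^L/C, and every polynomial u on ℂⁿ of degree < N, one has ‖u‖_{H_Φ} ≤ A exp(A h^{-1} log(1/h)) ‖(z − Q_h)u‖_{H_Φ}. -/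
open MeasureTheory

/-- The squared Euclidean norm `|x|² = Σ |x_j|²` on ℂⁿ. -/
noncomputable def eNormSq {n : ℕ} (x : Fin n → ℂ) : ℝ := ∑ j, Complex.normSq (x j)

/-- The weighted norm `‖u‖_{H_Φ}` with `Φ(x) = |x|²/2`:
`‖u‖²_{H_Φ} = ∫_{ℂⁿ} |u(x)|² e^{−|x|²/h} L(dx)`. -/
noncomputable def hPhiNorm {n : ℕ} (h : ℝ) (f : (Fin n → ℂ) → ℂ) : ℝ :=
  Real.sqrt (∫ x : Fin n → ℂ, ‖f x‖ ^ 2 * Real.exp (-eNormSq x / h))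

/-- Evaluation of a polynomial on ℂⁿ as a function. -/
noncomputable def evalPoly {n : ℕ} (u : MvPolynomial (Fin n) ℂ)
    (x : Fin n → ℂ) : ℂ :=
  MvPolynomial.eval x u

/-- The operator
`Q_h u = (h/i)[Σ_j 2λ_j x_j ∂u/∂x_j + Σ_{j+1<n} γ_j x_{j+1} ∂u/∂x_j + (Σ_j λ_j) u]`
acting on polynomials on ℂⁿ. -/
noncomputable def qOp (n : ℕ) (lam γ : Fin n → ℂ) (h : ℝ)
    (u : MvPolynomial (Fin n) ℂ) : MvPolynomial (Fin n) ℂ :=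
  MvPolynomial.C ((h : ℂ) / Complex.I) *
    ((∑ j : Fin n, MvPolynomial.C (2 * lam j) * MvPolynomial.X j * MvPolynomial.pderiv j u)
      + (∑ j : Fin n, if hj : (j : ℕ) + 1 < n then
            MvPolynomial.C (γ j) * MvPolynomial.X (⟨(j : ℕ) + 1, hj⟩ : Fin n)
              * MvPolynomial.pderiv j u
          else 0)
      + MvPolynomial.C (∑ j, lam j) * u)

/-- The set of eigenvalues `μ_α = (h/i) Σ_j λ_j(2α_j+1)`, `α ∈ ℕⁿ`, of `Q_h`. -/
noncomputable def specQ (n : ℕ) (lam : Fin n → ℂ) (h : ℝ) : Set ℂ :=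
  {w | ∃ α : Fin n → ℕ, w = (h : ℂ) / Complex.I * ∑ j, lam j * (2 * (α j : ℂ) + 1)}


/-- one-dimensional weight -/
noncomputable def wt1 (h : ℝ) (a : ℕ) : ℝ := Real.pi * h ^ (a + 1) * (a.factorial : ℝ)

/-- squared norm of a monomial -/
noncomputable def wtN {n : ℕ} (h : ℝ) (α : Fin n →₀ ℕ) : ℝ := ∏ i, wt1 h (α i)

noncomputable def ker1 (h : ℝ) (a b : ℕ) (z : ℂ) : ℂ :=
  z ^ a * (starRingEnd ℂ z) ^ b * ((Real.exp (-Complex.normSq z / h) : ℝ) : ℂ)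

lemma wt1_pos {h : ℝ} (hh : 0 < h) (a : ℕ) : 0 < wt1 h a := by
  unfold wt1; positivity

lemma moment_real {h : ℝ} (hh : 0 < h) (k : ℕ) :
    Integrable (fun z : ℂ => ‖z‖ ^ k * Real.exp (-Complex.normSq z / h)) := by
  apply Integrable.of_integral_ne_zero
  have := Complex.integral_rpow_mul_exp_neg_mul_rpow (p := 2) (q := k) (b := 1 / h)
    (by norm_num) (by have : (0:ℝ) ≤ k := by positivity
                      linarith) (by positivity)
  have e : (fun z : ℂ => ‖z‖ ^ k * Real.exp (-Complex.normSq z / h)) =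
     (fun z : ℂ => ‖z‖ ^ (k:ℝ) * Real.exp (-(1/h) * ‖z‖ ^ (2:ℝ))) := by
    funext z
    rw [Real.rpow_natCast, Complex.normSq_eq_norm_sq]
    norm_cast
    congr 2
    ring
  rw [e, this]
  have : 0 < Real.Gamma (((k:ℝ)+2)/2) := Real.Gamma_pos_of_pos (by positivity)
  positivity

lemma moment_val {h : ℝ} (hh : 0 < h) (a : ℕ) :
    ∫ z : ℂ, ‖z‖ ^ (2*a) * Real.exp (-Complex.normSq z / h) = wt1 h a := by
  have := Complex.integral_rpow_mul_exp_neg_mul_rpow (p := 2) (q := (2*a : ℕ)) (b := 1 / h)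
    (by norm_num) (by have : (0:ℝ) ≤ (2*a : ℕ) := by positivity
                      linarith) (by positivity)
  have e : (fun z : ℂ => ‖z‖ ^ (2*a) * Real.exp (-Complex.normSq z / h)) =
     (fun z : ℂ => ‖z‖ ^ ((2*a : ℕ):ℝ) * Real.exp (-(1/h) * ‖z‖ ^ (2:ℝ))) := by
    funext z
    rw [Real.rpow_natCast, Complex.normSq_eq_norm_sq]
    norm_cast
    congr 2
    ring
  rw [e, this]
  have e1 : (((2*a : ℕ):ℝ) + 2)/2 = a + 1 := by push_cast; ring
  have e2 : -(((2*a : ℕ):ℝ) + 2)/2 = -((a + 1 : ℕ) : ℝ) := by push_cast; ring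
  rw [e1, e2, Real.Gamma_nat_eq_factorial, Real.rpow_neg (by positivity), Real.rpow_natCast]
  unfold wt1
  simp

lemma ker1_norm (h : ℝ) (a b : ℕ) (z : ℂ) :
    ‖ker1 h a b z‖ = ‖z‖ ^ (a+b) * Real.exp (-Complex.normSq z / h) := by
  unfold ker1
  rw [norm_mul, norm_mul, norm_pow, norm_pow, RCLike.norm_conj, Complex.norm_real,
    Real.norm_of_nonneg (Real.exp_pos _).le, pow_add]

lemma ker1_cont (h : ℝ) (a b : ℕ) : Continuous (ker1 h a b) := by
  unfold ker1
  have := Complex.continuous_normSq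
  have := Complex.continuous_conj
  fun_prop

lemma ker1_int {h : ℝ} (hh : 0 < h) (a b : ℕ) : Integrable (ker1 h a b) := by
  refine (moment_real hh (a+b)).mono' (ker1_cont h a b).aestronglyMeasurable ?_
  exact Filter.Eventually.of_forall fun z => (ker1_norm h a b z).le

lemma ker1_diag {h : ℝ} (hh : 0 < h) (a : ℕ) : ∫ z, ker1 h a a z = (wt1 h a : ℂ) := by
  rw [← moment_val hh a, ← integral_complex_ofReal]
  congr 1
  funext z
  unfold ker1
  rw [← mul_pow, Complex.mul_conj, Complex.normSq_eq_norm_sq]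
  push_cast
  ring

lemma ker1_off {h : ℝ} (a b : ℕ) (hab : a ≠ b) : ∫ z, ker1 h a b z = 0 := by
  have hd : ((a:ℝ) - b) ≠ 0 := by
    intro H; apply hab; exact_mod_cast sub_eq_zero.mp H
  set c : Circle := Circle.exp (Real.pi / ((a:ℝ) - b)) with hc
  have hmp := (rotation c).measurePreserving
  have h1 : ∫ z, ker1 h a b (rotation c z) = ∫ z, ker1 h a b z :=
    hmp.integral_comp (rotation c).toHomeomorph.measurableEmbedding _
  have hfac : (c:ℂ)^a * (starRingEnd ℂ (c:ℂ))^b = -1 := by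
    rw [← Circle.coe_inv_eq_conj, hc, ← Circle.exp_neg, Circle.coe_exp, Circle.coe_exp,
      ← Complex.exp_nat_mul, ← Complex.exp_nat_mul, ← Complex.exp_add, ← Complex.exp_pi_mul_I]
    congr 1
    have hd' : ((a:ℂ) - b) ≠ 0 := by exact_mod_cast hd
    push_cast
    field_simp
    ring
  have h2 : ∀ z, ker1 h a b (rotation c z) = - ker1 h a b z := by
    intro z
    have : Complex.normSq ((c:ℂ) * z) = Complex.normSq z := by
      rw [Complex.normSq_mul, Circle.normSq_coe, one_mul]
    unfold ker1
    rw [rotation_apply, this, map_mul, mul_pow, mul_pow]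
    linear_combination (z ^ a * (starRingEnd ℂ z) ^ b *
      ((Real.exp (-Complex.normSq z / h) : ℝ) : ℂ)) * hfac
  simp_rw [h2] at h1
  rw [integral_neg] at h1
  have : (2:ℂ) * ∫ z, ker1 h a b z = 0 := by linear_combination -h1
  simpa using this

lemma kerN_integral {n : ℕ} {h : ℝ} (hh : 0 < h) (α β : Fin n →₀ ℕ) :
    ∫ x : Fin n → ℂ, ∏ i, ker1 h (α i) (β i) (x i) = if α = β then (wtN h α : ℂ) else 0 := by
  rw [integral_fintype_prod_volume_eq_prod (fun i => ker1 h (α i) (β i))]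
  split_ifs with hab
  · subst hab
    simp_rw [ker1_diag hh]
    unfold wtN
    push_cast
    rfl
  · obtain ⟨i, hi⟩ := Finsupp.ne_iff.mp hab
    exact Finset.prod_eq_zero (Finset.mem_univ i) (ker1_off _ _ hi)

lemma kerN_int {n : ℕ} {h : ℝ} (hh : 0 < h) (α β : Fin n →₀ ℕ) :
    Integrable (fun x : Fin n → ℂ => ∏ i, ker1 h (α i) (β i) (x i)) :=
  Integrable.fintype_prod (f := fun i => ker1 h (α i) (β i)) (fun i => ker1_int hh _ _)

lemma norm_formula {n : ℕ} {h : ℝ} (hh : 0 < h) (u : MvPolynomial (Fin n) ℂ) :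
    hPhiNorm h (evalPoly u) ^ 2 = ∑ α ∈ u.support, ‖u.coeff α‖ ^ 2 * wtN h α := by
  unfold hPhiNorm
  rw [Real.sq_sqrt (integral_nonneg fun x => by positivity)]
  have key : ∀ x : Fin n → ℂ, ((‖evalPoly u x‖ ^ 2 * Real.exp (-eNormSq x / h) : ℝ) : ℂ) =
      ∑ α ∈ u.support, ∑ β ∈ u.support, (u.coeff α * starRingEnd ℂ (u.coeff β)) *
        ∏ i, ker1 h (α i) (β i) (x i) := by
    intro x
    have he : (Real.exp (-eNormSq x / h) : ℝ) = ∏ i, Real.exp (-Complex.normSq (x i) / h) := by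
      rw [← Real.exp_sum, ← Finset.sum_div, Finset.sum_neg_distrib]; rfl
    rw [← Complex.normSq_eq_norm_sq, Complex.ofReal_mul, Complex.normSq_eq_conj_mul_self, he]
    unfold evalPoly
    rw [MvPolynomial.eval_eq', map_sum, mul_comm (∑ _ ∈ _, _), Finset.sum_mul_sum, Finset.sum_mul]
    refine Finset.sum_congr rfl fun α _ => ?_
    rw [Finset.sum_mul]
    refine Finset.sum_congr rfl fun β _ => ?_
    unfold ker1
    rw [Finset.prod_mul_distrib, Finset.prod_mul_distrib, map_mul, map_prod]
    simp_rw [map_pow]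
    push_cast
    ring
  have : ((∫ x : Fin n → ℂ, ‖evalPoly u x‖ ^ 2 * Real.exp (-eNormSq x / h) : ℝ) : ℂ) =
      ((∑ α ∈ u.support, ‖u.coeff α‖ ^ 2 * wtN h α : ℝ) : ℂ) := by
    rw [← integral_complex_ofReal]
    simp_rw [key]
    rw [integral_finsetSum _ fun α _ => integrable_finsetSum _ fun β _ => (kerN_int hh α β).const_mul _]
    push_cast
    refine Finset.sum_congr rfl fun α hα => ?_
    rw [integral_finsetSum _ fun β _ => (kerN_int hh α β).const_mul _]
    simp_rw [integral_const_mul, kerN_integral hh]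
    simp only [mul_ite, mul_zero]
    rw [Finset.sum_ite_eq, if_pos hα, Complex.mul_conj, Complex.normSq_eq_norm_sq]
    push_cast
    rfl
  exact_mod_cast this

/-- lowered multi-index -/
noncomputable def lowIdx {n : ℕ} (α : Fin n →₀ ℕ) (k : Fin n) : Fin n →₀ ℕ :=
  α - Finsupp.single k 1

/-- shifted multi-index -/
noncomputable def shiftIdx {n : ℕ} (α : Fin n →₀ ℕ) (k j : Fin n) : Fin n →₀ ℕ :=
  α - Finsupp.single k 1 + Finsupp.single j 1

def idxW {n : ℕ} (α : Fin n →₀ ℕ) : ℕ := ∑ i : Fin n, (i : ℕ) * α i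
def idxD {n : ℕ} (α : Fin n →₀ ℕ) : ℕ := ∑ i, α i

lemma shift_add {n : ℕ} (α : Fin n →₀ ℕ) (k j : Fin n) (hk : k ∈ α.support) :
    shiftIdx α k j + Finsupp.single k 1 = α + Finsupp.single j 1 := by
  unfold shiftIdx
  have : Finsupp.single k 1 ≤ α := by
    rw [Finsupp.single_le_iff]
    exact Nat.one_le_iff_ne_zero.mpr (Finsupp.mem_support_iff.mp hk)
  rw [add_right_comm, tsub_add_cancel_of_le this]

lemma idxW_add {n : ℕ} (α β : Fin n →₀ ℕ) : idxW (α + β) = idxW α + idxW β := by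
  simp [idxW, mul_add, Finset.sum_add_distrib]

lemma idxD_add {n : ℕ} (α β : Fin n →₀ ℕ) : idxD (α + β) = idxD α + idxD β := by
  simp [idxD, Finset.sum_add_distrib]

lemma idxW_single {n : ℕ} (j : Fin n) : idxW (Finsupp.single j 1) = j := by
  simp [idxW, Finsupp.single_apply]

lemma idxD_single {n : ℕ} (j : Fin n) : idxD (Finsupp.single j 1) = 1 := by
  simp [idxD, Finsupp.single_apply]

lemma coeff_formula {n : ℕ} (lam γ : Fin n → ℂ) (h : ℝ) (z : ℂ) (u : MvPolynomial (Fin n) ℂ)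
    (α : Fin n →₀ ℕ) :
    (MvPolynomial.C z * u - qOp n lam γ h u).coeff α =
      (z - (h : ℂ) / Complex.I * ∑ j, lam j * (2 * (α j : ℂ) + 1)) * u.coeff α
      - (h : ℂ) / Complex.I * ∑ j : Fin n, (if hj : (j : ℕ) + 1 < n then
          γ j * (if (⟨(j : ℕ) + 1, hj⟩ : Fin n) ∈ α.support then
            u.coeff (shiftIdx α ⟨(j : ℕ) + 1, hj⟩ j) *
              ((lowIdx α ⟨(j : ℕ) + 1, hj⟩ j : ℂ) + 1) else 0) else 0) := by
  have h1 : ∀ j : Fin n, (MvPolynomial.C (2 * lam j) * MvPolynomial.X j *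
      MvPolynomial.pderiv j u).coeff α = 2 * lam j * (α j : ℂ) * u.coeff α := by
    intro j
    rw [mul_assoc, MvPolynomial.coeff_C_mul, MvPolynomial.coeff_X_mul']
    split_ifs with hs
    · rw [MvPolynomial.coeff_pderiv]
      have hs' := Finsupp.mem_support_iff.mp hs
      have : α - Finsupp.single j 1 + Finsupp.single j 1 = α := by
        apply tsub_add_cancel_of_le
        rw [Finsupp.single_le_iff]; exact Nat.one_le_iff_ne_zero.mpr hs'
      rw [this]
      have h3 : ((lowIdx α j j : ℕ) : ℂ) + 1 = α j := by
        have : lowIdx α j j + 1 = α j := by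
          simp [lowIdx]; omega
        exact_mod_cast this
      change _ * (_ * (((lowIdx α j j : ℕ) : ℂ) + 1)) = _
      rw [h3]; ring
    · have : α j = 0 := by simpa using hs
      simp [this]
  unfold qOp
  rw [MvPolynomial.coeff_sub, MvPolynomial.coeff_C_mul, MvPolynomial.coeff_C_mul,
    MvPolynomial.coeff_add, MvPolynomial.coeff_add, MvPolynomial.coeff_sum,
    MvPolynomial.coeff_sum, MvPolynomial.coeff_C_mul]
  simp_rw [h1]
  have h2 : ∀ j : Fin n, (if hj : (j : ℕ) + 1 < n then
            MvPolynomial.C (γ j) * MvPolynomial.X (⟨(j : ℕ) + 1, hj⟩ : Fin n)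
              * MvPolynomial.pderiv j u
          else 0).coeff α = (if hj : (j : ℕ) + 1 < n then
          γ j * (if (⟨(j : ℕ) + 1, hj⟩ : Fin n) ∈ α.support then
            u.coeff (shiftIdx α ⟨(j : ℕ) + 1, hj⟩ j) *
              ((lowIdx α ⟨(j : ℕ) + 1, hj⟩ j : ℂ) + 1) else 0) else 0) := by
    intro j
    by_cases hj : (j : ℕ) + 1 < n
    · rw [dif_pos hj, dif_pos hj, mul_assoc, MvPolynomial.coeff_C_mul, MvPolynomial.coeff_X_mul',
        MvPolynomial.coeff_pderiv]
      rfl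
    · rw [dif_neg hj, dif_neg hj, MvPolynomial.coeff_zero]
  simp_rw [h2]
  have h4 : ∑ j, lam j * (2 * (α j : ℂ) + 1) =
      (∑ j, 2 * lam j * (α j : ℂ)) + ∑ j, lam j := by
    rw [← Finset.sum_add_distrib]
    exact Finset.sum_congr rfl fun j _ => by ring
  rw [h4, ← Finset.sum_mul]
  ring

lemma coeff_bound_s13 {n : ℕ} (lam γ : Fin n → ℂ) (hγ : ∀ j, γ j = 0 ∨ γ j = 1) (h : ℝ) (hh : 0 < h)
    (z : ℂ) (u : MvPolynomial (Fin n) ℂ) (N : ℕ) (M₀ K V : ℝ)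
    (hM : (N : ℝ) * h ≤ M₀) (hM₀ : 0 < M₀) (hK1 : 1 ≤ K) (hV : 0 ≤ V)
    (hK : ∀ α : Fin n →₀ ℕ,
      1 ≤ K * ‖z - (h : ℂ) / Complex.I * ∑ j, lam j * (2 * (α j : ℂ) + 1)‖)
    (hv : ∀ α : Fin n →₀ ℕ, idxD α < N →
      ‖(MvPolynomial.C z * u - qOp n lam γ h u).coeff α‖ ≤ V) :
    ∀ w : ℕ, ∀ α : Fin n →₀ ℕ, idxW α < w → idxD α < N →
      ‖u.coeff α‖ ≤ ((1 + n * M₀) * K) ^ w * V := by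
  intro w
  induction w with
  | zero => intro α h0; omega
  | succ w ih =>
    intro α hw hD
    set ρ := (1 + n * M₀) * K with hρ
    have hn1 : 1 ≤ 1 + n * M₀ := by
      have : 0 ≤ n * M₀ := by positivity
      linarith
    have hρ1 : 1 ≤ ρ := one_le_mul_of_one_le_of_one_le hn1 hK1
    have hρw : 1 ≤ ρ ^ w := one_le_pow₀ hρ1
    have hf := coeff_formula lam γ h z u α
    set μ := z - (h : ℂ) / Complex.I * ∑ j, lam j * (2 * (α j : ℂ) + 1) with hμ
    set S := ∑ j : Fin n, (if hj : (j : ℕ) + 1 < n then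
          γ j * (if (⟨(j : ℕ) + 1, hj⟩ : Fin n) ∈ α.support then
            u.coeff (shiftIdx α ⟨(j : ℕ) + 1, hj⟩ j) *
              ((lowIdx α ⟨(j : ℕ) + 1, hj⟩ j : ℂ) + 1) else 0) else 0)
      with hS
    have hSb : ‖S‖ ≤ n * (N * (ρ ^ w * V)) := by
      have : ∀ j ∈ (Finset.univ : Finset (Fin n)), ‖(if hj : (j : ℕ) + 1 < n then
          γ j * (if (⟨(j : ℕ) + 1, hj⟩ : Fin n) ∈ α.support then
            u.coeff (shiftIdx α ⟨(j : ℕ) + 1, hj⟩ j) *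
              ((lowIdx α ⟨(j : ℕ) + 1, hj⟩ j : ℂ) + 1) else 0) else 0)‖
          ≤ N * (ρ ^ w * V) := by
        intro j _
        have hnn : 0 ≤ N * (ρ ^ w * V) := by positivity
        split_ifs with hj hk
        · have hadd := shift_add α _ j hk
          have e1 := congrArg idxW hadd
          have e2 := congrArg idxD hadd
          rw [idxW_add, idxW_add, idxW_single, idxW_single] at e1
          rw [idxD_add, idxD_add, idxD_single, idxD_single] at e2
          simp only at e1
          have b := ih (shiftIdx α ⟨(j : ℕ) + 1, hj⟩ j) (by omega) (by omega)
          have hg : ‖γ j‖ ≤ 1 := by rcases hγ j with H | H <;> simp [H]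
          have hc : ‖((lowIdx α ⟨(j : ℕ) + 1, hj⟩ j : ℂ) + 1)‖ ≤ N := by
            have h5 : lowIdx α ⟨(j : ℕ) + 1, hj⟩ j ≤ α j := by simp [lowIdx]
            have h6 : α j ≤ idxD α :=
              Finset.single_le_sum (f := fun i => α i) (fun _ _ => Nat.zero_le _)
                (Finset.mem_univ j)
            have h7 : lowIdx α ⟨(j : ℕ) + 1, hj⟩ j + 1 ≤ N := by omega
            have h8 : ((lowIdx α ⟨(j : ℕ) + 1, hj⟩ j : ℂ) + 1) =
              ((lowIdx α ⟨(j : ℕ) + 1, hj⟩ j + 1 : ℕ) : ℂ) := by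
              push_cast; rfl
            rw [h8, Complex.norm_natCast]
            exact_mod_cast h7
          rw [norm_mul, norm_mul]
          calc _ ≤ 1 * ((ρ ^ w * V) * N) := by gcongr
            _ = _ := by ring
        · simpa using hnn
        · simpa using hnn
      calc ‖S‖ ≤ ∑ j : Fin n, N * (ρ ^ w * V) := norm_sum_le_of_le _ this
        _ = _ := by simp
    have hμu : ‖μ‖ * ‖u.coeff α‖ ≤ V + h * (n * (N * (ρ ^ w * V))) := by
      rw [← norm_mul]
      have e : μ * u.coeff α = (MvPolynomial.C z * u - qOp n lam γ h u).coeff α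
          + (h : ℂ) / Complex.I * S := by rw [hf]; ring
      rw [e]
      refine (norm_add_le _ _).trans (add_le_add (hv α hD) ?_)
      rw [norm_mul, norm_div, Complex.norm_I, div_one, Complex.norm_real,
        Real.norm_of_nonneg hh.le]
      gcongr
    have hfin : V + h * (n * (N * (ρ ^ w * V))) ≤ (1 + n * M₀) * (ρ ^ w * V) := by
      have a1 : V ≤ ρ ^ w * V := le_mul_of_one_le_left hV hρw
      have a2 : (N * h) * (n * (ρ ^ w * V)) ≤ M₀ * (n * (ρ ^ w * V)) := by gcongr
      nlinarith
    calc ‖u.coeff α‖ ≤ (K * ‖μ‖) * ‖u.coeff α‖ := le_mul_of_one_le_left (norm_nonneg _) (hK α)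
      _ = K * (‖μ‖ * ‖u.coeff α‖) := by ring
      _ ≤ K * ((1 + n * M₀) * (ρ ^ w * V)) := mul_le_mul_of_nonneg_left (hμu.trans hfin) (by linarith)
      _ = ρ ^ (w+1) * V := by rw [pow_succ, hρ]; ring

lemma wtN_pos {n : ℕ} {h : ℝ} (hh : 0 < h) (α : Fin n →₀ ℕ) : 0 < wtN h α :=
  Finset.prod_pos fun i _ => wt1_pos hh _

lemma wtN_lower {n : ℕ} {h : ℝ} (hh : 0 < h) (h1 : h ≤ 1) (α : Fin n →₀ ℕ) (N : ℕ)
    (hD : idxD α < N) : Real.pi ^ n * h ^ (N + n) ≤ wtN h α := by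
  have e : ∏ i : Fin n, (Real.pi * h ^ (α i + 1)) = Real.pi ^ n * h ^ (idxD α + n) := by
    rw [Finset.prod_mul_distrib, Finset.prod_pow_eq_pow_sum, Finset.sum_add_distrib]
    simp [idxD]
  calc Real.pi ^ n * h ^ (N + n) ≤ Real.pi ^ n * h ^ (idxD α + n) := by
        have := pow_le_pow_of_le_one hh.le h1 (show idxD α + n ≤ N + n by omega)
        gcongr
    _ = ∏ i : Fin n, (Real.pi * h ^ (α i + 1)) := e.symm
    _ ≤ wtN h α := by
      unfold wtN wt1
      refine Finset.prod_le_prod (fun i _ => by positivity) fun i _ => ?_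
      have : (1:ℝ) ≤ (α i).factorial := by exact_mod_cast Nat.factorial_pos _
      exact le_mul_of_one_le_right (by positivity) this

lemma idx_le {n : ℕ} (α : Fin n →₀ ℕ) (i : Fin n) : α i ≤ idxD α :=
  Finset.single_le_sum (f := fun i => α i) (fun _ _ => Nat.zero_le _) (Finset.mem_univ i)

lemma wtN_upper {n : ℕ} {h : ℝ} (hh : 0 < h) (h1 : h ≤ 1) (α : Fin n →₀ ℕ) (N : ℕ)
    (hD : idxD α < N) : wtN h α ≤ Real.pi ^ n * (N:ℝ) ^ (N * n) := by
  calc wtN h α ≤ ∏ i : Fin n, (Real.pi * (N:ℝ) ^ N) := by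
        refine Finset.prod_le_prod (fun i _ => (wt1_pos hh _).le) fun i _ => ?_
        unfold wt1
        have a1 : h ^ (α i + 1) ≤ 1 := pow_le_one₀ hh.le h1
        have a2 : ((α i).factorial : ℝ) ≤ (N:ℝ) ^ N := by
          have := (Nat.factorial_le (show α i ≤ N by have := idx_le α i; omega)).trans
            (Nat.factorial_le_pow N)
          exact_mod_cast this
        calc Real.pi * h ^ (α i + 1) * ((α i).factorial : ℝ) ≤ Real.pi * 1 * (N:ℝ) ^ N := by
              gcongr
          _ = _ := by ring
    _ = _ := by simp [mul_pow, pow_mul]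

lemma idxW_le {n : ℕ} (α : Fin n →₀ ℕ) : idxW α ≤ n * idxD α := by
  unfold idxW idxD
  rw [Finset.mul_sum]
  exact Finset.sum_le_sum fun i _ => Nat.mul_le_mul_right _ i.2.le

lemma supp_D {n : ℕ} (u : MvPolynomial (Fin n) ℂ) (N : ℕ) (hu : u.totalDegree < N)
    (α : Fin n →₀ ℕ) (hα : α ∈ u.support) : idxD α < N := by
  have := MvPolynomial.le_totalDegree hα
  rw [Finsupp.sum_fintype _ _ (by simp)] at this
  exact lt_of_le_of_lt this hu

lemma supp_card {n : ℕ} (u : MvPolynomial (Fin n) ℂ) (N : ℕ) (hu : u.totalDegree < N) :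
    u.support.card ≤ N ^ n := by
  have : u.support.card ≤ (Fintype.piFinset (fun _ : Fin n => Finset.range N)).card := by
    apply Finset.card_le_card_of_injOn (fun α i => α i)
    · intro α hα
      simp only [Finset.mem_coe, Fintype.mem_piFinset, Finset.mem_range]
      intro i
      exact lt_of_le_of_lt (idx_le α i) (supp_D u N hu α hα)
    · intro α _ β _ hab
      exact DFunLike.coe_injective hab
  simpa using this

lemma norm_bound {n : ℕ} (lam γ : Fin n → ℂ) (hγ : ∀ j, γ j = 0 ∨ γ j = 1) (h : ℝ) (hh : 0 < h)
    (h1 : h ≤ 1)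
    (z : ℂ) (u : MvPolynomial (Fin n) ℂ) (N : ℕ) (M₀ K : ℝ)
    (hM : (N : ℝ) * h ≤ M₀) (hM₀ : 0 < M₀) (hK1 : 1 ≤ K)
    (hK : ∀ α : Fin n →₀ ℕ,
      1 ≤ K * ‖z - (h : ℂ) / Complex.I * ∑ j, lam j * (2 * (α j : ℂ) + 1)‖)
    (hu : u.totalDegree < N) :
    hPhiNorm h (evalPoly u) ^ 2 ≤ ((N:ℝ) ^ (n + N * n) *
      ((1 + n * M₀) * K) ^ (2 * (n * N + 1)) * (1 / h) ^ (N + n)) *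
      hPhiNorm h (evalPoly (MvPolynomial.C z * u - qOp n lam γ h u)) ^ 2 := by
  set v := MvPolynomial.C z * u - qOp n lam γ h u with hv
  set Y := hPhiNorm h (evalPoly v) with hY
  have hY0 : 0 ≤ Y := Real.sqrt_nonneg _
  set c := Real.pi ^ n * h ^ (N + n) with hc
  have hc0 : 0 < c := by positivity
  have hV : 0 ≤ Y / Real.sqrt c := by positivity
  have hV2 : (Y / Real.sqrt c) ^ 2 = Y ^ 2 / c := by rw [div_pow, Real.sq_sqrt hc0.le]
  have hvb : ∀ α : Fin n →₀ ℕ, idxD α < N → ‖v.coeff α‖ ≤ Y / Real.sqrt c := by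
    intro α hα
    apply abs_le_of_sq_le_sq' _ hV |>.2
    rw [hV2, le_div_iff₀ hc0]
    by_cases hs : α ∈ v.support
    · calc ‖v.coeff α‖ ^ 2 * c ≤ ‖v.coeff α‖ ^ 2 * wtN h α := by
            gcongr; exact wtN_lower hh h1 α N hα
        _ ≤ Y ^ 2 := by
          rw [hY, norm_formula hh]
          exact Finset.single_le_sum (f := fun α => ‖v.coeff α‖ ^ 2 * wtN h α)
            (fun β _ => mul_nonneg (by positivity) (wtN_pos hh β).le) hs
    · rw [MvPolynomial.notMem_support_iff.mp hs]
      simp; positivity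
  have hub := coeff_bound_s13 lam γ hγ h hh z u N M₀ K _ hM hM₀ hK1 hV hK hvb (n * N + 1)
  set R := ((1 + n * M₀) * K) ^ (n * N + 1) with hR
  have hN0 : (0:ℝ) ≤ N := by positivity
  rw [norm_formula hh u]
  calc ∑ α ∈ u.support, ‖u.coeff α‖ ^ 2 * wtN h α
      ≤ ∑ α ∈ u.support, (R * (Y / Real.sqrt c)) ^ 2 * (Real.pi ^ n * (N:ℝ) ^ (N * n)) := by
        refine Finset.sum_le_sum fun α hα => ?_
        have hD := supp_D u N hu α hα
        have hW : idxW α < n * N + 1 := by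
          have := idxW_le α
          have := Nat.mul_le_mul_left n hD.le
          omega
        have := hub α hW hD
        have := wtN_upper hh h1 α N hD
        have := (wtN_pos hh α).le
        gcongr
    _ = (u.support.card : ℝ) * ((R * (Y / Real.sqrt c)) ^ 2 *
          (Real.pi ^ n * (N:ℝ) ^ (N * n))) := by simp
    _ ≤ (N:ℝ) ^ n * ((R * (Y / Real.sqrt c)) ^ 2 * (Real.pi ^ n * (N:ℝ) ^ (N * n))) := by
        have : (u.support.card : ℝ) ≤ (N:ℝ) ^ n := by exact_mod_cast supp_card u N hu
        gcongr
    _ = _ := by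
        rw [mul_pow, hV2, hc, pow_add (N:ℝ) n, mul_comm 2 (n * N + 1),
          pow_mul ((1 + n * M₀) * K), ← hR, one_div, inv_pow]
        field_simp

lemma const_exp {q s l : ℝ} (hq : 1 ≤ q) (hl : 1 ≤ l) :
    q * Real.exp (s * l) ≤ Real.exp ((Real.log q + s) * l) := by
  have h0 : 0 ≤ Real.log q := Real.log_nonneg hq
  calc q * Real.exp (s * l) = Real.exp (Real.log q + s * l) := by
        rw [Real.exp_add, Real.exp_log (by linarith)]
    _ ≤ _ := by
      apply Real.exp_le_exp.mpr
      nlinarith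

set_option maxHeartbeats 2000000

/-- For all `M₀ > 0`, `C > 0`, `L ≥ 1` there are `A > 0`, `h₀ > 0` such that for
all `h ∈ (0,h₀]`, all integers `N ≥ 1` with `Nh ≤ M₀`, all `z` with
`dist(z, {μ_α}) ≥ h^L/C`, and every polynomial `u` of degree `< N`,
`‖u‖_{H_Φ} ≤ A exp(A h⁻¹ log(1/h)) ‖(z − Q_h)u‖_{H_Φ}`. -/
theorem statement_13 {n : ℕ} (lam : Fin n → ℂ) (hlam : ∀ j, 0 < (lam j).im)
    (γ : Fin n → ℂ) (hγ : ∀ j, γ j = 0 ∨ γ j = 1)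
    (M₀ C : ℝ) (hM₀ : 0 < M₀) (hC : 0 < C) (L : ℝ) (hL : 1 ≤ L) :
    ∃ A > 0, ∃ h₀ > 0, ∀ h : ℝ, 0 < h → h ≤ h₀ →
      ∀ N : ℕ, 1 ≤ N → (N : ℝ) * h ≤ M₀ →
      ∀ z : ℂ, h ^ L / C ≤ Metric.infDist z (specQ n lam h) →
      ∀ u : MvPolynomial (Fin n) ℂ, u.totalDegree < N →
        hPhiNorm h (evalPoly u) ≤
          A * Real.exp (A / h * Real.log (1 / h)) *
            hPhiNorm h (evalPoly (MvPolynomial.C z * u - qOp n lam γ h u)) := by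

  set a : ℝ := Real.log (1 + M₀) + 1 with ha
  set q : ℝ := (1 + n * M₀) * (1 + C) with hq
  set b : ℝ := Real.log q + L with hb
  have hnM : 0 ≤ n * M₀ := by positivity
  have hq1 : 1 ≤ q := one_le_mul_of_one_le_of_one_le (by linarith) (by linarith)
  have ha0 : 0 ≤ a := by
    have := Real.log_nonneg (show 1 ≤ 1 + M₀ by linarith)
    linarith
  have hb0 : 0 ≤ b := by
    have := Real.log_nonneg hq1
    linarith
  set B : ℝ := a * (n + M₀ * n) + b * (2 * (n * M₀ + 1)) + (M₀ + n) + 1 with hB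
  have hB1 : 1 ≤ B := by
    have : 0 ≤ a * (n + M₀ * n) + b * (2 * (n * M₀ + 1)) + (M₀ + n) := by positivity
    linarith
  refine ⟨B, by linarith, Real.exp (-1), Real.exp_pos _, ?_⟩
  intro h hh hh0 N hN hNM z hz u hu
  have h1 : h ≤ 1 := hh0.trans (by rw [Real.exp_le_one_iff]; norm_num)
  set l := Real.log (1 / h) with hl
  have hlog : Real.log h = -l := by rw [hl, one_div, Real.log_inv]; ring
  have hl1 : 1 ≤ l := by
    have := Real.log_le_log hh hh0
    rw [Real.log_exp, hlog] at this
    linarith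
  have ht : 1 / h = Real.exp l := by rw [hl, Real.exp_log (by positivity)]
  have ht1 : 1 ≤ 1 / h := by rw [le_div_iff₀ hh]; linarith
  set K : ℝ := (1 + C) * Real.exp (L * l) with hKdef
  have hhL : h ^ L = Real.exp (-(L * l)) := by
    rw [Real.rpow_def_of_pos hh, hlog]; congr 1; ring
  have hK1 : 1 ≤ K := by
    apply one_le_mul_of_one_le_of_one_le (by linarith)
    rw [Real.one_le_exp_iff]
    nlinarith
  have hK : ∀ α : Fin n →₀ ℕ,
      1 ≤ K * ‖z - (h : ℂ) / Complex.I * ∑ j, lam j * (2 * (α j : ℂ) + 1)‖ := by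
    intro α
    have hm : (h : ℂ) / Complex.I * ∑ j, lam j * (2 * (α j : ℂ) + 1) ∈ specQ n lam h :=
      ⟨fun j => α j, rfl⟩
    have hd := hz.trans (Metric.infDist_le_dist_of_mem hm)
    rw [dist_eq_norm] at hd
    calc 1 ≤ (1 + C) / C := by rw [le_div_iff₀ hC]; linarith
      _ = K * (h ^ L / C) := by
        rw [hKdef, hhL, Real.exp_neg]
        field_simp
      _ ≤ _ := mul_le_mul_of_nonneg_left hd (by linarith)
  have main := norm_bound lam γ hγ h hh h1 z u N M₀ K hNM hM₀ hK1 hK hu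
  set X := hPhiNorm h (evalPoly u)
  set Y := hPhiNorm h (evalPoly (MvPolynomial.C z * u - qOp n lam γ h u))
  have hY0 : 0 ≤ Y := Real.sqrt_nonneg _
  have hNt : (N:ℝ) ≤ M₀ * (1 / h) := by rw [mul_one_div, le_div_iff₀ hh]; exact hNM
  have hNe : (N:ℝ) ≤ Real.exp (a * l) := by
    calc (N:ℝ) ≤ (1 + M₀) * Real.exp (1 * l) := by
          rw [one_mul, ← ht]
          nlinarith
      _ ≤ _ := const_exp (by linarith) hl1
  have hρe : (1 + n * M₀) * K ≤ Real.exp (b * l) := by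
    calc (1 + n * M₀) * K = q * Real.exp (L * l) := by rw [hKdef, hq]; ring
      _ ≤ _ := const_exp hq1 hl1
  have hρ0 : 0 ≤ (1 + n * M₀) * K := by positivity
  have hbig : (N:ℝ) ^ (n + N * n) * ((1 + n * M₀) * K) ^ (2 * (n * N + 1)) * (1 / h) ^ (N + n)
      ≤ Real.exp (B / h * l) := by
    rw [ht]
    calc _ ≤ Real.exp (a * l) ^ (n + N * n) * Real.exp (b * l) ^ (2 * (n * N + 1)) *
          Real.exp l ^ (N + n) := by gcongr
      _ = Real.exp ((a * (n + N * n) + b * (2 * (n * N + 1)) + (N + n)) * l) := by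
        rw [← Real.exp_nat_mul, ← Real.exp_nat_mul, ← Real.exp_nat_mul, ← Real.exp_add,
          ← Real.exp_add]
        congr 1
        push_cast
        ring
      _ ≤ _ := by
        apply Real.exp_le_exp.mpr
        apply mul_le_mul_of_nonneg_right _ (by linarith)
        set t := 1 / h with htdef
        have e : B / h = a * (n * t + (M₀ * t) * n) + b * (2 * (n * (M₀ * t) + 1 * t)) +
            (M₀ * t + n * t) + t := by
          rw [div_eq_mul_one_div, ← htdef, hB]; ring
        rw [e]
        have n1 : (n:ℝ) ≤ n * t := le_mul_of_one_le_right (by positivity) ht1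
        have n2 : (1:ℝ) ≤ 1 * t := by linarith
        have n3 : 0 ≤ t := by linarith
        calc _ ≤ a * (n * t + (M₀ * t) * n) + b * (2 * (n * (M₀ * t) + 1 * t)) +
            (M₀ * t + n * t) := by gcongr
          _ ≤ _ := by linarith
  set E := Real.exp (B / h * l) with hE
  have hE1 : 1 ≤ E := by
    rw [hE, Real.one_le_exp_iff]
    have : 0 < B := by linarith
    positivity
  have hBE : E ≤ B * E := le_mul_of_one_le_left (by linarith) hB1
  apply abs_le_of_sq_le_sq' _ (by positivity) |>.2
  calc X ^ 2 ≤ E * Y ^ 2 := main.trans (by gcongr)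
    _ ≤ (B * E) ^ 2 * Y ^ 2 := by
      gcongr
      nlinarith
    _ = _ := by ring
end
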